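/- Every finite field has property B1: for every proper regular integral curve C over a finite field k, the Brauer group Br(C) vanishes. -/

import Mathlib

universe u

open TensorProduct

/-- `A` is a finite-dimensional central simple algebra over the field `F`. -/
def IsCSA (F A : Type u) [Field F] [Ring A] [Algebra F A] : Prop :=
  FiniteDimensional F A ∧ Algebra.IsCentral F A ∧ IsSimpleRing A

/-- `A` is split over `F`, i.e. isomorphic to a matrix algebra over `F`
(its Brauer class is trivial). -/
def IsMatrixAlgebra (F A : Type u) [Field F] [Ring A] [Algebra F A] : Prop :=
  ∃ n : ℕ, 0 < n ∧ Nonempty (A ≃ₐ[F] Matrix (Fin n) (Fin n) F)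

/-- The Brauer group of the field `F` is trivial: every finite-dimensional central
simple `F`-algebra is a matrix algebra. -/
def BrauerTrivial (F : Type u) [Field F] : Prop :=
  ∀ (A : Type u) [Ring A] [Algebra F A], IsCSA F A → IsMatrixAlgebra F A

/-- `A` and `B` have the same Brauer class over `F`. -/
def BrauerEquiv (F A B : Type u) [Field F] [Ring A] [Algebra F A] [Ring B] [Algebra F B] :
    Prop :=
  ∃ n m : ℕ, 0 < n ∧ 0 < m ∧
    Nonempty (Matrix (Fin n) (Fin n) A ≃ₐ[F] Matrix (Fin m) (Fin m) B)

/-- `A₀` is an Azumaya algebra over the local ring `O`: it is a finite free `O`-algebra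
whose reduction modulo the maximal ideal is a central simple algebra over the residue
field. -/
def IsAzumayaOver (O A₀ : Type u) [CommRing O] [IsLocalRing O] [Ring A₀] [Algebra O A₀] :
    Prop :=
  Module.Free O A₀ ∧ Module.Finite O A₀ ∧
    IsCSA (IsLocalRing.ResidueField O) ((IsLocalRing.ResidueField O) ⊗[O] A₀)

/-- A central simple algebra `D` over `F` is unramified at a valuation subring `O` of `F`
if it extends to an Azumaya algebra over `O`. -/
def UnramifiedAt (F : Type u) [Field F] (O : ValuationSubring F) (D : Type u) [Ring D]
    [Algebra F D] : Prop :=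
  ∃ (A₀ : Type u) (_ : Ring A₀) (_ : Algebra O A₀),
    IsAzumayaOver O A₀ ∧ Nonempty ((F ⊗[↥O] A₀) ≃ₐ[F] D)

/-- `F` is the function field of a proper regular integral (not necessarily geometrically
integral) curve over `k`: a finitely generated field extension of `k` of transcendence
degree 1. -/
def IsCurveFunctionField (k F : Type u) [Field k] [Field F] [Algebra k F] : Prop :=
  (∃ s : Finset F, IntermediateField.adjoin k (s : Set F) = ⊤) ∧
  (∃ x : F, Transcendental k x ∧
    Algebra.IsAlgebraic (IntermediateField.adjoin k ({x} : Set F)) F)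

/-- `k` has property B₁: for every proper regular integral curve `C` over `k`, the
cohomological Brauer group `Br(C)` vanishes.  Since for a regular proper curve `C/k`
one has `Br(C) = ⋂ₓ Br(O_{C,x}) ⊆ Br(k(C))` — the subgroup of classes of the function
field `k(C)` unramified at every valuation of `k(C)` trivial on `k` — this is expressed
as: every central simple algebra over such a function field which is unramified at every
`k`-valuation subring is split. -/
def IsB1 (k : Type u) [Field k] : Prop :=
  ∀ (F : Type u) [Field F] [Algebra k F], IsCurveFunctionField k F →
    ∀ (D : Type u) [Ring D] [Algebra F D], IsCSA F D →
      (∀ O : ValuationSubring F, (∀ c : k, algebraMap k F c ∈ O) → UnramifiedAt F O D) →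
      IsMatrixAlgebra F D

section
namespace B1

open Finset in
/-- geometric-periodic sequences have rational generating series -/
lemma mk_mul_of_periodic (m : ℕ → ℚ) (T d1 : ℕ) (r : ℚ)
    (h0 : ∀ d < d1, m d = 0) (hm : ∀ d ≥ d1, m (d + T) = r * m d) :
    PowerSeries.mk m * (1 - PowerSeries.C r * PowerSeries.X ^ T) =
      ((∑ d ∈ range (d1 + T), Polynomial.C (m d) * Polynomial.X ^ d : Polynomial ℚ) :
        PowerSeries ℚ) := by
  ext e
  rw [mul_sub, mul_one, map_sub, mul_left_comm, PowerSeries.coeff_C_mul,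
    PowerSeries.coeff_mul_X_pow', Polynomial.coeff_coe]
  simp only [PowerSeries.coeff_mk, Polynomial.finsetSum_coeff, Polynomial.coeff_C_mul,
    Polynomial.coeff_X_pow, mul_ite, mul_one, mul_zero]
  rw [Finset.sum_ite_eq]
  simp only [mem_range]
  by_cases he : e < d1 + T
  · rw [if_pos he]
    by_cases hT : T ≤ e
    · rw [if_pos hT, h0 (e - T) (by omega)]; simp
    · simp [hT]
  · rw [if_neg he, if_pos (by omega)]
    have := hm (e - T) (by omega)
    rw [show e - T + T = e by omega] at this
    rw [this]; ring

open Finset in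
lemma exists_poly (a : ℕ → ℚ) (Q χ : ℚ) (hQ : 1 < Q) (hχ : 0 < χ) (T d0 : ℕ) (hT : 0 < T)
    (ha : ∀ d ≥ d0, a d * (χ * Q ^ (d + T) - 1) = a (d + T) * (χ * Q ^ d - 1)) :
    ∃ P : Polynomial ℚ, (P : PowerSeries ℚ) = PowerSeries.mk a *
        ((1 - PowerSeries.X ^ T) * (1 - PowerSeries.C (Q ^ T) * PowerSeries.X ^ T)) ∧
      ((∀ d, 0 ≤ a d) → (∀ N, ∃ d ≥ N, a d ≠ 0) → P.eval 1 ≠ 0 ∧ P.eval Q⁻¹ ≠ 0) := by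
  classical
  obtain ⟨d2, hd2⟩ : ∃ d2 : ℕ, 1 / χ < Q ^ d2 := pow_unbounded_of_one_lt _ hQ
  set d1 := max d0 d2 with hd1
  have hpos : ∀ d ≥ d1, 0 < χ * Q ^ d - 1 := by
    intro d hd
    have h1 : Q ^ d2 ≤ Q ^ d := pow_le_pow_right₀ hQ.le (le_trans (le_max_right _ _) hd)
    have h2 : 1 / χ < Q ^ d := lt_of_lt_of_le hd2 h1
    rw [div_lt_iff₀ hχ] at h2
    linarith
  let m : ℕ → ℚ := fun d => if d < d1 then 0 else a d / (χ * Q ^ d - 1)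
  have m_lt : ∀ d < d1, m d = 0 := fun d hd => by simp [m, hd]
  have m_ge : ∀ d ≥ d1, m d = a d / (χ * Q ^ d - 1) := fun d hd => by
    simp [m, not_lt.mpr hd]
  have m_per : ∀ d ≥ d1, m (d + T) = m d := by
    intro d hd
    rw [m_ge d hd, m_ge (d + T) (by omega), div_eq_div_iff (hpos _ (by omega)).ne' (hpos _ hd).ne',
      ha d (le_trans (le_max_left _ _) hd)]
  let E : Polynomial ℚ := ∑ d ∈ range d1, Polynomial.C (a d) * Polynomial.X ^ d
  let S : Polynomial ℚ := ∑ d ∈ range (d1 + T), Polynomial.C (m d) * Polynomial.X ^ d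
  let S' : Polynomial ℚ := ∑ d ∈ range (d1 + T), Polynomial.C (m d * Q ^ d) * Polynomial.X ^ d
  have hS : PowerSeries.mk m * (1 - PowerSeries.C 1 * PowerSeries.X ^ T) = (S : PowerSeries ℚ) :=
    mk_mul_of_periodic m T d1 1 m_lt (fun d hd => by rw [m_per d hd, one_mul])
  have hS' : PowerSeries.mk (fun d => m d * Q ^ d) *
      (1 - PowerSeries.C (Q ^ T) * PowerSeries.X ^ T) = (S' : PowerSeries ℚ) :=
    mk_mul_of_periodic (fun d => m d * Q ^ d) T d1 (Q ^ T) (fun d hd => by simp [m_lt d hd])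
      (fun d hd => by simp only [m_per d hd]; rw [pow_add]; ring)
  have hA : PowerSeries.mk a = (E : PowerSeries ℚ) +
      PowerSeries.C χ * PowerSeries.mk (fun d => m d * Q ^ d) - PowerSeries.mk m := by
    ext e
    simp only [map_sub, map_add, PowerSeries.coeff_C_mul, PowerSeries.coeff_mk,
      Polynomial.coeff_coe, E, Polynomial.finsetSum_coeff, Polynomial.coeff_C_mul,
      Polynomial.coeff_X_pow, mul_ite, mul_one, mul_zero]
    rw [Finset.sum_ite_eq]
    simp only [mem_range]
    by_cases he : e < d1
    · rw [if_pos he, m_lt e he]; ring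
    · rw [if_neg he, m_ge e (by omega)]
      have := (hpos e (by omega)).ne'
      field_simp
      ring
  refine ⟨E * ((1 - Polynomial.X ^ T) * (1 - Polynomial.C (Q ^ T) * Polynomial.X ^ T)) +
    Polynomial.C χ * S' * (1 - Polynomial.X ^ T) -
    S * (1 - Polynomial.C (Q ^ T) * Polynomial.X ^ T), ?_, ?_⟩
  · rw [hA]
    push_cast
    rw [← hS, ← hS', map_one, one_mul]
    ring
  · intro hnn hne
    have hQT : 1 < Q ^ T := one_lt_pow₀ hQ hT.ne'
    have hmnn : ∀ d, 0 ≤ m d := by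
      intro d
      by_cases hd : d < d1
      · rw [m_lt d hd]
      · rw [m_ge d (by omega)]
        exact div_nonneg (hnn d) (hpos d (by omega)).le
    have hper : ∀ j, ∀ d ≥ d1, m (d + T * j) = m d := by
      intro j
      induction j with
      | zero => intro d _; simp
      | succ j ih => intro d hd; rw [Nat.mul_succ, ← add_assoc, m_per _ (by omega), ih d hd]
    obtain ⟨d, hd, hmd⟩ : ∃ d ∈ range (d1 + T), 0 < m d := by
      obtain ⟨d, hd, had⟩ := hne d1
      refine ⟨d1 + (d - d1) % T, by
        simp only [mem_range]; have := Nat.mod_lt (d - d1) hT; omega, ?_⟩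
      rw [← hper ((d - d1) / T) _ (by omega), add_assoc, Nat.mod_add_div,
        show d1 + (d - d1) = d by omega, m_ge d hd]
      exact div_pos (lt_of_le_of_ne (hnn d) had.symm) (hpos d hd)
    have hsum : 0 < ∑ d ∈ range (d1 + T), m d := Finset.sum_pos' (fun d _ => hmnn d) ⟨d, hd, hmd⟩
    have e1 : S.eval 1 = ∑ d ∈ range (d1 + T), m d := by simp [S, Polynomial.eval_finsetSum]
    have e2 : S'.eval Q⁻¹ = ∑ d ∈ range (d1 + T), m d := by
      simp only [S', Polynomial.eval_finsetSum, Polynomial.eval_mul, Polynomial.eval_C,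
        Polynomial.eval_pow, Polynomial.eval_X]
      refine Finset.sum_congr rfl (fun d _ => ?_)
      have : Q ≠ 0 := by positivity
      rw [mul_assoc, ← mul_pow, mul_inv_cancel₀ this, one_pow, mul_one]
    constructor
    · simp only [Polynomial.eval_sub, Polynomial.eval_add, Polynomial.eval_mul, Polynomial.eval_pow,
        Polynomial.eval_X, Polynomial.eval_one, Polynomial.eval_C, one_pow, e1]
      have : 0 < (∑ d ∈ range (d1 + T), m d) * (Q ^ T - 1) := mul_pos hsum (by linarith)
      intro h
      nlinarith
    · have h3 : Q ^ T * Q⁻¹ ^ T = 1 := by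
        rw [← mul_pow, mul_inv_cancel₀ (by positivity), one_pow]
      simp only [Polynomial.eval_sub, Polynomial.eval_add, Polynomial.eval_mul, Polynomial.eval_pow,
        Polynomial.eval_X, Polynomial.eval_one, Polynomial.eval_C, e2, h3]
      have h4 : Q⁻¹ ^ T < 1 := pow_lt_one₀ (by positivity) (inv_lt_one_of_one_lt₀ hQ) hT.ne'
      have : 0 < χ * (∑ d ∈ range (d1 + T), m d) * (1 - Q⁻¹ ^ T) :=
        mul_pos (mul_pos hχ hsum) (by linarith)
      intro h
      nlinarith

lemma eval_pow_ne_zero (p : ℕ) (hp : 2 ≤ p) (A : PowerSeries ℤ) (hA : PowerSeries.coeff 0 A = 1)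
    (P : Polynomial ℚ) (hP : (P : PowerSeries ℚ) = A.map (Int.castRingHom ℚ)) (m : ℕ) (hm : 1 ≤ m) :
    P.eval ((p : ℚ) ^ m) ≠ 0 := by
  have hc : ∀ e, P.coeff e = (PowerSeries.coeff e A : ℤ) := by
    intro e
    rw [← Polynomial.coeff_coe, hP]; simp
  rw [Polynomial.eval_eq_sum_range, Finset.sum_range_succ']
  simp only [hc, hA]
  intro h
  have h2 : (∑ k ∈ Finset.range P.natDegree, (PowerSeries.coeff (k + 1)) A * ((p : ℤ) ^ m) ^ (k + 1))
      + 1 = 0 := by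
    have : (((∑ k ∈ Finset.range P.natDegree,
        (PowerSeries.coeff (k + 1)) A * ((p : ℤ) ^ m) ^ (k + 1)) + 1 : ℤ) : ℚ) = 0 := by
      push_cast
      simpa using h
    exact_mod_cast this
  have h3 : (p : ℤ) ∣ ∑ k ∈ Finset.range P.natDegree,
      (PowerSeries.coeff (k + 1)) A * ((p : ℤ) ^ m) ^ (k + 1) := by
    refine Finset.dvd_sum (fun k _ => Dvd.dvd.mul_left ?_ _)
    rw [← pow_mul]
    exact dvd_pow_self _ (by positivity)
  have h4 : (p : ℤ) ∣ 1 := by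
    have := (Int.dvd_add_right h3 (c := 1)).mp (by rw [h2]; exact dvd_zero _)
    exact this
  have := Int.le_of_dvd one_pos h4
  omega

theorem zeta_contra (p n : ℕ) (hp : 2 ≤ p) (hn : 2 ≤ n) (a b : ℕ → ℕ) (ha0 : a 0 = 1)
    (T d0 : ℕ) (hT : 0 < T) (χ : ℚ) (hχ : 0 < χ)
    (ha : ∀ d ≥ d0, (a d : ℚ) * (χ * p ^ (d + T) - 1) = a (d + T) * (χ * p ^ d - 1))
    (hne : ∀ N, ∃ d ≥ N, a d ≠ 0)
    (T' d0' : ℕ) (hT' : 0 < T') (χ' : ℚ) (hχ' : 0 < χ')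
    (hb : ∀ d ≥ d0', (b d : ℚ) * (χ' * p ^ (n * (d + T')) - 1) =
      b (d + T') * (χ' * p ^ (n * d) - 1))
    (hprod : PowerSeries.mk (fun d => (b d : ℚ)) =
      ∏ i ∈ Finset.range n, PowerSeries.rescale ((p : ℚ) ^ i) (PowerSeries.mk (fun d => (a d : ℚ)))) :
    False := by
  have hp1 : (1 : ℚ) < p := by exact_mod_cast (by omega : 1 < p)
  have hp0 : (p : ℚ) ≠ 0 := by positivity
  obtain ⟨P, hP, hP'⟩ := exists_poly (fun d => (a d : ℚ)) p χ hp1 hχ T d0 hT ha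
  obtain ⟨hP1, hPp⟩ := hP' (fun d => by positivity) (fun N => by simpa using hne N)
  obtain ⟨R, hR, -⟩ := exists_poly (fun d => (b d : ℚ)) ((p : ℚ) ^ n) χ'
    (one_lt_pow₀ hp1 (by omega)) hχ' T' d0' hT' (fun d hd => by
      simpa [pow_mul] using hb d hd)
  have hPm : ∀ m, 1 ≤ m → P.eval ((p : ℚ) ^ m) ≠ 0 := by
    refine fun m hm => eval_pow_ne_zero p hp (PowerSeries.mk (fun d => (a d : ℤ)) *
        ((1 - PowerSeries.X ^ T) * (1 - PowerSeries.C ((p : ℤ) ^ T) * PowerSeries.X ^ T))) ?_ P ?_ m hm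
    · simp [ha0, hT.ne']
    · rw [hP]
      have : PowerSeries.map (Int.castRingHom ℚ) (PowerSeries.mk (fun d => (a d : ℤ))) =
          PowerSeries.mk (fun d => (a d : ℚ)) := by ext; simp
      simp [this]
  -- the polynomial identity
  have hresc : ∀ i, ((P.comp (Polynomial.C ((p : ℚ) ^ i) * Polynomial.X) : Polynomial ℚ) :
      PowerSeries ℚ) = PowerSeries.rescale ((p : ℚ) ^ i) (P : PowerSeries ℚ) := by
    intro i
    ext e
    rw [PowerSeries.coeff_rescale, Polynomial.coeff_coe, Polynomial.coeff_coe,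
      Polynomial.comp_C_mul_X_coeff]
    ring
  have key : R * ∏ i ∈ Finset.range n, ((1 - (Polynomial.C ((p : ℚ) ^ i) * Polynomial.X) ^ T) *
      (1 - Polynomial.C ((p : ℚ) ^ T) * (Polynomial.C ((p : ℚ) ^ i) * Polynomial.X) ^ T)) =
      ((1 - Polynomial.X ^ T') * (1 - Polynomial.C (((p : ℚ) ^ n) ^ T') * Polynomial.X ^ T')) *
      ∏ i ∈ Finset.range n, P.comp (Polynomial.C ((p : ℚ) ^ i) * Polynomial.X) := by
    apply Polynomial.coe_injective
    have hc : ∀ f : ℕ → Polynomial ℚ, ((∏ i ∈ Finset.range n, f i : Polynomial ℚ) : PowerSeries ℚ)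
      = ∏ i ∈ Finset.range n, (f i : PowerSeries ℚ) := fun f =>
        map_prod (Polynomial.coeToPowerSeries.ringHom (R := ℚ)) f (Finset.range n)
    simp only [Polynomial.coe_mul, hc, hresc, hR, hP, hprod, map_mul, Finset.prod_mul_distrib]
    have e1 : ∀ c : ℚ, PowerSeries.rescale c (1 - PowerSeries.X ^ T) =
        ((1 - (Polynomial.C c * Polynomial.X) ^ T : Polynomial ℚ) : PowerSeries ℚ) := by
      intro c
      simp [PowerSeries.rescale_X]
    have e2 : ∀ c r : ℚ, PowerSeries.rescale c (1 - PowerSeries.C r * PowerSeries.X ^ T) =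
        ((1 - Polynomial.C r * (Polynomial.C c * Polynomial.X) ^ T :
          Polynomial ℚ) : PowerSeries ℚ) := by
      intro c r
      have : PowerSeries.rescale c (PowerSeries.C r) = PowerSeries.C r := by
        ext e
        rw [PowerSeries.coeff_rescale, PowerSeries.coeff_C]
        split_ifs with h
        · simp [h]
        · simp
      rw [map_sub, map_mul, map_one, map_pow, PowerSeries.rescale_X, this]
      simp
    simp only [e1, e2]
    push_cast
    ring
  have := congrArg (Polynomial.eval ((p : ℚ)⁻¹)) key
  rw [Polynomial.eval_mul, Polynomial.eval_mul, Polynomial.eval_prod, Polynomial.eval_prod,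
    Finset.prod_eq_zero (i := 0) (by simp; omega), mul_zero] at this
  · refine (mul_ne_zero ?_ ?_) this.symm
    · have h1 : (p : ℚ)⁻¹ ^ T' < 1 :=
        pow_lt_one₀ (by positivity) (inv_lt_one_of_one_lt₀ hp1) hT'.ne'
      have h2 : 1 < ((p : ℚ) ^ n) ^ T' * (p : ℚ)⁻¹ ^ T' := by
        rw [← mul_pow]
        refine one_lt_pow₀ ?_ hT'.ne'
        obtain ⟨j, rfl⟩ : ∃ j, n = j + 1 := ⟨n - 1, by omega⟩
        rw [pow_succ, mul_assoc, mul_inv_cancel₀ hp0, mul_one]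
        exact one_lt_pow₀ hp1 (by omega)
      simp only [Polynomial.eval_mul, Polynomial.eval_sub, Polynomial.eval_one, Polynomial.eval_pow,
        Polynomial.eval_X, Polynomial.eval_C]
      refine mul_ne_zero ?_ ?_ <;> linarith
    · rw [Finset.prod_ne_zero_iff]
      intro i hi
      simp only [Polynomial.eval_comp, Polynomial.eval_mul, Polynomial.eval_C, Polynomial.eval_X]
      rcases i with _ | _ | i
      · simpa using hPp
      · simpa [mul_inv_cancel₀ hp0] using hP1
      · rw [pow_succ, mul_assoc, mul_inv_cancel₀ hp0, mul_one]
        exact hPm (i + 1) (by omega)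
  · simp only [Polynomial.eval_mul, Polynomial.eval_sub, Polynomial.eval_one, Polynomial.eval_pow,
        Polynomial.eval_X, Polynomial.eval_C, pow_zero, one_mul]
    rw [← mul_pow (p : ℚ), mul_inv_cancel₀ hp0]
    simp

end B1
end

section
namespace B1
open scoped Pointwise

section Index
variable {G : Type*} [AddCommGroup G]

lemma relIndex_split (Δ U U' : AddSubgroup G) (h : U ≤ U') :
    U.relIndex U' = (Δ ⊓ U).relIndex (Δ ⊓ U') * (Δ ⊔ U).relIndex (Δ ⊔ U') := by
  have h1 : U ≤ U ⊔ (Δ ⊓ U') := le_sup_left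
  have h2 : U ⊔ (Δ ⊓ U') ≤ U' := sup_le h inf_le_right
  rw [← AddSubgroup.relIndex_mul_relIndex U _ U' h1 h2]
  congr 1
  · rw [AddSubgroup.relIndex_sup_left, ← AddSubgroup.inf_relIndex_right U]
    congr 1
    rw [inf_left_comm, inf_eq_left.mpr h]
  · have h3 : U ⊔ (Δ ⊓ U') = (Δ ⊔ U) ⊓ U' := by
      rw [← sup_inf_assoc_of_le Δ h, sup_comm]
    rw [h3, AddSubgroup.inf_relIndex_right, ← AddSubgroup.relIndex_sup_left U' (Δ ⊔ U)]
    congr 1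
    rw [sup_assoc, sup_eq_right.mpr h]

lemma card_mul_relIndex (H K : AddSubgroup G) (h : H ≤ K) :
    Nat.card H * H.relIndex K = Nat.card K := by
  rw [← AddSubgroup.relIndex_bot_left, ← AddSubgroup.relIndex_bot_left,
    AddSubgroup.relIndex_mul_relIndex _ _ _ bot_le h]

lemma euler_mul (Δ U U' : AddSubgroup G) (h : U ≤ U') :
    Nat.card (Δ ⊓ U' : AddSubgroup G) * (Δ ⊔ U).index =
      Nat.card (Δ ⊓ U : AddSubgroup G) * U.relIndex U' * (Δ ⊔ U').index := by
  rw [relIndex_split Δ U U' h, ← card_mul_relIndex _ _ (inf_le_inf_left Δ h),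
    ← AddSubgroup.relIndex_mul_index (sup_le_sup_left h Δ)]
  ring

/-- both cohomology groups finite -/
def Good (Δ U : AddSubgroup G) : Prop :=
  Nat.card (Δ ⊓ U : AddSubgroup G) ≠ 0 ∧ (Δ ⊔ U).index ≠ 0

lemma Good.up {Δ U U' : AddSubgroup G} (h : U ≤ U') (hr : U.relIndex U' ≠ 0) (hg : Good Δ U) :
    Good Δ U' := by
  rw [relIndex_split Δ U U' h] at hr
  refine ⟨?_, ?_⟩
  · rw [← card_mul_relIndex _ _ (inf_le_inf_left Δ h)]
    exact mul_ne_zero hg.1 (left_ne_zero_of_mul hr)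
  · have := hg.2
    rw [← AddSubgroup.relIndex_mul_index (sup_le_sup_left h Δ)] at this
    exact right_ne_zero_of_mul this

lemma Good.down {Δ U U' : AddSubgroup G} (h : U ≤ U') (hr : U.relIndex U' ≠ 0) (hg : Good Δ U') :
    Good Δ U := by
  rw [relIndex_split Δ U U' h] at hr
  refine ⟨?_, ?_⟩
  · have := hg.1
    rw [← card_mul_relIndex _ _ (inf_le_inf_left Δ h)] at this
    exact left_ne_zero_of_mul this
  · rw [← AddSubgroup.relIndex_mul_index (sup_le_sup_left h Δ)]
    exact mul_ne_zero (right_ne_zero_of_mul hr) hg.2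

/-- multiplicative Euler characteristic -/
noncomputable def chi (Δ U : AddSubgroup G) : ℚ :=
  (Nat.card (Δ ⊓ U : AddSubgroup G) : ℚ) / ((Δ ⊔ U).index : ℚ)

lemma Good.chi_pos {Δ U : AddSubgroup G} (hg : Good Δ U) : 0 < chi Δ U := by
  have h1 := Nat.pos_of_ne_zero hg.1
  have h2 := Nat.pos_of_ne_zero hg.2
  unfold chi; positivity

lemma chi_mul {Δ U U' : AddSubgroup G} (h : U ≤ U') (hg : Good Δ U) (hg' : Good Δ U') :
    chi Δ U' = U.relIndex U' * chi Δ U := by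
  have h1 : ((Δ ⊔ U).index : ℚ) ≠ 0 := by exact_mod_cast hg.2
  have h2 : ((Δ ⊔ U').index : ℚ) ≠ 0 := by exact_mod_cast hg'.2
  unfold chi
  field_simp
  have := euler_mul Δ U U' h
  have h3 : ((Nat.card (Δ ⊓ U' : AddSubgroup G) * (Δ ⊔ U).index : ℕ) : ℚ) =
    ((Nat.card (Δ ⊓ U : AddSubgroup G) * U.relIndex U' * (Δ ⊔ U').index : ℕ) : ℚ) := by rw [this]
  push_cast at h3
  rw [h3]; ring

lemma card_of_sup_top {Δ U : AddSubgroup G} (h : Δ ⊔ U = ⊤) :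
    (Nat.card (Δ ⊓ U : AddSubgroup G) : ℚ) = chi Δ U := by
  simp [chi, h]

end Index

section Classes
variable {𝔸 D : Type*} [Ring 𝔸] [DivisionRing D]

/-- translate of an additive subgroup by a unit -/
def tr (g : 𝔸ˣ) (U : AddSubgroup 𝔸) : AddSubgroup 𝔸 := U.map (AddMonoidHom.mulLeft (g : 𝔸))

local infixr:73 "⋆" => tr

lemma mem_tr {g : 𝔸ˣ} {U : AddSubgroup 𝔸} {x : 𝔸} : x ∈ g ⋆ U ↔ ((g⁻¹ : 𝔸ˣ) : 𝔸) * x ∈ U := by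
  constructor
  · rintro ⟨y, hy, rfl⟩
    simpa using hy
  · intro h
    exact ⟨_, h, by simp⟩

lemma tr_tr (g h : 𝔸ˣ) (U : AddSubgroup 𝔸) : g ⋆ h ⋆ U = (g * h) ⋆ U := by
  ext x
  simp only [mem_tr, mul_inv_rev, Units.val_mul, mul_assoc]

lemma tr_inv_tr (g : 𝔸ˣ) (U : AddSubgroup 𝔸) : g ⋆ g⁻¹ ⋆ U = U := by
  ext x
  simp [mem_tr]

lemma inv_tr_tr (g : 𝔸ˣ) (U : AddSubgroup 𝔸) : g⁻¹ ⋆ g ⋆ U = U := by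
  ext x
  simp [mem_tr]

lemma tr_mono (g : 𝔸ˣ) {U V : AddSubgroup 𝔸} (h : U ≤ V) : g ⋆ U ≤ g ⋆ V :=
  AddSubgroup.map_mono h

lemma mulLeft_inj (g : 𝔸ˣ) : Function.Injective (AddMonoidHom.mulLeft (g : 𝔸)) := by
  intro a b h
  have h' : (g : 𝔸) * a = g * b := h
  simpa using h'

lemma relIndex_tr (g : 𝔸ˣ) (U V : AddSubgroup 𝔸) : (g ⋆ U).relIndex (g ⋆ V) = U.relIndex V :=
  AddSubgroup.relIndex_map_map_of_injective U V (mulLeft_inj g)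

lemma card_tr (g : 𝔸ˣ) (U : AddSubgroup 𝔸) :
    Nat.card (g ⋆ U : AddSubgroup 𝔸) = Nat.card U := by
  have := relIndex_tr g (⊥ : AddSubgroup 𝔸) U
  rwa [tr, AddSubgroup.map_bot, AddSubgroup.relIndex_bot_left, AddSubgroup.relIndex_bot_left] at this

lemma tr_top (g : 𝔸ˣ) : g ⋆ (⊤ : AddSubgroup 𝔸) = ⊤ := by
  rw [eq_top_iff]
  intro x _
  rw [mem_tr]
  trivial

lemma tr_inf (g : 𝔸ˣ) (U V : AddSubgroup 𝔸) : g ⋆ (U ⊓ V) = g ⋆ U ⊓ g ⋆ V := by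
  ext x
  simp only [AddSubgroup.mem_inf, mem_tr]

lemma tr_sup (g : 𝔸ˣ) (U V : AddSubgroup 𝔸) : g ⋆ (U ⊔ V) = g ⋆ U ⊔ g ⋆ V :=
  AddSubgroup.map_sup _ _ _

lemma index_tr (g : 𝔸ˣ) (U : AddSubgroup 𝔸) :
    (g ⋆ U : AddSubgroup 𝔸).index = U.index := by
  have := relIndex_tr g U ⊤
  rwa [tr_top, AddSubgroup.relIndex_top_right, AddSubgroup.relIndex_top_right] at this

lemma Good.tr {Δ U : AddSubgroup 𝔸} {g : 𝔸ˣ} (hg : g ⋆ Δ = Δ) (h : Good Δ U) :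
    Good Δ (g ⋆ U) := by
  have e1 : Δ ⊓ g ⋆ U = g ⋆ (Δ ⊓ U) := by rw [tr_inf, hg]
  have e2 : Δ ⊔ g ⋆ U = g ⋆ (Δ ⊔ U) := by rw [tr_sup, hg]
  unfold Good
  rw [e1, e2, card_tr, index_tr]
  exact h

lemma chi_tr {Δ : AddSubgroup 𝔸} (U : AddSubgroup 𝔸) {g : 𝔸ˣ} (hg : g ⋆ Δ = Δ) :
    chi Δ (g ⋆ U) = chi Δ U := by
  have e1 : Δ ⊓ g ⋆ U = g ⋆ (Δ ⊓ U) := by rw [tr_inf, hg]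
  have e2 : Δ ⊔ g ⋆ U = g ⋆ (Δ ⊔ U) := by rw [tr_sup, hg]
  unfold chi
  rw [e1, e2, card_tr, index_tr]

/-- the set of right `𝒰`-modules containing `𝒰` with index `p ^ d`. -/
def EffSet (𝒰 : Subring 𝔸) (p d : ℕ) : Set (AddSubgroup 𝔸) :=
  {U | 𝒰.toAddSubgroup ≤ U ∧ (∀ u ∈ U, ∀ a ∈ 𝒰, u * a ∈ U) ∧
    𝒰.toAddSubgroup.relIndex U = p ^ d}

lemma card_units [Nontrivial 𝔸] (j : D →+* 𝔸) (W : AddSubgroup 𝔸)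
    (h : Nat.card (j.toAddMonoidHom.range ⊓ W : AddSubgroup 𝔸) ≠ 0) :
    Nat.card {s : Dˣ // j s ∈ W} + 1 = Nat.card (j.toAddMonoidHom.range ⊓ W : AddSubgroup 𝔸) := by
  classical
  have hfin : Finite (j.toAddMonoidHom.range ⊓ W : AddSubgroup 𝔸) := Nat.finite_of_card_ne_zero h
  let e : Option {s : Dˣ // j s ∈ W} → (j.toAddMonoidHom.range ⊓ W : AddSubgroup 𝔸) := fun o =>
    match o with
    | none => 0
    | some s => ⟨j s.1, ⟨s.1, rfl⟩, s.2⟩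
  have he : Function.Bijective e := by
    constructor
    · intro a b hab
      rcases a with _ | a <;> rcases b with _ | b
      · rfl
      · exfalso
        have : (0 : 𝔸) = j b.1 := congrArg Subtype.val hab
        have h2 := (map_eq_zero j).mp this.symm
        exact b.1.ne_zero h2
      · exfalso
        have : j a.1 = (0 : 𝔸) := congrArg Subtype.val hab
        have h2 := (map_eq_zero j).mp this
        exact a.1.ne_zero h2
      · have : j a.1 = j b.1 := congrArg Subtype.val hab
        congr 1
        exact Subtype.ext (Units.ext (j.injective this))
    · rintro ⟨x, ⟨s, hs⟩, hx⟩
      by_cases h0 : s = 0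
      · refine ⟨none, ?_⟩
        apply Subtype.ext
        subst h0
        exact ((map_zero j).symm.trans hs)
      · refine ⟨some ⟨Units.mk0 s h0, ?_⟩, ?_⟩
        · have : j s = x := hs
          simpa [this] using hx
        · exact Subtype.ext hs
  have : Finite (Option {s : Dˣ // j s ∈ W}) := Finite.of_injective e he.1
  have : Finite {s : Dˣ // j s ∈ W} := Finite.of_injective (some) (Option.some_injective _)
  rw [← Nat.card_eq_of_bijective e he, Finite.card_option]

lemma range_tr (j : D →+* 𝔸) (s : Dˣ) :
    (Units.map (j : D →* 𝔸) s) ⋆ j.toAddMonoidHom.range = j.toAddMonoidHom.range := by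
  ext x
  rw [mem_tr]
  constructor
  · rintro ⟨y, hy⟩
    refine ⟨s * y, ?_⟩
    have hy' : j y = ((Units.map (j : D →* 𝔸) s)⁻¹ : 𝔸ˣ) * x := hy
    change j (s * y) = x
    rw [map_mul, hy', ← mul_assoc]
    have : j s = ((Units.map (j : D →* 𝔸) s : 𝔸ˣ) : 𝔸) := rfl
    rw [this, Units.mul_inv, one_mul]
  · rintro ⟨y, hy⟩
    have hy' : j y = x := hy
    refine ⟨(s⁻¹ : Dˣ) * y, ?_⟩
    change j ((s⁻¹ : Dˣ) * y) = _
    rw [map_mul, hy', ← map_inv]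
    rfl

theorem class_count [Nontrivial 𝔸] (j : D →+* 𝔸) (𝒰 : Subring 𝔸) (p : ℕ) (hp : 2 ≤ p)
    (hgood : Good j.toAddMonoidHom.range 𝒰.toAddSubgroup)
    (τ : 𝔸ˣ) (hτ : ∀ x : 𝔸, τ * x = x * τ) (T : ℕ) (hT0 : 0 < T) (hτU : (τ : 𝔸) ∈ 𝒰)
    (hT : 𝒰.toAddSubgroup.relIndex (τ⁻¹ ⋆ 𝒰.toAddSubgroup) = p ^ T)
    (htop : j.toAddMonoidHom.range ⊔ τ⁻¹ ⋆ 𝒰.toAddSubgroup = ⊤)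
    (hfin : ∀ d, (EffSet 𝒰 p d).Finite) :
    ∃ χ : ℚ, 0 < χ ∧ ∃ d0 : ℕ, ∀ d ≥ d0,
      (Nat.card (EffSet 𝒰 p d) : ℚ) * (χ * p ^ (d + T) - 1) =
        Nat.card (EffSet 𝒰 p (d + T)) * (χ * p ^ d - 1) := by
  set Δ := j.toAddMonoidHom.range with hΔ
  set U0 := 𝒰.toAddSubgroup with hU0
  set χ := chi Δ U0 with hχ
  have hχ0 : 0 < χ := hgood.chi_pos
  have hp0 : (p : ℚ) ≠ 0 := by positivity
  have hp1 : (1 : ℚ) < p := by exact_mod_cast (by omega : 1 < p)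
  have hmemU0 : ∀ x, x ∈ U0 ↔ x ∈ 𝒰 := fun x => Iff.rfl
  have hle : U0 ≤ τ⁻¹ ⋆ U0 := by
    intro x hx
    rw [mem_tr, inv_inv]
    exact 𝒰.mul_mem hτU hx
  have hle' : τ ⋆ U0 ≤ U0 := by
    have := tr_mono τ hle
    rwa [tr_inv_tr] at this
  have hT' : (τ ⋆ U0).relIndex U0 = p ^ T := by
    rw [← relIndex_tr τ] at hT
    rwa [tr_inv_tr] at hT
  have hpT : ∀ d, p ^ d ≠ 0 := fun d => by positivity
  -- right module property transported by units
  have rm : ∀ (U : AddSubgroup 𝔸) (g : 𝔸ˣ), (∀ u ∈ U, ∀ a ∈ 𝒰, u * a ∈ U) →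
      ∀ u ∈ g ⋆ U, ∀ a ∈ 𝒰, u * a ∈ g ⋆ U := by
    intro U g h u hu a ha
    rw [mem_tr] at hu ⊢
    rw [← mul_assoc]
    exact h _ hu _ ha
  have comm : ∀ g : 𝔸ˣ, g * τ = τ * g := fun g => Units.ext (hτ g).symm
  -- goodness of everything
  have goodE : ∀ d, ∀ U ∈ EffSet 𝒰 p d, Good Δ U := fun d U hU =>
    hgood.up hU.1 (by rw [hU.2.2]; exact hpT d)
  have goodτ : Good Δ (τ⁻¹ ⋆ U0) := hgood.up hle (by rw [hT]; exact hpT T)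
  have gooda : ∀ d, ∀ U ∈ EffSet 𝒰 p d, Good Δ (τ⁻¹ ⋆ U) ∧ chi Δ (τ⁻¹ ⋆ U) = χ * p ^ (d + T) := by
    intro d U hU
    have h1 : τ⁻¹ ⋆ U0 ≤ τ⁻¹ ⋆ U := tr_mono _ hU.1
    have h2 : (τ⁻¹ ⋆ U0).relIndex (τ⁻¹ ⋆ U) = p ^ d := by
      rw [relIndex_tr]; exact hU.2.2
    have h3 : Good Δ (τ⁻¹ ⋆ U) := goodτ.up h1 (by rw [h2]; exact hpT d)
    refine ⟨h3, ?_⟩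
    rw [chi_mul h1 goodτ h3, h2, chi_mul hle hgood goodτ, hT]
    push_cast
    rw [pow_add]; ring
  have goodτ' : Good Δ (τ ⋆ U0) := hgood.down hle' (by rw [hT']; exact hpT T)
  have goodb : ∀ d, ∀ U ∈ EffSet 𝒰 p d, Good Δ (τ ⋆ U) ∧ chi Δ (τ ⋆ U) * p ^ T = χ * p ^ d := by
    intro d U hU
    have h1 : τ ⋆ U0 ≤ τ ⋆ U := tr_mono _ hU.1
    have h2 : (τ ⋆ U0).relIndex (τ ⋆ U) = p ^ d := by
      rw [relIndex_tr]; exact hU.2.2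
    have h3 : Good Δ (τ ⋆ U) := goodτ'.up h1 (by rw [h2]; exact hpT d)
    refine ⟨h3, ?_⟩
    rw [chi_mul h1 goodτ' h3, h2, hχ, chi_mul hle' goodτ' hgood, hT']
    push_cast
    ring
  have goodτ'' : Good Δ (τ ⋆ τ ⋆ U0) := goodτ'.down
    (tr_mono _ hle')
    (by rw [relIndex_tr, hT']; exact hpT T)
  have goodc : ∀ d, ∀ U ∈ EffSet 𝒰 p d,
      Good Δ (τ ⋆ τ ⋆ U) ∧ chi Δ (τ ⋆ τ ⋆ U) * p ^ (T + T) = χ * p ^ d := by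
    intro d U hU
    have h1 : τ ⋆ τ ⋆ U0 ≤ τ ⋆ τ ⋆ U := tr_mono _
      (tr_mono _ hU.1)
    have h2 : (τ ⋆ τ ⋆ U0).relIndex (τ ⋆ τ ⋆ U) = p ^ d := by
      rw [relIndex_tr, relIndex_tr]; exact hU.2.2
    have h3 : Good Δ (τ ⋆ τ ⋆ U) := goodτ''.up h1 (by rw [h2]; exact hpT d)
    refine ⟨h3, ?_⟩
    rw [chi_mul h1 goodτ'' h3, h2, hχ, chi_mul hle' goodτ' hgood, hT',
      chi_mul (tr_mono _ hle') goodτ'' goodτ',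
      relIndex_tr, hT']
    push_cast
    rw [pow_add]; ring
  obtain ⟨d0, hd0⟩ : ∃ d0 : ℕ, p ^ T / χ < (p : ℚ) ^ d0 := pow_unbounded_of_one_lt _ hp1
  refine ⟨χ, hχ0, d0, fun d hd => ?_⟩
  -- vanishing of H1 for τ ⋆ U
  have van : ∀ U ∈ EffSet 𝒰 p (d + T), Δ ⊔ τ ⋆ U = ⊤ := by
    intro U hU
    obtain ⟨hg, hc⟩ := goodc _ U hU
    have h1 : 1 < chi Δ (τ ⋆ τ ⋆ U) := by
      have h2 : (p : ℚ) ^ T < χ * p ^ d := by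
        have h3 : (p : ℚ) ^ d0 ≤ p ^ d := pow_le_pow_right₀ hp1.le hd
        have h4 := lt_of_lt_of_le hd0 h3
        rw [div_lt_iff₀ hχ0] at h4
        linarith
      have h5 : (0 : ℚ) < p ^ T := by positivity
      rw [pow_add, pow_add, ← mul_assoc, ← mul_assoc] at hc
      have hc' := mul_right_cancel₀ h5.ne' hc
      by_contra hcon
      push Not at hcon
      nlinarith
    have hcard : 1 < Nat.card (Δ ⊓ τ ⋆ τ ⋆ U : AddSubgroup 𝔸) := by
      unfold chi at h1
      have h2 : (0 : ℚ) < ((Δ ⊔ τ ⋆ τ ⋆ U).index : ℚ) := by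
        exact_mod_cast Nat.pos_of_ne_zero hg.2
      rw [lt_div_iff₀ h2, one_mul] at h1
      have h3 : ((Δ ⊔ τ ⋆ τ ⋆ U).index) < Nat.card (Δ ⊓ τ ⋆ τ ⋆ U : AddSubgroup 𝔸) := by
        exact_mod_cast h1
      have := Nat.pos_of_ne_zero hg.2
      omega
    have hu := card_units j (τ ⋆ τ ⋆ U) hg.1
    rw [← hΔ] at hu
    have : 0 < Nat.card {s : Dˣ // j s ∈ τ ⋆ τ ⋆ U} := by omega
    obtain ⟨⟨s, hs⟩⟩ := (Nat.card_pos_iff.mp this).1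
    set g : 𝔸ˣ := Units.map (j : D →* 𝔸) s with hgdef
    have hgval : (g : 𝔸) = j s := rfl
    have h6 : g ⋆ U0 ≤ τ ⋆ τ ⋆ U := by
      intro x hx
      rw [mem_tr] at hx
      have := rm (τ ⋆ U) τ (rm U τ hU.2.1) (j s) hs _ hx
      rw [← hgval] at this
      change (g : 𝔸) * ((g⁻¹ : 𝔸ˣ) * x) ∈ _ at this
      rwa [Units.mul_inv_cancel_left] at this
    have h7 : g ⋆ τ⁻¹ ⋆ U0 ≤ τ ⋆ U := by
      have h8 := tr_mono τ⁻¹ h6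
      rw [inv_tr_tr, tr_tr] at h8
      rw [tr_tr]
      have : g * τ⁻¹ = τ⁻¹ * g := by
        rw [mul_inv_eq_iff_eq_mul, mul_assoc, comm g, inv_mul_cancel_left]
      rwa [this]
    rw [eq_top_iff]
    calc ⊤ = g ⋆ (⊤ : AddSubgroup 𝔸) := (tr_top g).symm
      _ = g ⋆ (Δ ⊔ τ⁻¹ ⋆ U0) := by rw [htop]
      _ = Δ ⊔ g ⋆ τ⁻¹ ⋆ U0 := by rw [tr_sup, range_tr j s]
      _ ≤ Δ ⊔ τ ⋆ U := sup_le_sup_left h7 _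
  -- the double counting
  have rel_of : ∀ (V : AddSubgroup 𝔸) (e : ℕ), U0 ≤ V → Good Δ V → chi Δ V = χ * p ^ e →
      U0.relIndex V = p ^ e := by
    intro V e hV hg hc
    rw [chi_mul hV hgood hg, mul_comm] at hc
    have := mul_left_cancel₀ hχ0.ne' hc
    exact_mod_cast this
  have sub_of : ∀ (V : AddSubgroup 𝔸) (s : Dˣ), (∀ u ∈ V, ∀ a ∈ 𝒰, u * a ∈ V) → j s ∈ V →
      U0 ≤ (Units.map (j : D →* 𝔸) s)⁻¹ ⋆ V := by
    intro V s hV hs x hx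
    rw [mem_tr, inv_inv]
    exact hV _ hs _ hx
  have inv_mem : ∀ (U : AddSubgroup 𝔸) (s : Dˣ), U0 ≤ U →
      j ((s⁻¹ : Dˣ) : D) ∈ (Units.map (j : D →* 𝔸) s)⁻¹ ⋆ U := by
    intro U s hU
    rw [mem_tr, inv_inv]
    change j s * j ((s⁻¹ : Dˣ) : D) ∈ U
    rw [← map_mul, Units.mul_inv, map_one]
    exact hU 𝒰.one_mem
  have goodinv : ∀ (U : AddSubgroup 𝔸) (s : Dˣ), Good Δ U →
      Good Δ ((Units.map (j : D →* 𝔸) s)⁻¹ ⋆ U) := by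
    intro U s h
    rw [← map_inv]
    exact h.tr (range_tr j _)
  have chiinv : ∀ (U : AddSubgroup 𝔸) (s : Dˣ),
      chi Δ ((Units.map (j : D →* 𝔸) s)⁻¹ ⋆ U) = chi Δ U := by
    intro U s
    rw [← map_inv]
    exact chi_tr U (range_tr j _)
  have comm2 : ∀ g : 𝔸ˣ, τ * g⁻¹ = g⁻¹ * τ := fun g => (comm g⁻¹).symm
  have comm3 : ∀ g : 𝔸ˣ, τ⁻¹ * g⁻¹ = g⁻¹ * τ⁻¹ := fun g => by
    rw [inv_mul_eq_iff_eq_mul, ← mul_assoc, comm2, mul_assoc, mul_inv_cancel, mul_one]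
  let Y := {x : (EffSet 𝒰 p d) × Dˣ // j x.2 ∈ τ⁻¹ ⋆ (x.1 : AddSubgroup 𝔸)}
  let Y' := {x : (EffSet 𝒰 p (d + T)) × Dˣ // j x.2 ∈ τ ⋆ (x.1 : AddSubgroup 𝔸)}
  let e : Y ≃ Y' :=
    { toFun := fun x => ⟨(⟨(Units.map (j : D →* 𝔸) x.1.2)⁻¹ ⋆ τ⁻¹ ⋆ (x.1.1 : AddSubgroup 𝔸), by
          refine ⟨sub_of _ _ (rm _ _ x.1.1.2.2.1) x.2, rm _ _ (rm _ _ x.1.1.2.2.1), ?_⟩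
          obtain ⟨h1, h2⟩ := gooda d _ x.1.1.2
          refine rel_of _ _ (sub_of _ _ (rm _ _ x.1.1.2.2.1) x.2) (goodinv _ _ h1) ?_
          rw [chiinv, h2]⟩, x.1.2⁻¹), by
          change j ((x.1.2⁻¹ : Dˣ) : D) ∈ τ ⋆ (Units.map (j : D →* 𝔸) x.1.2)⁻¹ ⋆ τ⁻¹ ⋆ (x.1.1 : AddSubgroup 𝔸)
          rw [tr_tr τ, comm2, ← tr_tr, tr_inv_tr]
          exact inv_mem _ _ x.1.1.2.1⟩
      invFun := fun x => ⟨(⟨(Units.map (j : D →* 𝔸) x.1.2)⁻¹ ⋆ τ ⋆ (x.1.1 : AddSubgroup 𝔸), by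
          refine ⟨sub_of _ _ (rm _ _ x.1.1.2.2.1) x.2, rm _ _ (rm _ _ x.1.1.2.2.1), ?_⟩
          obtain ⟨h1, h2⟩ := goodb _ _ x.1.1.2
          refine rel_of _ _ (sub_of _ _ (rm _ _ x.1.1.2.2.1) x.2) (goodinv _ _ h1) ?_
          rw [chiinv]
          rw [pow_add, ← mul_assoc] at h2
          exact mul_right_cancel₀ (by positivity) h2⟩, x.1.2⁻¹), by
          change j ((x.1.2⁻¹ : Dˣ) : D) ∈ τ⁻¹ ⋆ (Units.map (j : D →* 𝔸) x.1.2)⁻¹ ⋆ τ ⋆ (x.1.1 : AddSubgroup 𝔸)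
          rw [tr_tr τ⁻¹, comm3, ← tr_tr, inv_tr_tr]
          exact inv_mem _ _ x.1.1.2.1⟩
      left_inv := by
        rintro ⟨⟨⟨U, hU⟩, s⟩, hs⟩
        apply Subtype.ext
        refine Prod.ext (Subtype.ext ?_) (inv_inv s)
        change (Units.map (j : D →* 𝔸) s⁻¹)⁻¹ ⋆ τ ⋆ (Units.map (j : D →* 𝔸) s)⁻¹ ⋆ τ⁻¹ ⋆ U = U
        rw [tr_tr τ, comm2, ← tr_tr, tr_inv_tr, map_inv, inv_inv, tr_inv_tr]
      right_inv := by
        rintro ⟨⟨⟨U, hU⟩, s⟩, hs⟩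
        apply Subtype.ext
        refine Prod.ext (Subtype.ext ?_) (inv_inv s)
        change (Units.map (j : D →* 𝔸) s⁻¹)⁻¹ ⋆ τ⁻¹ ⋆ (Units.map (j : D →* 𝔸) s)⁻¹ ⋆ τ ⋆ U = U
        rw [tr_tr τ⁻¹, comm3, ← tr_tr, inv_tr_tr, map_inv, inv_inv, tr_inv_tr] }
  have fib : ∀ (e : ℕ) (g : 𝔸ˣ) (c : ℚ), (∀ U ∈ EffSet 𝒰 p e, Good Δ (g ⋆ U) ∧ Δ ⊔ g ⋆ U = ⊤ ∧
      chi Δ (g ⋆ U) = c) →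
      (Nat.card {x : (EffSet 𝒰 p e) × Dˣ // j x.2 ∈ g ⋆ (x.1 : AddSubgroup 𝔸)} : ℚ) =
        Nat.card (EffSet 𝒰 p e) * (c - 1) := by
    intro e g c h
    have : Finite (EffSet 𝒰 p e) := hfin e
    have := Fintype.ofFinite (EffSet 𝒰 p e)
    have eqv : {x : (EffSet 𝒰 p e) × Dˣ // j x.2 ∈ g ⋆ (x.1 : AddSubgroup 𝔸)} ≃
        Σ U : EffSet 𝒰 p e, {s : Dˣ // j s ∈ g ⋆ (U : AddSubgroup 𝔸)} :=
      { toFun := fun x => ⟨x.1.1, x.1.2, x.2⟩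
        invFun := fun x => ⟨(x.1, x.2.1), x.2.2⟩
        left_inv := fun _ => rfl
        right_inv := fun _ => rfl }
    rw [Nat.card_congr eqv]
    have hu : ∀ U : EffSet 𝒰 p e, (Nat.card {s : Dˣ // j s ∈ g ⋆ (U : AddSubgroup 𝔸)} : ℚ) = c - 1 := by
      intro U
      obtain ⟨h1, h2, h3⟩ := h U U.2
      have h4 := card_units j (g ⋆ (U : AddSubgroup 𝔸)) h1.1
      rw [← h3, ← card_of_sup_top h2]
      change _ = ((Nat.card (j.toAddMonoidHom.range ⊓ g ⋆ (U : AddSubgroup 𝔸) : AddSubgroup 𝔸) : ℕ) : ℚ) - 1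
      rw [← h4]
      push_cast; ring
    have hf : ∀ U : EffSet 𝒰 p e, Finite {s : Dˣ // j s ∈ g ⋆ (U : AddSubgroup 𝔸)} := by
      intro U
      obtain ⟨h1, h2, h3⟩ := h U U.2
      have hfin : Finite (Δ ⊓ g ⋆ (U : AddSubgroup 𝔸) : AddSubgroup 𝔸) :=
        Nat.finite_of_card_ne_zero h1.1
      refine Finite.of_injective (fun s => (⟨j s.1, ⟨s.1, rfl⟩, s.2⟩ :
        (Δ ⊓ g ⋆ (U : AddSubgroup 𝔸) : AddSubgroup 𝔸))) ?_
      intro a b hab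
      exact Subtype.ext (Units.ext (j.injective (congrArg Subtype.val hab)))
    rw [Nat.card_sigma]
    push_cast
    rw [Finset.sum_congr rfl (fun U _ => hu U), Finset.sum_const, Finset.card_univ,
      Nat.card_eq_fintype_card, nsmul_eq_mul]
  rw [← fib d τ⁻¹ (χ * p ^ (d + T)) (fun U hU => ⟨(gooda d U hU).1, ?_, (gooda d U hU).2⟩),
    ← fib (d + T) τ (χ * p ^ d) (fun U hU => ⟨(goodb _ U hU).1, van U hU, ?_⟩)]
  · exact_mod_cast Nat.card_congr e
  · have h2 := (goodb _ U hU).2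
    rw [pow_add, ← mul_assoc] at h2
    exact mul_right_cancel₀ (by positivity) h2
  · rw [eq_top_iff, ← htop]
    exact sup_le_sup_left (tr_mono _ hU.1) _

end Classes
end B1
end

section
namespace B1

section Chain

lemma card_ker_range {A B : Type*} [AddCommGroup A] [AddCommGroup B] (f : A →+ B) :
    Nat.card f.ker * Nat.card f.range = Nat.card A := by
  rw [← AddSubgroup.index_ker, AddSubgroup.card_mul_index]

/-- locally nilpotent endomorphism of a finite `p`-group of order `p ^ m` has `f ^ m = 0`. -/
lemma pow_eq_zero_of_card {p : ℕ} (hp : p.Prime) : ∀ (m : ℕ) {H : Type*} [AddCommGroup H]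
    (_ : ∃ c ≤ m, Nat.card H = p ^ c) (f : H →+ H) (_ : ∀ x, ∃ k : ℕ, (f^[k]) x = 0) (x : H),
    (f^[m]) x = 0 := by
  intro m
  induction m with
  | zero =>
    rintro H _ ⟨c, hc0, hc⟩ f hf x
    obtain rfl : c = 0 := by omega
    rw [pow_zero, Nat.card_eq_one_iff_unique] at hc
    have := hc.1
    exact Subsingleton.elim _ _
  | succ m ih =>
    rintro H _ ⟨c, hcm, hc⟩ f hf x
    have hfin : Finite H := Nat.finite_of_card_ne_zero (by rw [hc]; exact pow_ne_zero _ hp.ne_zero)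
    let f' : f.range →+ f.range := (f.comp f.range.subtype).codRestrict _ (fun x => ⟨_, rfl⟩)
    have hval : ∀ (k : ℕ) (y : f.range), ((f'^[k]) y : H) = (f^[k]) y := by
      intro k
      induction k with
      | zero => intro y; rfl
      | succ k ih2 => intro y; rw [Function.iterate_succ_apply, ih2]; rfl
    have hcr := card_ker_range f
    have hdvd : Nat.card f.range ∣ p ^ c := ⟨_, by rw [mul_comm, hcr, hc]⟩
    obtain ⟨c', hc1, hc2⟩ := (Nat.dvd_prime_pow hp).mp hdvd
    have hcm' : c' ≤ m := by
      by_contra hcon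
      have h1 : c' = m + 1 := by omega
      have h1' : c = m + 1 := by omega
      rw [hc2, h1, hc, h1'] at hcr
      have h3 : 0 < p ^ (m + 1) := pow_pos hp.pos _
      have hker : Nat.card f.ker = 1 := Nat.eq_of_mul_eq_mul_right h3 (by rw [hcr, one_mul])
      have h2 : f.ker = ⊥ := AddSubgroup.card_eq_one.mp hker
      have hinj : Function.Injective f := (AddMonoidHom.ker_eq_bot_iff f).mp h2
      have hnt : Nontrivial H := by
        rw [← Finite.one_lt_card_iff_nontrivial, hc, h1']
        exact Nat.one_lt_pow (by omega) hp.one_lt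
      obtain ⟨y, hy⟩ := exists_ne (0 : H)
      obtain ⟨k, hk⟩ := hf y
      have h0 : (f^[k]) 0 = 0 := by
        clear hk
        induction k with
        | zero => rfl
        | succ k ih => rw [Function.iterate_succ_apply, map_zero, ih]
      exact hy (hinj.iterate k (hk.trans h0.symm))
    have key := ih ⟨c', hcm', hc2⟩ f' (fun y => by
        obtain ⟨k, hk⟩ := hf y
        exact ⟨k, Subtype.ext ((hval k y).trans hk)⟩) ⟨f x, x, rfl⟩
    have := congrArg Subtype.val key
    rw [hval] at this
    exact this

/-- truncated discrete valuation ring -/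
structure ChainRing (S : Type*) [CommRing S] (π : S) (N q : ℕ) : Prop where
  fin : Finite S
  card : ∀ i ≤ N, Nat.card (Ideal.span {π ^ i} : Ideal S) = q ^ (N - i)
  ideal : ∀ J : Ideal S, ∃ i ≤ N, J = Ideal.span {π ^ i}

variable {S : Type*} [CommRing S] {π : S} {N q : ℕ}

lemma ChainRing.pow_zero' (h : ChainRing S π N q) : π ^ N = 0 := by
  have h1 := h.card N le_rfl
  rw [Nat.sub_self, pow_zero, Nat.card_eq_one_iff_unique] at h1
  have := h1.1
  have h2 : (⟨π ^ N, Ideal.mem_span_singleton_self _⟩ : (Ideal.span {π ^ N} : Ideal S)) = 0 :=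
    Subsingleton.elim _ _
  exact congrArg Subtype.val h2

lemma ChainRing.card_top (h : ChainRing S π N q) : Nat.card S = q ^ N := by
  have h1 := h.card 0 (Nat.zero_le _)
  rw [pow_zero, Ideal.span_singleton_one, Nat.sub_zero] at h1
  rw [← h1]
  exact (Nat.card_congr (Equiv.subtypeUnivEquiv (fun x => trivial))).symm

/-- kernel of `π^i` on `S` -/
lemma ChainRing.card_ann (h : ChainRing S π N q) (hq : 0 < q) (i : ℕ) (hi : i ≤ N) :
    Nat.card {s : S // π ^ i * s = 0} = q ^ i := by
  have h1 := card_ker_range (AddMonoidHom.mulLeft (π ^ i))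
  have h2 : Nat.card (AddMonoidHom.mulLeft (π ^ i)).range = q ^ (N - i) := by
    rw [← h.card i hi]
    refine Nat.card_congr (Equiv.subtypeEquivRight fun x => ?_)
    rw [Ideal.mem_span_singleton]
    constructor
    · rintro ⟨y, rfl⟩; exact ⟨y, rfl⟩
    · rintro ⟨y, rfl⟩; exact ⟨y, rfl⟩
  rw [h2, h.card_top] at h1
  have h3 : q ^ N = q ^ i * q ^ (N - i) := by rw [← pow_add]; congr 1; omega
  rw [h3] at h1
  exact Nat.eq_of_mul_eq_mul_right (pow_pos hq _) h1

lemma ChainRing.ann_iff (h : ChainRing S π N q) (hq : 0 < q) (i : ℕ) (hi : i ≤ N) (s : S) :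
    π ^ i * s = 0 ↔ ∃ t, s = π ^ (N - i) * t := by
  have := h.fin
  have h1 : (((Ideal.span {π ^ (N - i)} : Ideal S) : Set S)) = {s | π ^ i * s = 0} := by
    apply Set.eq_of_subset_of_ncard_le
    · intro x hx
      obtain ⟨t, rfl⟩ := Ideal.mem_span_singleton.mp hx
      change π ^ i * (π ^ (N - i) * t) = 0
      rw [← mul_assoc, ← pow_add, (by omega : i + (N - i) = N), h.pow_zero', zero_mul]
    · rw [← Nat.card_coe_set_eq, ← Nat.card_coe_set_eq]
      refine le_of_eq ((h.card_ann hq i hi).trans ?_)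
      refine Eq.trans ?_ (h.card (N - i) (by omega)).symm
      congr 1; omega
    · exact Set.toFinite _
  have h2 : s ∈ (((Ideal.span {π ^ (N - i)} : Ideal S) : Set S)) ↔ s ∈ {s | π ^ i * s = 0} := by
    rw [h1]
  rw [Set.mem_setOf_eq] at h2
  rw [← h2, SetLike.mem_coe, Ideal.mem_span_singleton]
  rfl

end Chain
end B1
end

section
namespace B1

section Chain2
variable {S : Type*} [CommRing S] {π : S} {N q : ℕ}
variable {M : Type*} [AddCommGroup M] [Module S M]

lemma card_preimage (i : ℕ) (W' : Submodule S M) (hW' : ∀ w ∈ W', ∃ m, w = π ^ i • m) :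
    Nat.card {y : M // π ^ i • y ∈ W'} = Nat.card {y : M // π ^ i • y = 0} * Nat.card W' := by
  let P : Submodule S M := W'.comap (LinearMap.lsmul S M (π ^ i))
  let f : P →ₗ[S] W' := (LinearMap.lsmul S M (π ^ i)).restrict (fun x hx => hx)
  have h := card_ker_range f.toAddMonoidHom
  have h1 : Nat.card P = Nat.card {y : M // π ^ i • y ∈ W'} := rfl
  rw [← h1, ← h]
  congr 1
  · refine Nat.card_congr
      { toFun := fun x => ⟨x.1.1, congrArg Subtype.val x.2⟩
        invFun := fun y => ⟨⟨y.1, ?_⟩, ?_⟩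
        left_inv := fun _ => rfl
        right_inv := fun _ => rfl }
    · change π ^ i • y.1 ∈ W'
      rw [y.2]; exact W'.zero_mem
    · exact Subtype.ext y.2
  · refine Nat.card_congr (Equiv.subtypeUnivEquiv ?_)
    rintro ⟨w, hw⟩
    obtain ⟨m, rfl⟩ := hW' w hw
    exact ⟨⟨m, hw⟩, rfl⟩

/-- the fibre -/
def Fib (W' : Submodule S M) (J : Ideal S) : Set (Submodule S (M × S)) :=
  {W | W.comap (LinearMap.inl S M S) = W' ∧ W.map (LinearMap.snd S M S) = J}

lemma mem_of_fib {W' : Submodule S M} {c : S} {W : Submodule S (M × S)}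
    (hW : W ∈ Fib W' (Ideal.span {c})) {y : M} (hy : (y, c) ∈ W) (m : M) (s : S) :
    (m, s) ∈ W ↔ ∃ r, s = r * c ∧ m - r • y ∈ W' := by
  obtain ⟨h1, h2⟩ := hW
  have h1' : ∀ m, (m, (0 : S)) ∈ W ↔ m ∈ W' := by intro m; rw [← h1]; rfl
  constructor
  · intro h
    have : s ∈ Ideal.span {c} := by rw [← h2]; exact ⟨_, h, rfl⟩
    obtain ⟨r, rfl⟩ := Ideal.mem_span_singleton'.mp this
    refine ⟨r, rfl, ?_⟩
    rw [← h1']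
    have := W.sub_mem h (W.smul_mem r hy)
    simpa using this
  · rintro ⟨r, rfl, h⟩
    rw [← h1'] at h
    have := W.add_mem h (W.smul_mem r hy)
    simpa using this

lemma card_fib [Finite M] (h : ChainRing S π N q) (hq : 0 < q) (i : ℕ) (hi : i ≤ N)
    (W' : Submodule S M) (hW' : ∀ w ∈ W', ∃ m, w = π ^ i • m) :
    Nat.card (Fib W' (Ideal.span {π ^ (N - i)})) = Nat.card {y : M // π ^ i • y = 0} := by
  have := h.fin
  set c := π ^ (N - i) with hc
  have hcN : π ^ i * c = 0 := by
    rw [hc, ← pow_add, (by omega : i + (N - i) = N), h.pow_zero']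
  have hcard : ∀ W : Fib W' (Ideal.span {c}), Nat.card {y : M // (y, c) ∈ W.1} = Nat.card W' := by
    intro W
    have : c ∈ W.1.map (LinearMap.snd S M S) := by
      rw [W.2.2]; exact Ideal.mem_span_singleton_self _
    obtain ⟨⟨y0, c'⟩, hy0, hcc⟩ := this
    have hcc' : c' = c := hcc
    subst hcc'
    have h1' : ∀ m, (m, (0 : S)) ∈ W.1 ↔ m ∈ W' := by
      intro m; conv_rhs => rw [← W.2.1]
      rfl
    refine Nat.card_congr
      { toFun := fun y => ⟨y.1 - y0, ?_⟩
        invFun := fun w => ⟨w.1 + y0, ?_⟩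
        left_inv := fun y => Subtype.ext (sub_add_cancel _ _)
        right_inv := fun y => Subtype.ext (add_sub_cancel_right _ _) }
    · rw [← h1']
      have := W.1.sub_mem y.2 hy0
      simpa using this
    · have := W.1.add_mem ((h1' _).mpr w.2) hy0
      simpa using this
  let Φ : (Σ W : Fib W' (Ideal.span {c}), {y : M // (y, c) ∈ W.1}) → {y : M // π ^ i • y ∈ W'} :=
    fun x => ⟨x.2.1, by
      have := x.1.1.smul_mem (π ^ i) x.2.2
      rw [Prod.smul_mk, smul_eq_mul, hcN] at this
      exact x.1.2.1.le this⟩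
  have hΦ : Function.Bijective Φ := by
    constructor
    · rintro ⟨W1, y1, hy1⟩ ⟨W2, y2, hy2⟩ heq
      have hy : y1 = y2 := congrArg Subtype.val heq
      subst hy
      have : W1 = W2 := by
        apply Subtype.ext
        ext ⟨m, s⟩
        rw [mem_of_fib W1.2 hy1, mem_of_fib W2.2 hy2]
      subst this
      rfl
    · rintro ⟨y, hy⟩
      let W : Submodule S (M × S) :=
        { carrier := {x | ∃ r, x.2 = r * c ∧ x.1 - r • y ∈ W'}
          add_mem' := by
            rintro a b ⟨r, h1, h2⟩ ⟨r', h1', h2'⟩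
            refine ⟨r + r', ?_, ?_⟩
            · rw [Prod.snd_add, h1, h1', add_mul]
            · have := W'.add_mem h2 h2'
              convert this using 1
              rw [Prod.fst_add, add_smul]; abel
          zero_mem' := ⟨0, by simp, by simp⟩
          smul_mem' := by
            rintro t a ⟨r, h1, h2⟩
            refine ⟨t * r, ?_, ?_⟩
            · rw [Prod.smul_snd, h1, smul_eq_mul, mul_assoc]
            · have := W'.smul_mem t h2
              rwa [smul_sub, smul_smul] at this }
      have hmem : ∀ m s, (m, s) ∈ W ↔ ∃ r, s = r * c ∧ m - r • y ∈ W' := fun m s => Iff.rfl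
      refine ⟨⟨⟨W, ?_, ?_⟩, y, ?_⟩, rfl⟩
      · ext m
        change (m, (0 : S)) ∈ W ↔ _
        rw [hmem]
        constructor
        · rintro ⟨r, hr, hm⟩
          rw [mul_comm, eq_comm, hc, h.ann_iff hq (N - i) (by omega)] at hr
          obtain ⟨t, rfl⟩ := hr
          rw [(by omega : N - (N - i) = i), mul_comm, mul_smul] at hm
          have := W'.add_mem hm (W'.smul_mem t hy)
          rwa [sub_add_cancel] at this
        · intro hm
          exact ⟨0, by simp, by simpa using hm⟩
      · ext s
        rw [Ideal.mem_span_singleton']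
        constructor
        · rintro ⟨⟨m, s'⟩, ⟨r, hr, _⟩, hs⟩
          have hs' : s' = s := hs
          subst hs'
          exact ⟨r, hr.symm⟩
        · rintro ⟨r, rfl⟩
          exact ⟨(r • y, r * c), ⟨r, rfl, by simp⟩, rfl⟩
      · exact ⟨1, by simp, by simp⟩
  have h1 := Nat.card_eq_of_bijective Φ hΦ
  have : Fintype (Fib W' (Ideal.span {c})) := Fintype.ofFinite _
  rw [card_preimage i W' hW', Nat.card_sigma, Finset.sum_congr rfl (fun W _ => hcard W),
    Finset.sum_const, Finset.card_univ, smul_eq_mul, ← Nat.card_eq_fintype_card] at h1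
  exact Nat.eq_of_mul_eq_mul_right Nat.card_pos h1

lemma card_of_fib [Finite M] [Finite S] {W' : Submodule S M} {J : Ideal S}
    {W : Submodule S (M × S)} (hW : W ∈ Fib W' J) : Nat.card W = Nat.card W' * Nat.card J := by
  let f : W →ₗ[S] S := (LinearMap.snd S M S).comp W.subtype
  have h := card_ker_range f.toAddMonoidHom
  rw [← h]
  congr 1
  · refine Nat.card_congr
      { toFun := fun x => ⟨x.1.1.1, ?_⟩
        invFun := fun y => ⟨⟨(y.1, 0), ?_⟩, rfl⟩
        left_inv := fun x => ?_
        right_inv := fun _ => rfl }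
    · rw [← hW.1]
      have : x.1.1 = (x.1.1.1, 0) := Prod.ext rfl x.2
      change (x.1.1.1, 0) ∈ W
      rw [← this]
      exact x.1.2
    · exact hW.1.ge y.2
    · apply Subtype.ext
      apply Subtype.ext
      exact (Prod.ext rfl x.2 : x.1.1 = (x.1.1.1, 0)).symm
  · rw [← hW.2]
    refine Nat.card_congr (Equiv.subtypeEquivRight fun x => ?_)
    constructor
    · rintro ⟨y, rfl⟩; exact ⟨y.1, y.2, rfl⟩
    · rintro ⟨y, hy, rfl⟩; exact ⟨⟨y, hy⟩, rfl⟩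


lemma card_sub_prod [Finite M] (h : ChainRing S π N q) (p f : ℕ) (hp : p.Prime) (hf : 0 < f)
    (hqf : q = p ^ f) (n : ℕ) (hM : ∀ i ≤ N, Nat.card {y : M // π ^ i • y = 0} = q ^ (i * n))
    (hM' : ∀ i ≤ N, ∀ y : M, π ^ i • y = 0 → ∃ m, y = π ^ (N - i) • m)
    (j : ℕ) (hj : j ≤ N) :
    Nat.card {W : Submodule S (M × S) // Nat.card W = p ^ j} =
      ∑ x ∈ Finset.HasAntidiagonal.antidiagonal j, (if f ∣ x.1 then 1 else 0) * p ^ (x.1 * n) *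
        Nat.card {W : Submodule S M // Nat.card W = p ^ x.2} := by
  classical
  have := h.fin
  have := Fintype.ofFinite (Submodule S (M × S))
  have := Fintype.ofFinite (Submodule S M)
  have hq : 0 < q := by rw [hqf]; exact pow_pos hp.pos _
  have hin := Nat.pow_right_injective hp.two_le
  simp only [Nat.card_eq_fintype_card, Fintype.card_subtype]
  rw [Finset.card_eq_sum_card_fiberwise (t := Finset.HasAntidiagonal.antidiagonal j)
    (f := fun W : Submodule S (M × S) => (Nat.log p (Nat.card (W.map (LinearMap.snd S M S))),
      Nat.log p (Nat.card (W.comap (LinearMap.inl S M S)))))]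
  · refine Finset.sum_congr rfl ?_
    rintro ⟨a, b⟩ hab
    have hab' := Finset.HasAntidiagonal.mem_antidiagonal.mp hab
    simp only at hab' ⊢
    rw [Finset.card_eq_sum_card_fiberwise (t := Finset.univ.filter
      (fun W : Submodule S M => Nat.card W = p ^ b))
      (f := fun W : Submodule S (M × S) => W.comap (LinearMap.inl S M S))]
    · rw [mul_comm, ← smul_eq_mul]
      apply Finset.sum_eq_card_nsmul
      intro W' hW'
      simp only [Finset.mem_filter, Finset.mem_univ, true_and] at hW'
      have hW'2 : Nat.card W' = p ^ b := hW'
      split_ifs with hfa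
      · obtain ⟨i, rfl⟩ := hfa
        have hia : i ≤ f * i := Nat.le_mul_of_pos_left _ hf
        have hiN : i ≤ N := by omega
        have hfib := card_fib h hq i hiN W' (by
          intro w hw
          have hk : π ^ b • w = 0 := by
            have := pow_eq_zero_of_card hp b ⟨b, le_rfl, hW'2⟩
              (LinearMap.lsmul S W' π).toAddMonoidHom (by
                intro x
                refine ⟨N, ?_⟩
                have : ∀ k : ℕ, ((LinearMap.lsmul S W' π).toAddMonoidHom^[k]) x = π ^ k • x := by
                  intro k
                  induction k with
                  | zero => simp
                  | succ k ih =>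
                    rw [Function.iterate_succ_apply', ih, pow_succ', mul_smul]; rfl
                rw [this, h.pow_zero', zero_smul]) ⟨w, hw⟩
            have h2 : ∀ k : ℕ, ∀ x, ((LinearMap.lsmul S W' π).toAddMonoidHom^[k]) x = π ^ k • x := by
              intro k x
              induction k with
              | zero => simp
              | succ k ih =>
                rw [Function.iterate_succ_apply', ih, pow_succ', mul_smul]; rfl
            rw [h2] at this
            exact congrArg Subtype.val this
          obtain ⟨m, rfl⟩ := hM' b (by omega) w hk
          refine ⟨π ^ (N - b - i) • m, ?_⟩
          rw [smul_smul, ← pow_add]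
          congr 2; omega)
        rw [hM i hiN, Nat.card_eq_fintype_card] at hfib
        rw [one_mul, mul_assoc, pow_mul, ← hqf, ← hfib, Fintype.card_subtype]
        congr 1
        ext W
        simp only [Finset.mem_filter, Finset.mem_univ, true_and]
        constructor
        · rintro ⟨⟨hW, hW2⟩, hW3⟩
          refine ⟨hW3, ?_⟩
          have hc := card_of_fib (W' := W') (J := W.map (LinearMap.snd S M S)) ⟨hW3, rfl⟩
          obtain ⟨i', hi', hJ⟩ := h.ideal (W.map (LinearMap.snd S M S))
          rw [hJ]
          have hc' : Nat.card W = p ^ j := hW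
          rw [hJ, hW'2, hc', h.card i' hi', hqf, ← pow_mul, ← pow_add] at hc
          have := hin hc
          have h5 : f * (N - i') = f * i := by omega
          have h6 := Nat.eq_of_mul_eq_mul_left hf h5
          congr 3; omega
        · rintro ⟨hW1, hW2⟩
          have hc := card_of_fib (W' := W') (J := W.map (LinearMap.snd S M S)) ⟨hW1, rfl⟩
          rw [hW2, hW'2, h.card _ (by omega), hqf, ← pow_mul, ← pow_add] at hc
          refine ⟨⟨?_, ?_⟩, hW1⟩
          · rw [hc]
            congr 1
            rw [(by omega : N - (N - i) = i)]; omega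
          · rw [hW1, hW2, hW'2, h.card _ (by omega), hqf, ← pow_mul, Nat.log_pow hp.one_lt,
              Nat.log_pow hp.one_lt, (by omega : N - (N - i) = i)]
      · rw [zero_mul, Finset.card_eq_zero, Finset.filter_eq_empty_iff]
        intro W hW hW3
        simp only [Finset.mem_filter, Finset.mem_univ, true_and] at hW
        obtain ⟨i', hi', hJ⟩ := h.ideal (W.map (LinearMap.snd S M S))
        have h1 := congrArg Prod.fst hW.2
        simp only at h1
        rw [hJ, h.card i' hi', hqf, ← pow_mul, Nat.log_pow hp.one_lt] at h1
        exact hfa ⟨_, h1.symm⟩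
    · intro W hW
      simp only [Finset.coe_filter, Finset.mem_filter, Finset.mem_univ, true_and, Set.mem_ofPred_eq] at hW ⊢
      have h1 := congrArg Prod.snd hW.2
      simp only at h1
      have hc := card_of_fib (W := W) ⟨rfl, rfl⟩
      have hd : Nat.card (W.comap (LinearMap.inl S M S)) ∣ p ^ j := by
        rw [← hW.1, hc]; exact dvd_mul_right _ _
      obtain ⟨e, _, he⟩ := (Nat.dvd_prime_pow hp).mp hd
      rw [he, Nat.log_pow hp.one_lt] at h1
      rw [he, h1]
  · intro W hW
    simp only [Finset.coe_filter, Finset.mem_univ, true_and, Set.mem_ofPred_eq] at hW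
    simp only [Finset.mem_coe, Finset.HasAntidiagonal.mem_antidiagonal]
    have hc := card_of_fib (W := W) ⟨rfl, rfl⟩
    rw [hW] at hc
    obtain ⟨e, _, he⟩ := (Nat.dvd_prime_pow hp).mp (Dvd.intro _ hc.symm)
    obtain ⟨e', _, he'⟩ := (Nat.dvd_prime_pow hp).mp (Dvd.intro_left _ hc.symm)
    rw [he, he', ← pow_add] at hc
    rw [he, he', Nat.log_pow hp.one_lt, Nat.log_pow hp.one_lt]
    have := hin hc
    omega

lemma card_sub_congr {M M' : Type*} [AddCommGroup M] [Module S M] [AddCommGroup M'] [Module S M']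
    (e : M ≃ₗ[S] M') (c : ℕ) :
    Nat.card {W : Submodule S M // Nat.card W = c} =
      Nat.card {W : Submodule S M' // Nat.card W = c} := by
  refine Nat.card_congr (Equiv.subtypeEquiv (Submodule.orderIsoMapComap e).toEquiv fun W => ?_)
  have : Nat.card W = Nat.card (W.map (e : M →ₗ[S] M')) :=
    Nat.card_congr (e.submoduleMap W).toEquiv
  rw [this]
  rfl

/-- local zeta factor -/
noncomputable def zloc (f : ℕ) : PowerSeries ℚ := PowerSeries.mk fun a => if f ∣ a then 1 else 0

theorem card_sub_pi (h : ChainRing S π N q) (p f : ℕ) (hp : p.Prime) (hf : 0 < f)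
    (hqf : q = p ^ f) (n : ℕ) : ∀ (j : ℕ) (_ : j ≤ N),
    (Nat.card {W : Submodule S (Fin n → S) // Nat.card W = p ^ j} : ℚ) =
      PowerSeries.coeff j (∏ i ∈ Finset.range n, PowerSeries.rescale ((p : ℚ) ^ i) (zloc f)) := by
  have := h.fin
  have hq : 0 < q := by rw [hqf]; exact pow_pos hp.pos _
  induction n with
  | zero =>
    intro j hj
    rw [Finset.range_zero, Finset.prod_empty, PowerSeries.coeff_one]
    have hW : ∀ W : Submodule S (Fin 0 → S), Nat.card W = 1 := fun W => by
      rw [Nat.card_eq_one_iff_unique]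
      exact ⟨inferInstance, ⟨0⟩⟩
    split_ifs with h0
    · subst h0
      have : Nat.card {W : Submodule S (Fin 0 → S) // Nat.card W = p ^ 0} = 1 := by
        rw [Nat.card_eq_one_iff_unique]
        exact ⟨⟨fun a b => Subtype.ext (Subsingleton.elim _ _)⟩, ⟨⊥, hW _⟩⟩
      rw [this]; simp
    · have : IsEmpty {W : Submodule S (Fin 0 → S) // Nat.card W = p ^ j} := by
        refine ⟨fun W => ?_⟩
        have := W.2
        rw [hW] at this
        have h2 := Nat.one_lt_pow h0 hp.one_lt
        omega
      rw [Nat.card_of_isEmpty]; simp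
  | succ n ih =>
    intro j hj
    rw [← card_sub_congr ((LinearEquiv.prodComm S (Fin n → S) S).trans
      (Fin.consLinearEquiv S (fun _ : Fin (n + 1) => S))) (p ^ j),
      card_sub_prod h p f hp hf hqf n ?_ ?_ j hj, Finset.prod_range_succ, mul_comm,
      PowerSeries.coeff_mul]
    · push_cast
      refine Finset.sum_congr rfl ?_
      rintro ⟨a, b⟩ hab
      have hab' := Finset.HasAntidiagonal.mem_antidiagonal.mp hab
      simp only at hab' ⊢
      rw [ih b (by omega), PowerSeries.coeff_rescale, zloc, PowerSeries.coeff_mk]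
      rw [← pow_mul, mul_comm n a]
      ring
    · intro i hi
      have e : {y : Fin n → S // π ^ i • y = 0} ≃ (Fin n → {s : S // π ^ i * s = 0}) :=
        { toFun := fun y k => ⟨y.1 k, congrFun y.2 k⟩
          invFun := fun y => ⟨fun k => (y k).1, funext fun k => (y k).2⟩
          left_inv := fun _ => rfl
          right_inv := fun _ => rfl }
      rw [Nat.card_congr e, Nat.card_fun, h.card_ann hq i hi, Nat.card_fin, pow_mul]
    · intro i hi y hy
      have : ∀ k, ∃ t, y k = π ^ (N - i) * t := fun k =>
        (h.ann_iff hq i hi (y k)).mp (congrFun hy k)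
      choose t ht using this
      exact ⟨t, funext ht⟩

end Chain2
end B1
end

section
namespace B1

section Local
variable {D : Type u} [Ring D]

/-- `𝒜` is a local order all of whose truncations are matrix algebras over a chain ring -/
def LocOrd (𝒜 : Subring D) (ϖ : Dˣ) (n q : ℕ) : Prop :=
  (∀ x : D, ϖ * x = x * ϖ) ∧ (ϖ : D) ∈ 𝒜 ∧ (∀ s : D, ∃ k : ℕ, (ϖ : D) ^ k * s ∈ 𝒜) ∧
  ∀ N : ℕ, ∃ (S : Type u) (_ : CommRing S) (π : S) (φ : 𝒜 →+* Matrix (Fin n) (Fin n) S),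
    ChainRing S π N q ∧ Function.Surjective φ ∧
      ∀ a : 𝒜, φ a = 0 ↔ ∃ b ∈ 𝒜, (a : D) = (ϖ : D) ^ N * b

section LW
variable {S : Type*} [CommRing S] {n : ℕ} {𝒜 : Subring D} (φ : 𝒜 →+* Matrix (Fin n) (Fin n) S)

/-- the lattice attached to a submodule -/
def LW (t : D) (W : Submodule S (Fin n → S)) : AddSubgroup D where
  carrier := {x | ∃ h : t * x ∈ 𝒜, ∀ k, (fun i => φ ⟨t * x, h⟩ i k) ∈ W}
  add_mem' := by
    rintro a b ⟨ha, ha'⟩ ⟨hb, hb'⟩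
    have hab : t * (a + b) ∈ 𝒜 := by rw [mul_add]; exact 𝒜.add_mem ha hb
    refine ⟨hab, fun k => ?_⟩
    have : (⟨t * (a + b), hab⟩ : 𝒜) = ⟨t * a, ha⟩ + ⟨t * b, hb⟩ := Subtype.ext (mul_add _ _ _)
    rw [this, map_add]
    exact W.add_mem (ha' k) (hb' k)
  zero_mem' := by
    have h0 : t * 0 ∈ 𝒜 := by rw [mul_zero]; exact 𝒜.zero_mem
    refine ⟨h0, fun k => ?_⟩
    have : (⟨t * 0, h0⟩ : 𝒜) = 0 := Subtype.ext (mul_zero _)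
    rw [this, map_zero]
    exact W.zero_mem
  neg_mem' := by
    rintro a ⟨ha, ha'⟩
    have hab : t * (-a) ∈ 𝒜 := by rw [mul_neg]; exact 𝒜.neg_mem ha
    refine ⟨hab, fun k => ?_⟩
    have : (⟨t * (-a), hab⟩ : 𝒜) = - ⟨t * a, ha⟩ := Subtype.ext (mul_neg _ _)
    rw [this, map_neg]
    exact W.neg_mem (ha' k)

variable {φ} {t : Dˣ} 

lemma LW_mul (W : Submodule S (Fin n → S)) : ∀ u ∈ LW φ t W, ∀ a ∈ 𝒜, u * a ∈ LW φ t W := by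
  rintro u ⟨hu, hu'⟩ a ha
  have h1 : (t : D) * (u * a) ∈ 𝒜 := by rw [← mul_assoc]; exact 𝒜.mul_mem hu ha
  refine ⟨h1, fun k => ?_⟩
  have : (⟨t * (u * a), h1⟩ : 𝒜) = ⟨t * u, hu⟩ * ⟨a, ha⟩ := Subtype.ext (mul_assoc _ _ _).symm
  rw [this, map_mul]
  have h2 : (fun i => (φ ⟨t * u, hu⟩ * φ ⟨a, ha⟩) i k) =
      ∑ l, φ ⟨a, ha⟩ l k • (fun i => φ ⟨t * u, hu⟩ i l) := by
    ext i
    simp [Matrix.mul_apply, mul_comm]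
  rw [h2]
  exact W.sum_mem fun l _ => W.smul_mem _ (hu' l)

lemma le_LW (hker : ∀ a : 𝒜, φ a = 0 ↔ ∃ b ∈ 𝒜, (a : D) = (t : D) * b) (ht : (t : D) ∈ 𝒜)
    (W : Submodule S (Fin n → S)) : 𝒜.toAddSubgroup ≤ LW φ t W := by
  intro a ha
  have h1 : (t : D) * a ∈ 𝒜 := 𝒜.mul_mem ht ha
  refine ⟨h1, fun k => ?_⟩
  have : φ ⟨t * a, h1⟩ = 0 := (hker _).mpr ⟨a, ha, rfl⟩
  rw [this]
  exact W.zero_mem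

lemma relIndex_LW (hker : ∀ a : 𝒜, φ a = 0 ↔ ∃ b ∈ 𝒜, (a : D) = (t : D) * b)
    (hsurj : Function.Surjective φ) (W : Submodule S (Fin n → S)) :
    𝒜.toAddSubgroup.relIndex (LW φ t W) = Nat.card W ^ n := by
  let ψ : LW φ t W →+ (Fin n → W) :=
    { toFun := fun x k => ⟨fun i => φ ⟨t * x.1, x.2.choose⟩ i k, x.2.choose_spec k⟩
      map_zero' := by
        ext k i
        have h0 : (⟨t * ((0 : LW φ t W) : D), (0 : LW φ t W).2.choose⟩ : 𝒜) = 0 :=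
          Subtype.ext (mul_zero _)
        change φ ⟨t * ((0 : LW φ t W) : D), (0 : LW φ t W).2.choose⟩ i k = 0
        rw [h0, map_zero]; rfl
      map_add' := by
        intro x y
        ext k i
        have h0 : (⟨t * ((x + y : LW φ t W) : D), (x + y).2.choose⟩ : 𝒜) =
            ⟨t * x.1, x.2.choose⟩ + ⟨t * y.1, y.2.choose⟩ :=
          Subtype.ext (mul_add _ _ _)
        change φ ⟨t * ((x + y : LW φ t W) : D), (x + y).2.choose⟩ i k = _
        rw [h0, map_add]; rfl }
  have hk : ψ.ker = 𝒜.toAddSubgroup.addSubgroupOf (LW φ t W) := by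
    ext x
    rw [AddMonoidHom.mem_ker, AddSubgroup.mem_addSubgroupOf]
    have h1 : ψ x = 0 ↔ φ ⟨t * x.1, x.2.choose⟩ = 0 := by
      constructor
      · intro h
        ext i k
        exact congrFun (congrArg Subtype.val (congrFun h k)) i
      · intro h
        ext k i
        exact congrFun (congrFun h i) k
    rw [h1, hker]
    constructor
    · rintro ⟨b, hb, hb'⟩
      have : x.1 = b := by simpa using hb'
      rw [this]; exact hb
    · intro h
      exact ⟨x.1, h, rfl⟩
  have hs : Function.Surjective ψ := by
    intro w
    obtain ⟨a, ha⟩ := hsurj (Matrix.of fun i k => (w k).1 i)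
    have h1 : (t : D) * ((t⁻¹ : Dˣ) * a.1) = a.1 := by simp
    have h2 : (t : D) * ((t⁻¹ : Dˣ) * a.1) ∈ 𝒜 := by rw [h1]; exact a.2
    have h3 : (⟨(t : D) * ((t⁻¹ : Dˣ) * a.1), h2⟩ : 𝒜) = a := Subtype.ext h1
    refine ⟨⟨(t⁻¹ : Dˣ) * a.1, h2, fun k => ?_⟩, ?_⟩
    · rw [h3, ha]; exact (w k).2
    · ext k i
      change φ ⟨(t : D) * ((t⁻¹ : Dˣ) * a.1), h2⟩ i k = _
      rw [h3, ha]; rfl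
  rw [AddSubgroup.relIndex, ← hk, AddSubgroup.index_ker, AddMonoidHom.range_eq_top.mpr hs]
  rw [AddSubgroup.card_top, Nat.card_fun, Nat.card_fin]

lemma LW_inj (hsurj : Function.Surjective φ) (k0 : Fin n) {W W' : Submodule S (Fin n → S)} (h : LW φ t W ≤ LW φ t W') :
    W ≤ W' := by
  intro v hv
  obtain ⟨a, ha⟩ := hsurj (Matrix.of fun i k => if k = k0 then v i else 0)
  have h1 : (t : D) * ((t⁻¹ : Dˣ) * a.1) = a.1 := by simp
  have h2 : (t : D) * ((t⁻¹ : Dˣ) * a.1) ∈ 𝒜 := by rw [h1]; exact a.2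
  have h3 : (⟨(t : D) * ((t⁻¹ : Dˣ) * a.1), h2⟩ : 𝒜) = a := Subtype.ext h1
  have h4 : ((t⁻¹ : Dˣ) : D) * a.1 ∈ LW φ t W := by
    refine ⟨h2, fun k => ?_⟩
    rw [h3, ha]
    by_cases hk : k = k0
    · simpa [hk] using hv
    · simp only [Matrix.of_apply, if_neg hk]
      exact W.zero_mem
  obtain ⟨h5, h6⟩ := h h4
  have := h6 k0
  have h7 : (⟨(t : D) * ((t⁻¹ : Dˣ) * a.1), h5⟩ : 𝒜) = a := Subtype.ext h1
  rw [h7, ha] at this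
  simpa using this

lemma LW_surj (hker : ∀ a : 𝒜, φ a = 0 ↔ ∃ b ∈ 𝒜, (a : D) = (t : D) * b)
    (hsurj : Function.Surjective φ) (k0 : Fin n) (L : AddSubgroup D)
    (hL : 𝒜.toAddSubgroup ≤ L)
    (hLm : ∀ u ∈ L, ∀ a ∈ 𝒜, u * a ∈ L) (hLt : ∀ x ∈ L, (t : D) * x ∈ 𝒜) :
    ∃ W : Submodule S (Fin n → S), LW φ t W = L := by
  classical
  let I : Set (Matrix (Fin n) (Fin n) S) := {A | ∃ x, ∃ h : x ∈ L, φ ⟨t * x, hLt x h⟩ = A}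
  have Iadd : ∀ A ∈ I, ∀ B ∈ I, A + B ∈ I := by
    rintro _ ⟨x, hx, rfl⟩ _ ⟨y, hy, rfl⟩
    refine ⟨x + y, L.add_mem hx hy, ?_⟩
    rw [← map_add]
    congr 1
    exact Subtype.ext (mul_add _ _ _)
  have Izero : (0 : Matrix (Fin n) (Fin n) S) ∈ I := by
    refine ⟨0, L.zero_mem, ?_⟩
    rw [← map_zero φ]
    congr 1
    exact Subtype.ext (mul_zero _)
  have Imul : ∀ A ∈ I, ∀ B, A * B ∈ I := by
    rintro _ ⟨x, hx, rfl⟩ B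
    obtain ⟨b, rfl⟩ := hsurj B
    refine ⟨x * b, hLm x hx b b.2, ?_⟩
    rw [← map_mul]
    congr 1
    exact Subtype.ext (mul_assoc _ _ _).symm
  have Isum : ∀ A : Fin n → Matrix (Fin n) (Fin n) S, (∀ k, A k ∈ I) → ∑ k, A k ∈ I := by
    intro A hA
    exact Finset.sum_induction _ (· ∈ I) (fun a b ha hb => Iadd a ha b hb) Izero (fun k _ => hA k)
  have Imem : ∀ x (h : (t : D) * x ∈ 𝒜), φ ⟨t * x, h⟩ ∈ I → x ∈ L := by
    rintro x h ⟨y, hy, hxy⟩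
    have h1 : φ (⟨t * x, h⟩ - ⟨t * y, hLt y hy⟩) = 0 := by rw [map_sub, hxy, sub_self]
    obtain ⟨b, hb, hb'⟩ := (hker _).mp h1
    have h2 : (t : D) * x - t * y = t * b := hb'
    have h3 : x - y = b := by
      rw [← mul_sub] at h2
      simpa using h2
    have : x = b + y := by rw [← h3, sub_add_cancel]
    rw [this]
    exact L.add_mem (hL hb) hy
  let cm : (Fin n → S) → Matrix (Fin n) (Fin n) S := fun v => Matrix.of fun i k => if k = k0 then v i else 0
  let W : Submodule S (Fin n → S) :=
    { carrier := {v | cm v ∈ I}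
      add_mem' := by
        intro a b ha hb
        have : cm (a + b) = cm a + cm b := by
          ext i k
          simp only [cm, Matrix.of_apply, Matrix.add_apply, Pi.add_apply]
          split_ifs <;> simp
        change cm (a + b) ∈ I
        rw [this]; exact Iadd _ ha _ hb
      zero_mem' := by
        have : cm 0 = 0 := by ext i k; simp [cm]
        change cm 0 ∈ I
        rw [this]; exact Izero
      smul_mem' := by
        intro s v hv
        have : cm (s • v) = cm v * (Matrix.scalar (Fin n) s) := by
          ext i k
          simp only [cm, Matrix.of_apply, Matrix.scalar_apply, Matrix.mul_diagonal, Pi.smul_apply,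
            smul_eq_mul]
          split_ifs <;> simp [mul_comm]
        change cm (s • v) ∈ I
        rw [this]; exact Imul _ hv _ }
  have hW : ∀ v, v ∈ W ↔ cm v ∈ I := fun v => Iff.rfl
  have hcol : ∀ (A : Matrix (Fin n) (Fin n) S) k,
      cm (fun i => A i k) = A * Matrix.single k k0 1 := by
    intro A k
    ext i l
    simp only [cm, Matrix.of_apply]
    split_ifs with h
    · subst h; simp
    · rw [Matrix.mul_single_apply_of_ne]
      exact h
  have hrec : ∀ (A : Matrix (Fin n) (Fin n) S),
      A = ∑ k, cm (fun i => A i k) * Matrix.single k0 k 1 := by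
    intro A
    have h1 : ∀ k, cm (fun i => A i k) * Matrix.single k0 k 1 = A * Matrix.single k k 1 := by
      intro k
      rw [hcol, Matrix.mul_assoc, Matrix.single_mul_single_same, mul_one]
    simp_rw [h1]
    rw [← Finset.mul_sum, Matrix.sum_single_one, mul_one]
  refine ⟨W, le_antisymm ?_ ?_⟩
  · rintro x ⟨h, hx⟩
    refine Imem x h ?_
    rw [hrec (φ ⟨t * x, h⟩)]
    exact Isum _ fun k => Imul _ ((hW _).mp (hx k)) _
  · intro x hx
    refine ⟨hLt x hx, fun k => ?_⟩
    rw [hW, hcol]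
    exact Imul _ ⟨x, hx, rfl⟩ _

end LW

lemma loc_bound {𝒜 : Subring D} {ϖ : Dˣ} {n q p : ℕ} (hp : p.Prime) (h : LocOrd 𝒜 ϖ n q) (m : ℕ)
    (L : AddSubgroup D) (hL : L ∈ EffSet 𝒜 p m) : ∀ x ∈ L, (ϖ : D) ^ m * x ∈ 𝒜 := by
  obtain ⟨hcen, hϖ, htor, -⟩ := h
  obtain ⟨h1, h2, h3⟩ := hL
  let μ : L →+ L := ((AddMonoidHom.mulLeft (ϖ : D)).comp L.subtype).codRestrict L (by
    intro x
    change (ϖ : D) * x.1 ∈ L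
    rw [hcen]
    exact h2 _ x.2 _ hϖ)
  let K := 𝒜.toAddSubgroup.addSubgroupOf L
  have hK : K ≤ K.comap μ := by
    intro x hx
    exact 𝒜.mul_mem hϖ hx
  let f : L ⧸ K →+ L ⧸ K := QuotientAddGroup.map K K μ hK
  have hit : ∀ (k : ℕ) (x : L), ∃ y : L, (y : D) = (ϖ : D) ^ k * x ∧
      (f^[k]) (QuotientAddGroup.mk x) = QuotientAddGroup.mk y := by
    intro k x
    induction k with
    | zero => exact ⟨x, by simp, rfl⟩
    | succ k ih =>
      obtain ⟨y, hy, hy'⟩ := ih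
      refine ⟨μ y, ?_, ?_⟩
      · change (ϖ : D) * y.1 = _
        rw [hy, pow_succ', mul_assoc]
      · rw [Function.iterate_succ_apply', hy']
        rfl
  have hiff : ∀ (k : ℕ) (x : L), (f^[k]) (QuotientAddGroup.mk x) = 0 ↔ (ϖ : D) ^ k * x ∈ 𝒜 := by
    intro k x
    obtain ⟨y, hy, hy'⟩ := hit k x
    rw [hy', QuotientAddGroup.eq_zero_iff, ← hy]
    rfl
  intro x hx
  rw [← hiff m ⟨x, hx⟩]
  refine pow_eq_zero_of_card hp m ⟨m, le_rfl, h3⟩ f ?_ _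
  intro y
  obtain ⟨y, rfl⟩ := QuotientAddGroup.mk_surjective y
  obtain ⟨k, hk⟩ := htor y.1
  exact ⟨k, (hiff k y).mpr hk⟩

theorem loc_count {𝒜 : Subring D} {ϖ : Dˣ} {n p f : ℕ} (hp : p.Prime) (hf : 0 < f) (hn : 0 < n)
    (h : LocOrd 𝒜 ϖ n (p ^ f)) (m : ℕ) :
    (EffSet 𝒜 p m).Finite ∧ (¬ n ∣ m → EffSet 𝒜 p m = ∅) ∧ ∀ j, m = n * j →
      (Nat.card (EffSet 𝒜 p m) : ℚ) =
        PowerSeries.coeff j (∏ i ∈ Finset.range n, PowerSeries.rescale ((p : ℚ) ^ i) (zloc f)) := by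
  have hb := loc_bound hp h m
  obtain ⟨hcen, hϖ, htor, hφ⟩ := h
  obtain ⟨S, _, π, φ, hch, hsurj, hker⟩ := hφ m
  have hfinS := hch.fin
  have ht : ((ϖ ^ m : Dˣ) : D) = (ϖ : D) ^ m := Units.val_pow_eq_pow_val _ _
  rw [← ht] at hker
  have htA : ((ϖ ^ m : Dˣ) : D) ∈ 𝒜 := by rw [ht]; exact 𝒜.pow_mem hϖ m
  have hsub : ∀ L ∈ EffSet 𝒜 p m, ∃ W : Submodule S (Fin n → S), LW φ (ϖ ^ m : Dˣ) W = L := by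
    intro L hL
    exact LW_surj hker hsurj ⟨0, hn⟩ L hL.1 hL.2.1 (fun x hx => by rw [ht]; exact hb L hL x hx)
  have hfinsub : Finite (Submodule S (Fin n → S)) := inferInstance
  refine ⟨?_, ?_, ?_⟩
  · exact (Set.finite_range (LW φ ((ϖ ^ m : Dˣ) : D))).subset (fun L hL => hsub L hL)
  · intro hnm
    rw [Set.eq_empty_iff_forall_notMem]
    intro L hL
    obtain ⟨W, rfl⟩ := hsub L hL
    have h1 := relIndex_LW hker hsurj W
    rw [hL.2.2] at h1
    obtain ⟨c, _, hc⟩ := (Nat.dvd_prime_pow hp).mp (Dvd.intro_left (Nat.card W ^ (n - 1))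
      (by rw [← pow_succ, h1]; congr 1; omega : _ = p ^ m))
    rw [hc, ← pow_mul] at h1
    have := Nat.pow_right_injective hp.two_le h1
    exact hnm ⟨c, by rw [this, mul_comm]⟩
  · intro j hj
    rw [← card_sub_pi hch p f hp hf rfl n j (by rw [hj]; exact Nat.le_mul_of_pos_left _ hn)]
    norm_cast
    symm
    have hiff : ∀ W : Submodule S (Fin n → S), Nat.card W = p ^ j ↔
        LW φ (ϖ ^ m : Dˣ) W ∈ EffSet 𝒜 p m := by
      intro W
      have h1 := relIndex_LW hker hsurj W
      constructor
      · intro hW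
        refine ⟨le_LW hker htA W, LW_mul W, ?_⟩
        rw [h1, hW, ← pow_mul, hj, mul_comm]
      · intro hW
        rw [hW.2.2, hj, mul_comm n j, pow_mul] at h1
        exact (Nat.pow_left_injective hn.ne' h1).symm
    refine Nat.card_eq_of_bijective (fun W : {W : Submodule S (Fin n → S) // Nat.card W = p ^ j} =>
      (⟨LW φ (ϖ ^ m : Dˣ) W.1, (hiff _).mp W.2⟩ : EffSet 𝒜 p m)) ⟨?_, ?_⟩
    · intro W W' heq
      have heq' : LW φ (ϖ ^ m : Dˣ) W.1 = LW φ (ϖ ^ m : Dˣ) W'.1 := congrArg Subtype.val heq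
      exact Subtype.ext (le_antisymm (LW_inj hsurj ⟨0, hn⟩ heq'.le) (LW_inj hsurj ⟨0, hn⟩ heq'.ge))
    · rintro ⟨L, hL⟩
      obtain ⟨W, rfl⟩ := hsub L hL
      exact ⟨⟨W, (hiff W).mpr hL⟩, rfl⟩

end Local
end B1
end

section
namespace B1

section Adele
open scoped Classical
variable {ι : Type*} {D : Type*} [Ring D]

/-- restricted product -/
def Adele (𝒜 : ι → Subring D) : Subring (ι → D) where
  carrier := {g | ∀ᶠ v in Filter.cofinite, g v ∈ 𝒜 v}
  mul_mem' := by
    intro a b ha hb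
    change ∀ᶠ v in Filter.cofinite, a v * b v ∈ 𝒜 v
    have ha' : ∀ᶠ v in Filter.cofinite, a v ∈ 𝒜 v := ha
    have hb' : ∀ᶠ v in Filter.cofinite, b v ∈ 𝒜 v := hb
    filter_upwards [ha', hb'] with v h1 h2 using (𝒜 v).mul_mem h1 h2
  one_mem' := by
    change ∀ᶠ v in Filter.cofinite, (1 : D) ∈ 𝒜 v
    exact Filter.Eventually.of_forall fun v => (𝒜 v).one_mem
  add_mem' := by
    intro a b ha hb
    change ∀ᶠ v in Filter.cofinite, a v + b v ∈ 𝒜 v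
    have ha' : ∀ᶠ v in Filter.cofinite, a v ∈ 𝒜 v := ha
    have hb' : ∀ᶠ v in Filter.cofinite, b v ∈ 𝒜 v := hb
    filter_upwards [ha', hb'] with v h1 h2 using (𝒜 v).add_mem h1 h2
  zero_mem' := by
    change ∀ᶠ v in Filter.cofinite, (0 : D) ∈ 𝒜 v
    exact Filter.Eventually.of_forall fun v => (𝒜 v).zero_mem
  neg_mem' := by
    intro a ha
    change ∀ᶠ v in Filter.cofinite, - a v ∈ 𝒜 v
    have ha' : ∀ᶠ v in Filter.cofinite, a v ∈ 𝒜 v := ha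
    filter_upwards [ha'] with v h1 using (𝒜 v).neg_mem h1

/-- integral adeles -/
def IntAdele (𝒜 : ι → Subring D) : Subring (Adele 𝒜) where
  carrier := {g | ∀ v, g.1 v ∈ 𝒜 v}
  mul_mem' := fun ha hb v => (𝒜 v).mul_mem (ha v) (hb v)
  one_mem' := fun v => (𝒜 v).one_mem
  add_mem' := fun ha hb v => (𝒜 v).add_mem (ha v) (hb v)
  zero_mem' := fun v => (𝒜 v).zero_mem
  neg_mem' := fun ha v => (𝒜 v).neg_mem (ha v)

variable (𝒜 : ι → Subring D)

/-- box subgroup -/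
def Box (L : ι → AddSubgroup D) : AddSubgroup (Adele 𝒜) where
  carrier := {g | ∀ v, g.1 v ∈ L v}
  add_mem' := fun ha hb v => (L v).add_mem (ha v) (hb v)
  zero_mem' := fun v => (L v).zero_mem
  neg_mem' := fun ha v => (L v).neg_mem (ha v)

/-- adele concentrated at `v` -/
noncomputable def sg (v : ι) (x : D) : Adele 𝒜 := ⟨Pi.single v x, by
  have : ∀ᶠ w in Filter.cofinite, w ≠ v := by
    rw [Filter.eventually_cofinite]
    exact (Set.finite_singleton v).subset (fun w hw => by simpa using hw)
  change ∀ᶠ w in Filter.cofinite, (Pi.single v x : ι → D) w ∈ 𝒜 w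
  filter_upwards [this] with w hw
  rw [Pi.single_eq_of_ne hw]
  exact (𝒜 w).zero_mem⟩

lemma sg_add (v : ι) (x y : D) : sg 𝒜 v (x + y) = sg 𝒜 v x + sg 𝒜 v y :=
  Subtype.ext (Pi.single_add _ _ _)

lemma sg_same (v : ι) (x : D) : (sg 𝒜 v x).1 v = x := Pi.single_eq_same (M := fun _ : ι => D) v x

lemma sg_ne {v w : ι} (h : w ≠ v) (x : D) : (sg 𝒜 v x).1 w = 0 := Pi.single_eq_of_ne h _

lemma mul_sg (g : Adele 𝒜) (v : ι) (x : D) : g * sg 𝒜 v x = sg 𝒜 v (g.1 v * x) := by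
  apply Subtype.ext
  funext w
  change g.1 w * (sg 𝒜 v x).1 w = _
  by_cases h : w = v
  · subst h; rw [sg_same, sg_same]
  · rw [sg_ne 𝒜 h, sg_ne 𝒜 h, mul_zero]

lemma sg_mem_box {L : ι → AddSubgroup D} {v : ι} {x : D} : sg 𝒜 v x ∈ Box 𝒜 L ↔ x ∈ L v := by
  constructor
  · intro h
    have := h v
    rwa [sg_same] at this
  · intro h w
    by_cases hw : w = v
    · subst hw; rw [sg_same]; exact h
    · rw [sg_ne 𝒜 hw]; exact (L w).zero_mem

lemma box_int : Box 𝒜 (fun v => (𝒜 v).toAddSubgroup) = (IntAdele 𝒜).toAddSubgroup := rfl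

lemma box_mono {L L' : ι → AddSubgroup D} (h : ∀ v, L v ≤ L' v) : Box 𝒜 L ≤ Box 𝒜 L' :=
  fun _ hg v => h v (hg v)

/-- component -/
noncomputable def Comp (U : AddSubgroup (Adele 𝒜)) (v : ι) : AddSubgroup D :=
  U.comap { toFun := sg 𝒜 v, map_zero' := Subtype.ext (Pi.single_zero _), map_add' := sg_add 𝒜 v }

lemma mem_comp {U : AddSubgroup (Adele 𝒜)} {v : ι} {x : D} : x ∈ Comp 𝒜 U v ↔ sg 𝒜 v x ∈ U :=
  Iff.rfl

lemma comp_box (L : ι → AddSubgroup D) : Comp 𝒜 (Box 𝒜 L) = L := by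
  funext v
  ext x
  rw [mem_comp, sg_mem_box]

lemma sg_int {v : ι} {x : D} (hx : x ∈ 𝒜 v) : sg 𝒜 v x ∈ IntAdele 𝒜 :=
  (sg_mem_box 𝒜 (L := fun v => (𝒜 v).toAddSubgroup)).mpr hx

lemma box_comp {U : AddSubgroup (Adele 𝒜)} (h1 : (IntAdele 𝒜).toAddSubgroup ≤ U)
    (h2 : ∀ u ∈ U, ∀ a ∈ IntAdele 𝒜, u * a ∈ U) : Box 𝒜 (Comp 𝒜 U) = U := by
  apply le_antisymm
  · intro g hg
    have hfin : {v | ¬ g.1 v ∈ 𝒜 v}.Finite := Filter.eventually_cofinite.mp g.2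
    have key : ∀ (T : Finset ι) (g : Adele 𝒜), (∀ v ∉ T, g.1 v ∈ 𝒜 v) →
        (∀ v, g.1 v ∈ Comp 𝒜 U v) → g ∈ U := by
      intro T
      induction T using Finset.induction_on with
      | empty => exact fun g hg _ => h1 (fun v => hg v (Finset.notMem_empty v))
      | insert v T hv ih =>
        intro g hg hg'
        have e : g = (g - sg 𝒜 v (g.1 v)) + sg 𝒜 v (g.1 v) := by abel
        rw [e]
        refine U.add_mem (ih _ ?_ ?_) (hg' v)
        · intro w hw
          change g.1 w - (sg 𝒜 v (g.1 v)).1 w ∈ _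
          by_cases hwv : w = v
          · subst hwv; rw [sg_same, sub_self]; exact (𝒜 w).zero_mem
          · rw [sg_ne 𝒜 hwv, sub_zero]
            exact hg w (by simp [hwv, hw])
        · intro w
          change g.1 w - (sg 𝒜 v (g.1 v)).1 w ∈ _
          by_cases hwv : w = v
          · subst hwv; rw [sg_same, sub_self]; exact (Comp 𝒜 U w).zero_mem
          · rw [sg_ne 𝒜 hwv, sub_zero]
            exact hg' w
    refine key hfin.toFinset g ?_ hg
    intro v hv
    by_contra hcon
    exact hv (by simpa using hcon)
  · intro g hg v
    rw [mem_comp]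
    have := h2 g hg (sg 𝒜 v 1) (sg_int 𝒜 (𝒜 v).one_mem)
    rwa [mul_sg, mul_one] at this

lemma relIndex_box (S : Finset ι) (L : ι → AddSubgroup D) (hL : ∀ v, (𝒜 v).toAddSubgroup ≤ L v)
    (hS : ∀ v ∉ S, L v = (𝒜 v).toAddSubgroup) :
    (IntAdele 𝒜).toAddSubgroup.relIndex (Box 𝒜 L) =
      ∏ v ∈ S, (𝒜 v).toAddSubgroup.relIndex (L v) := by
  let Q : S → Type _ := fun v => (L v) ⧸ ((𝒜 v).toAddSubgroup.addSubgroupOf (L v))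
  let ψ : Box 𝒜 L →+ (∀ v : S, Q v) :=
    { toFun := fun g v => QuotientAddGroup.mk (⟨g.1.1 v, g.2 v⟩ : L v)
      map_zero' := rfl
      map_add' := fun _ _ => rfl }
  have hk : ψ.ker = (IntAdele 𝒜).toAddSubgroup.addSubgroupOf (Box 𝒜 L) := by
    ext g
    rw [AddMonoidHom.mem_ker, AddSubgroup.mem_addSubgroupOf]
    constructor
    · intro h v
      by_cases hv : v ∈ S
      · have h1 := congrFun h ⟨v, hv⟩
        exact (QuotientAddGroup.eq_zero_iff _).mp h1
      · have := g.2 v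
        rwa [hS v hv] at this
    · intro h
      funext v
      exact (QuotientAddGroup.eq_zero_iff _).mpr (h v)
  have hs : Function.Surjective ψ := by
    intro y
    have : ∀ v : S, ∃ x : L v, QuotientAddGroup.mk x = y v :=
      fun v => QuotientAddGroup.mk_surjective _
    choose x hx using this
    let g : ι → D := fun v => if h : v ∈ S then (x ⟨v, h⟩ : D) else 0
    have hg : g ∈ Adele 𝒜 := by
      change ∀ᶠ v in Filter.cofinite, g v ∈ 𝒜 v
      rw [Filter.eventually_cofinite]
      refine S.finite_toSet.subset fun v hv => ?_
      by_contra hcon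
      refine hv ?_
      have hcon' : v ∉ S := hcon
      simp only [g, dif_neg hcon']
      exact (𝒜 v).zero_mem
    refine ⟨⟨⟨g, hg⟩, fun v => ?_⟩, ?_⟩
    · change g v ∈ L v
      by_cases h : v ∈ S
      · simp only [g, dif_pos h]; exact (x ⟨v, h⟩).2
      · simp only [g, dif_neg h]; exact (L v).zero_mem
    · funext v
      rw [← hx v]
      change QuotientAddGroup.mk _ = _
      congr 1
      apply Subtype.ext
      change g v = _
      simp only [g, dif_pos v.2]
  rw [AddSubgroup.relIndex, ← hk, AddSubgroup.index_ker, AddMonoidHom.range_eq_top.mpr hs,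
    AddSubgroup.card_top, Nat.card_pi, ← Finset.prod_coe_sort S]
  rfl

theorem card_eff (P d : ℕ) (hP : 2 ≤ P)
    (hloc : ∀ v, ∀ L : AddSubgroup D, (𝒜 v).toAddSubgroup ≤ L → (∀ u ∈ L, ∀ a ∈ 𝒜 v, u * a ∈ L) →
      (𝒜 v).toAddSubgroup.relIndex L ∣ P ^ d → ∃ m, (𝒜 v).toAddSubgroup.relIndex L = P ^ m)
    (hfin : ∀ v m, (EffSet (𝒜 v) P m).Finite)
    (S : Finset ι) (hS : ∀ v ∉ S, ∀ m, 0 < m → m ≤ d → EffSet (𝒜 v) P m = ∅) :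
    (EffSet (IntAdele 𝒜) P d).Finite ∧ (Nat.card (EffSet (IntAdele 𝒜) P d) : ℚ) =
      PowerSeries.coeff d (∏ v ∈ S, PowerSeries.mk fun m => (Nat.card (EffSet (𝒜 v) P m) : ℚ)) := by
  have hinj := Nat.pow_right_injective hP
  -- componentwise properties
  have hcomp : ∀ U ∈ EffSet (IntAdele 𝒜) P d, ∀ v,
      (𝒜 v).toAddSubgroup ≤ Comp 𝒜 U v ∧ (∀ u ∈ Comp 𝒜 U v, ∀ a ∈ 𝒜 v, u * a ∈ Comp 𝒜 U v) ∧
      ∃ m ≤ d, (𝒜 v).toAddSubgroup.relIndex (Comp 𝒜 U v) = P ^ m := by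
    intro U hU v
    have h1 : ∀ v, (𝒜 v).toAddSubgroup ≤ Comp 𝒜 U v := fun v x hx => hU.1 (sg_int 𝒜 hx)
    have h2 : ∀ u ∈ Comp 𝒜 U v, ∀ a ∈ 𝒜 v, u * a ∈ Comp 𝒜 U v := by
      intro u hu a ha
      rw [mem_comp] at hu ⊢
      have := hU.2.1 _ hu _ (sg_int 𝒜 ha)
      rwa [mul_sg, sg_same] at this
    refine ⟨h1 v, h2, ?_⟩
    let L' : ι → AddSubgroup D := fun w => if w = v then Comp 𝒜 U v else (𝒜 w).toAddSubgroup
    have hL' : ∀ w, (𝒜 w).toAddSubgroup ≤ L' w := by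
      intro w
      by_cases h : w = v
      · subst h; simp only [L', if_true]; exact h1 w
      · simp only [L', if_neg h]; exact le_rfl
    have hL'2 : ∀ w, L' w ≤ Comp 𝒜 U w := by
      intro w
      by_cases h : w = v
      · subst h; simp only [L', if_true]; exact le_rfl
      · simp only [L', if_neg h]; exact h1 w
    have h3 := relIndex_box 𝒜 {v} L' hL' (fun w hw => by
      have : w ≠ v := by simpa using hw
      simp only [L', if_neg this])
    rw [Finset.prod_singleton] at h3
    simp only [L', if_true] at h3
    have h4 : (IntAdele 𝒜).toAddSubgroup ≤ Box 𝒜 L' := by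
      rw [← box_int]; exact box_mono 𝒜 hL'
    have h5 : Box 𝒜 L' ≤ U := by
      rw [← box_comp 𝒜 hU.1 hU.2.1]; exact box_mono 𝒜 hL'2
    have h6 := AddSubgroup.relIndex_mul_relIndex _ _ _ h4 h5
    have h7 : (𝒜 v).toAddSubgroup.relIndex (Comp 𝒜 U v) ∣ P ^ d := by
      rw [← hU.2.2, ← h6, ← h3]
      exact dvd_mul_right _ _
    obtain ⟨m, hm⟩ := hloc v _ (h1 v) h2 h7
    refine ⟨m, ?_, hm⟩
    rw [hm] at h7
    exact (Nat.pow_dvd_pow_iff_le_right hP).mp h7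
  have hout : ∀ U ∈ EffSet (IntAdele 𝒜) P d, ∀ v ∉ S, Comp 𝒜 U v = (𝒜 v).toAddSubgroup := by
    intro U hU v hv
    obtain ⟨h1, h2, m, hm, h3⟩ := hcomp U hU v
    have hm0 : m = 0 := by
      by_contra hcon
      have := hS v hv m (Nat.pos_of_ne_zero hcon) hm
      have h4 : Comp 𝒜 U v ∈ EffSet (𝒜 v) P m := ⟨h1, h2, h3⟩
      rw [this] at h4
      exact h4
    rw [hm0, pow_zero, AddSubgroup.relIndex_eq_one] at h3
    exact le_antisymm h3 h1
  -- the map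
  let X := Σ l : Finset.finsuppAntidiag S d, ∀ v : S, EffSet (𝒜 v) P (l.1 v)
  let ext : X → ι → AddSubgroup D := fun x v => if h : v ∈ S then (x.2 ⟨v, h⟩).1 else
    (𝒜 v).toAddSubgroup
  have ext_in : ∀ (x : X) (v : S), ext x v = (x.2 v).1 := fun x v => by
    simp only [ext, dif_pos v.2]
  have ext_out : ∀ (x : X) v, v ∉ S → ext x v = (𝒜 v).toAddSubgroup := fun x v hv => by
    simp only [ext, dif_neg hv]
  have ext_le : ∀ x v, (𝒜 v).toAddSubgroup ≤ ext x v := by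
    intro x v
    by_cases h : v ∈ S
    · rw [ext_in x ⟨v, h⟩]; exact (x.2 ⟨v, h⟩).2.1
    · rw [ext_out x v h]
  have ext_mul : ∀ x v, ∀ u ∈ ext x v, ∀ a ∈ 𝒜 v, u * a ∈ ext x v := by
    intro x v
    by_cases h : v ∈ S
    · rw [ext_in x ⟨v, h⟩]; exact (x.2 ⟨v, h⟩).2.2.1
    · rw [ext_out x v h]; exact fun u hu a ha => (𝒜 v).mul_mem hu ha
  let Ψ : X → EffSet (IntAdele 𝒜) P d := fun x => ⟨Box 𝒜 (ext x), by
    refine ⟨?_, ?_, ?_⟩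
    · rw [← box_int]; exact box_mono 𝒜 (ext_le x)
    · intro u hu a ha v
      exact ext_mul x v _ (hu v) _ (ha v)
    · rw [relIndex_box 𝒜 S _ (ext_le x) (ext_out x)]
      have h1 : ∀ v ∈ S, (𝒜 v).toAddSubgroup.relIndex (ext x v) = P ^ (x.1.1 v) := by
        intro v hv
        rw [ext_in x ⟨v, hv⟩]
        exact (x.2 ⟨v, hv⟩).2.2.2
      rw [Finset.prod_congr rfl h1, Finset.prod_pow_eq_pow_sum]
      congr 1
      exact (Finset.mem_finsuppAntidiag.mp x.1.2).1⟩
  have hΨ : Function.Bijective Ψ := by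
    constructor
    · rintro x y hxy
      have h1 : ext x = ext y := by
        rw [← comp_box 𝒜 (ext x), ← comp_box 𝒜 (ext y)]
        exact congrArg (Comp 𝒜) (congrArg Subtype.val hxy)
      have h2 : ∀ v : S, (x.2 v).1 = (y.2 v).1 := by
        intro v
        rw [← ext_in, ← ext_in, h1]
      have h3 : x.1 = y.1 := by
        apply Subtype.ext
        ext v
        by_cases hv : v ∈ S
        · have a1 := (x.2 ⟨v, hv⟩).2.2.2
          have a2 := (y.2 ⟨v, hv⟩).2.2.2
          rw [h2 ⟨v, hv⟩, a2] at a1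
          exact (hinj a1).symm
        · have a1 := (Finset.mem_finsuppAntidiag.mp x.1.2).2
          have a2 := (Finset.mem_finsuppAntidiag.mp y.1.2).2
          rw [Finsupp.notMem_support_iff.mp (fun h => hv (a1 h)),
            Finsupp.notMem_support_iff.mp (fun h => hv (a2 h))]
      obtain ⟨l, x⟩ := x
      obtain ⟨l', y⟩ := y
      obtain rfl : l = l' := h3
      congr 1
      funext v
      exact Subtype.ext (h2 v)
    · rintro ⟨U, hU⟩
      have h0 := hcomp U hU
      choose h1 h2 m hm h3 using h0
      let l : ι →₀ ℕ := Finsupp.onFinset S (fun v => if v ∈ S then m v else 0) (by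
        intro v hv
        by_contra hcon
        simp [hcon] at hv)
      have hlS : ∀ v ∈ S, l v = m v := fun v hv => by simp [l, hv]
      have hl : l ∈ Finset.finsuppAntidiag S d := by
        rw [Finset.mem_finsuppAntidiag]
        refine ⟨?_, Finsupp.support_onFinset_subset⟩
        have h4 := relIndex_box 𝒜 S _ h1 (hout U hU)
        rw [box_comp 𝒜 hU.1 hU.2.1, hU.2.2, Finset.prod_congr rfl (fun v _ => h3 v),
          Finset.prod_pow_eq_pow_sum] at h4
        have := hinj h4
        rw [this]
        exact Finset.sum_congr rfl hlS
      let x : X := ⟨⟨l, hl⟩, fun v => ⟨Comp 𝒜 U v, h1 v, h2 v, by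
        rw [h3 v]; congr 1; exact (hlS v v.2).symm⟩⟩
      refine ⟨x, Subtype.ext ?_⟩
      change Box 𝒜 (ext x) = U
      have : ext x = Comp 𝒜 U := by
        funext v
        by_cases hv : v ∈ S
        · rw [ext_in x ⟨v, hv⟩]
        · rw [ext_out x v hv, hout U hU v hv]
      rw [this, box_comp 𝒜 hU.1 hU.2.1]
  have hf : ∀ v m, Finite (EffSet (𝒜 v) P m) := fun v m => hfin v m
  have hX : Finite X := inferInstance
  refine ⟨Finite.of_surjective Ψ hΨ.2, ?_⟩
  rw [← Nat.card_eq_of_bijective Ψ hΨ, PowerSeries.coeff_prod, Nat.card_sigma,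
    ← Finset.sum_coe_sort (Finset.finsuppAntidiag S d)]
  push_cast
  refine Finset.sum_congr rfl fun l _ => ?_
  rw [Nat.card_pi]
  push_cast
  rw [← Finset.prod_coe_sort S]
  refine Finset.prod_congr rfl fun v _ => ?_
  rw [PowerSeries.coeff_mk]

end Adele
end B1
end

section
namespace B1

/-- A field with a family of places behaving like the function field of a curve over a finite
field. -/
structure CurveData (F : Type u) [Field F] (p : ℕ) {ι : Type u} (O : ι → ValuationSubring F)
    (f : ι → ℕ) (ϖ : ι → Fˣ) : Prop where
  prime : p.Prime
  dvr : ∀ v, IsDiscreteValuationRing (O v)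
  unif : ∀ v, ∃ h : (ϖ v : F) ∈ O v, Irreducible (⟨ϖ v, h⟩ : O v)
  fpos : ∀ v, 0 < f v
  card : ∀ v, Nat.card (IsLocalRing.ResidueField (O v)) = p ^ f v
  ne : Nonempty ι
  fin : ∀ d, {v | f v ≤ d}.Finite
  ae : ∀ x : F, ∀ᶠ v in Filter.cofinite, x ∈ O v
  H0 : {x : F | ∀ v, x ∈ O v}.Finite
  H1 : ∃ t : ι → F, (∀ᶠ v in Filter.cofinite, t v = 1) ∧ (∀ v, t v ≠ 0) ∧
    ∀ g : ι → F, (∀ᶠ v in Filter.cofinite, g v ∈ O v) → ∃ x : F, ∀ v, t v * (x - g v) ∈ O v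

/-- A family of local orders in a division algebra. -/
structure OrdFam {F : Type u} [Field F] {D : Type u} [DivisionRing D] [Algebra F D] {ι : Type u}
    (O : ι → ValuationSubring F) (ϖ : ι → Fˣ) (p n : ℕ) (f : ι → ℕ) {m : ℕ}
    (e : Module.Basis (Fin m) F D) (𝒜 : ι → Subring D) : Prop where
  loc : ∀ v, LocOrd (𝒜 v) (Units.map (algebraMap F D).toMonoidHom (ϖ v)) n (p ^ f v)
  scal : ∀ v, ∀ c ∈ O v, algebraMap F D c ∈ 𝒜 v
  ae : ∀ᶠ v in Filter.cofinite, ∀ s, s ∈ 𝒜 v ↔ ∀ i, e.repr s i ∈ O v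
  fg : ∀ v, ∃ k : ℕ, ∀ s ∈ 𝒜 v, ∀ i, (ϖ v : F) ^ k * e.repr s i ∈ O v

lemma LocOrd.relIndex {D : Type u} [Ring D] {𝒜 : Subring D} {ϖ : Dˣ} {n q : ℕ}
    (h : LocOrd 𝒜 ϖ n q) (k : ℕ) :
    𝒜.toAddSubgroup.relIndex (tr (ϖ ^ k)⁻¹ 𝒜.toAddSubgroup) = q ^ (k * (n * n)) := by
  obtain ⟨h1, h2, h3, h4⟩ := h
  obtain ⟨S, _, π, φ, hS, hφ, hk⟩ := h4 k
  rw [← relIndex_tr (ϖ ^ k), tr_inv_tr]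
  have e : (tr (ϖ ^ k) 𝒜.toAddSubgroup).addSubgroupOf 𝒜.toAddSubgroup = φ.toAddMonoidHom.ker := by
    ext a
    rw [AddSubgroup.mem_addSubgroupOf, mem_tr, AddMonoidHom.mem_ker]
    refine Iff.trans ?_ (hk a).symm
    constructor
    · intro h
      refine ⟨_, h, ?_⟩
      rw [← mul_assoc, ← Units.val_pow_eq_pow_val, Units.mul_inv, one_mul]
    · rintro ⟨b, hb, hab⟩
      have : (((ϖ ^ k)⁻¹ : Dˣ) : D) * (a : D) = b := by
        rw [hab, ← mul_assoc, ← Units.val_pow_eq_pow_val, Units.inv_mul, one_mul]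
      exact this ▸ hb
  rw [AddSubgroup.relIndex, e, AddSubgroup.index_ker,
    AddMonoidHom.range_eq_top.mpr (show Function.Surjective φ.toAddMonoidHom from hφ),
    AddSubgroup.card_top]
  have := hS.card_top
  rw [show Matrix (Fin n) (Fin n) S = (Fin n → Fin n → S) from rfl, Nat.card_fun, Nat.card_fun,
    this, Nat.card_fin]
  simp only [← pow_mul, mul_assoc]

section Global
variable {F : Type u} [Field F] {D : Type u} [DivisionRing D] [Algebra F D] {ι : Type u}
    {O : ι → ValuationSubring F} {ϖ : ι → Fˣ} {p n : ℕ} {f : ι → ℕ} {m : ℕ}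
    {e : Module.Basis (Fin m) F D} {𝒜 : ι → Subring D}

lemma OrdFam.diag_mem (hc : CurveData F p O f ϖ) (h : OrdFam O ϖ p n f e 𝒜) (s : D) :
    (fun _ : ι => s) ∈ Adele 𝒜 := by
  change ∀ᶠ v in Filter.cofinite, s ∈ 𝒜 v
  have h1 : ∀ᶠ v in Filter.cofinite, ∀ i, e.repr s i ∈ O v :=
    Filter.eventually_all.mpr fun i => hc.ae _
  filter_upwards [h1, h.ae] with v h2 h3 using (h3 s).mpr h2

/-- diagonal embedding -/
def OrdFam.diag (hc : CurveData F p O f ϖ) (h : OrdFam O ϖ p n f e 𝒜) : D →+* Adele 𝒜 where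
  toFun := fun s => ⟨fun _ => s, h.diag_mem hc s⟩
  map_one' := rfl
  map_mul' := fun _ _ => rfl
  map_zero' := rfl
  map_add' := fun _ _ => rfl

/-- idele of powers of uniformizers -/
def kap (ϖ : ι → Fˣ) (𝒜 : ι → Subring D) (k : ι → ℕ) (hk : ∀ᶠ v in Filter.cofinite, k v = 0) :
    (Adele 𝒜)ˣ where
  val := ⟨fun v => algebraMap F D ((ϖ v : F) ^ k v), by
    change ∀ᶠ v in Filter.cofinite, algebraMap F D ((ϖ v : F) ^ k v) ∈ 𝒜 v
    filter_upwards [hk] with v hv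
    rw [hv, pow_zero, map_one]; exact (𝒜 v).one_mem⟩
  inv := ⟨fun v => algebraMap F D (((ϖ v : F) ^ k v)⁻¹), by
    change ∀ᶠ v in Filter.cofinite, algebraMap F D (((ϖ v : F) ^ k v)⁻¹) ∈ 𝒜 v
    filter_upwards [hk] with v hv
    rw [hv, pow_zero, inv_one, map_one]; exact (𝒜 v).one_mem⟩
  val_inv := by
    apply Subtype.ext
    funext v
    change algebraMap F D _ * algebraMap F D _ = 1
    rw [← map_mul, mul_inv_cancel₀ (pow_ne_zero _ (ϖ v).ne_zero), map_one]
  inv_val := by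
    apply Subtype.ext
    funext v
    change algebraMap F D _ * algebraMap F D _ = 1
    rw [← map_mul, inv_mul_cancel₀ (pow_ne_zero _ (ϖ v).ne_zero), map_one]

variable (k : ι → ℕ) (hk : ∀ᶠ v in Filter.cofinite, k v = 0)

lemma kap_central (x : Adele 𝒜) : (kap ϖ 𝒜 k hk : Adele 𝒜) * x = x * kap ϖ 𝒜 k hk := by
  apply Subtype.ext
  funext v
  exact Algebra.commutes _ _

lemma OrdFam.unif_mem (h : OrdFam O ϖ p n f e 𝒜) (v : ι) (k : ℕ) :
    algebraMap F D ((ϖ v : F) ^ k) ∈ 𝒜 v := by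
  rw [map_pow]
  exact (𝒜 v).pow_mem (h.loc v).2.1 k

lemma kap_mem (h : OrdFam O ϖ p n f e 𝒜) : (kap ϖ 𝒜 k hk : Adele 𝒜) ∈ IntAdele 𝒜 :=
  fun v => h.unif_mem v (k v)

lemma mem_kap_inv {x : Adele 𝒜} : x ∈ tr (kap ϖ 𝒜 k hk)⁻¹ (IntAdele 𝒜).toAddSubgroup ↔
    ∀ v, algebraMap F D ((ϖ v : F) ^ k v) * x.1 v ∈ 𝒜 v := by
  rw [mem_tr, inv_inv]
  rfl

lemma kap_box : tr (kap ϖ 𝒜 k hk)⁻¹ (IntAdele 𝒜).toAddSubgroup =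
    Box 𝒜 (fun v => tr ((Units.map (algebraMap F D).toMonoidHom (ϖ v)) ^ k v)⁻¹
      (𝒜 v).toAddSubgroup) := by
  ext x
  rw [mem_kap_inv]
  change _ ↔ ∀ v, x.1 v ∈ tr ((Units.map (algebraMap F D).toMonoidHom (ϖ v)) ^ k v)⁻¹
      (𝒜 v).toAddSubgroup
  refine forall_congr' fun v => ?_
  rw [mem_tr, inv_inv, map_pow]
  rfl

lemma kap_relIndex (h : OrdFam O ϖ p n f e 𝒜) (S : Finset ι) (hS : ∀ v ∉ S, k v = 0) :
    (IntAdele 𝒜).toAddSubgroup.relIndex (tr (kap ϖ 𝒜 k hk)⁻¹ (IntAdele 𝒜).toAddSubgroup) =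
      (p ^ n) ^ (∑ v ∈ S, f v * k v * n) := by
  rw [kap_box, relIndex_box 𝒜 S]
  · rw [← Finset.prod_pow_eq_pow_sum]
    refine Finset.prod_congr rfl fun v _ => ?_
    rw [(h.loc v).relIndex, ← pow_mul, ← pow_mul]
    congr 1; ring
  · intro v x hx
    rw [mem_tr, inv_inv, Units.val_pow_eq_pow_val]
    exact (𝒜 v).mul_mem ((𝒜 v).pow_mem (h.loc v).2.1 _) hx
  · intro v hv
    ext x
    rw [hS v hv, mem_tr, pow_zero, inv_one, inv_one, Units.val_one, one_mul]

lemma kap_relIndex_ne (hp : p.Prime) (h : OrdFam O ϖ p n f e 𝒜) :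
    (IntAdele 𝒜).toAddSubgroup.relIndex
      (tr (kap ϖ 𝒜 k hk)⁻¹ (IntAdele 𝒜).toAddSubgroup) ≠ 0 := by
  have hfin : {v | ¬ k v = 0}.Finite := Filter.eventually_cofinite.mp hk
  rw [kap_relIndex k hk h hfin.toFinset (by simp)]
  exact pow_ne_zero _ (pow_ne_zero _ hp.ne_zero)

lemma le_kap (h : OrdFam O ϖ p n f e 𝒜) : (IntAdele 𝒜).toAddSubgroup ≤
    tr (kap ϖ 𝒜 k hk)⁻¹ (IntAdele 𝒜).toAddSubgroup := by
  intro x hx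
  rw [mem_kap_inv]
  exact fun v => (𝒜 v).mul_mem (h.unif_mem v _) (hx v)

lemma kap_le (h : OrdFam O ϖ p n f e 𝒜) : tr (kap ϖ 𝒜 k hk) (IntAdele 𝒜).toAddSubgroup ≤
    (IntAdele 𝒜).toAddSubgroup := by
  have := tr_mono (kap ϖ 𝒜 k hk) (le_kap k hk h)
  rwa [tr_inv_tr] at this

/-- finiteness of `H⁰` -/
lemma card_H0 (hc : CurveData F p O f ϖ) (h : OrdFam O ϖ p n f e 𝒜) :
    Nat.card ((h.diag hc).toAddMonoidHom.range ⊓ tr (kap ϖ 𝒜 k hk)⁻¹ (IntAdele 𝒜).toAddSubgroup :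
      AddSubgroup (Adele 𝒜)) ≠ 0 := by
  classical
  obtain ⟨k2, hk2, hk2'⟩ : ∃ k2 : ι → ℕ, (∀ᶠ v in Filter.cofinite, k2 v = 0) ∧
      ∀ v, ∀ s ∈ 𝒜 v, ∀ i, (ϖ v : F) ^ k2 v * e.repr s i ∈ O v := by
    choose k2 hk2 using h.fg
    refine ⟨fun v => if (∀ s, s ∈ 𝒜 v ↔ ∀ i, e.repr s i ∈ O v) then 0 else k2 v, ?_, ?_⟩
    · filter_upwards [h.ae] with v hv
      rw [if_pos hv]
    · intro v s hs i
      dsimp only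
      split_ifs with h1
      · rw [pow_zero, one_mul]; exact (h1 s).mp hs i
      · exact hk2 v s hs i
  have hfin : Finite ((h.diag hc).toAddMonoidHom.range ⊓
      tr (kap ϖ 𝒜 k2 hk2) (IntAdele 𝒜).toAddSubgroup : AddSubgroup (Adele 𝒜)) := by
    have hX : {s : D | ∀ i, e.repr s i ∈ {x : F | ∀ v, x ∈ O v}}.Finite := by
      have : (Set.pi Set.univ fun _ : Fin m => {x : F | ∀ v, x ∈ O v}).Finite :=
        Set.Finite.pi fun _ => hc.H0
      refine (this.preimage (f := fun s : D => (fun i => e.repr s i)) ?_).subset ?_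
      · intro a _ b _ hab
        exact e.repr.injective (Finsupp.ext fun i => congrFun hab i)
      · intro s hs i _
        exact hs i
    refine (hX.image (h.diag hc)).subset ?_
    rintro x ⟨⟨s, rfl⟩, hx⟩
    refine ⟨s, ?_, rfl⟩
    intro i v
    obtain ⟨y, hy, hys⟩ := hx
    have h1 : algebraMap F D ((ϖ v : F) ^ k2 v) * y.1 v = s :=
      congrFun (congrArg Subtype.val hys) v
    rw [← h1, ← Algebra.smul_def, map_smul]
    exact hk2' v _ (hy v) i
  have h1 := kap_le k2 hk2 h
  have h2 := le_kap k hk h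
  have h3 : (tr (kap ϖ 𝒜 k2 hk2) (IntAdele 𝒜).toAddSubgroup).relIndex
      (tr (kap ϖ 𝒜 k hk)⁻¹ (IntAdele 𝒜).toAddSubgroup) ≠ 0 := by
    rw [← AddSubgroup.relIndex_mul_relIndex _ _ _ h1 h2]
    refine mul_ne_zero ?_ (kap_relIndex_ne k hk hc.prime h)
    rw [← relIndex_tr (kap ϖ 𝒜 k2 hk2)⁻¹, inv_tr_tr]
    exact kap_relIndex_ne k2 hk2 hc.prime h
  rw [relIndex_split (h.diag hc).toAddMonoidHom.range _ _ (h1.trans h2)] at h3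
  rw [← card_mul_relIndex _ _ (inf_le_inf_left _ (h1.trans h2))]
  exact mul_ne_zero (Nat.card_ne_zero.mpr ⟨⟨0⟩, hfin⟩) (left_ne_zero_of_mul h3)

/-- vanishing of `H¹` after twisting -/
lemma exists_H1 (hc : CurveData F p O f ϖ) (h : OrdFam O ϖ p n f e 𝒜) :
    ∃ (k : ι → ℕ) (hk : ∀ᶠ v in Filter.cofinite, k v = 0), (∃ v, 0 < k v) ∧
      (h.diag hc).toAddMonoidHom.range ⊔ tr (kap ϖ 𝒜 k hk)⁻¹ (IntAdele 𝒜).toAddSubgroup = ⊤ := by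
  classical
  obtain ⟨t, ht1, ht0, ht⟩ := hc.H1
  obtain ⟨v0⟩ := hc.ne
  have hloc : ∀ v, ∃ k : ℕ, ∀ s : D, (∀ i, t v * e.repr s i ∈ O v) →
      algebraMap F D ((ϖ v : F) ^ k) * s ∈ 𝒜 v := by
    intro v
    have h1 : ∀ i, ∃ k : ℕ, algebraMap F D ((ϖ v : F) ^ k) * ((t v)⁻¹ • e i) ∈ 𝒜 v := by
      intro i
      obtain ⟨k, hk⟩ := (h.loc v).2.2.1 ((t v)⁻¹ • e i)
      refine ⟨k, ?_⟩
      rw [map_pow]; exact hk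
    choose k hk using h1
    refine ⟨∑ i, k i, fun s hs => ?_⟩
    have hs' : s = ∑ i, algebraMap F D (t v * e.repr s i) * ((t v)⁻¹ • e i) := by
      conv_lhs => rw [← e.sum_repr s]
      refine Finset.sum_congr rfl fun i _ => ?_
      rw [← Algebra.smul_def, smul_smul]
      congr 1
      field_simp [ht0 v]
    rw [hs', Finset.mul_sum]
    refine (𝒜 v).sum_mem fun i _ => ?_
    rw [← Finset.add_sum_erase _ k (Finset.mem_univ i), add_comm, pow_add, map_mul, mul_assoc]
    refine (𝒜 v).mul_mem (h.unif_mem v _) ?_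
    rw [← mul_assoc, Algebra.commutes ((ϖ v : F) ^ k i), mul_assoc]
    exact (𝒜 v).mul_mem (h.scal v _ (hs i)) (hk i)
  choose k hk using hloc
  let k' : ι → ℕ := fun v => (if (∀ s, s ∈ 𝒜 v ↔ ∀ i, e.repr s i ∈ O v) ∧ t v = 1 then 0 else k v) +
    (if v = v0 then 1 else 0)
  have hk' : ∀ᶠ v in Filter.cofinite, k' v = 0 := by
    have h0 : ∀ᶠ v in Filter.cofinite, v ≠ v0 := by
      rw [Filter.eventually_cofinite]
      exact (Set.finite_singleton v0).subset (fun w hw => by simpa using hw)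
    filter_upwards [h.ae, ht1, h0] with v h1 h2 h3
    simp only [k']
    rw [if_pos ⟨h1, h2⟩, if_neg h3]
  refine ⟨k', hk', ⟨v0, by simp [k']⟩, ?_⟩
  rw [eq_top_iff]
  intro g _
  have h1 : ∀ i, ∃ x : F, ∀ v, t v * (x - e.repr (g.1 v) i) ∈ O v := by
    intro i
    refine ht _ ?_
    have h2 : ∀ᶠ v in Filter.cofinite, g.1 v ∈ 𝒜 v := g.2
    filter_upwards [h2, h.ae] with v h3 h4 using (h4 _).mp h3 i
  choose x hx using h1
  rw [AddSubgroup.mem_sup]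
  refine ⟨h.diag hc (∑ i, x i • e i), ⟨_, rfl⟩, g - h.diag hc (∑ i, x i • e i), ?_, by abel⟩
  rw [mem_kap_inv]
  intro v
  change algebraMap F D ((ϖ v : F) ^ k' v) * (g.1 v - ∑ i, x i • e i) ∈ 𝒜 v
  have h2 : ∀ i, t v * e.repr (g.1 v - ∑ i, x i • e i) i ∈ O v := by
    intro i
    have := neg_mem (hx i v)
    rw [map_sub, Finsupp.sub_apply, Module.Basis.repr_sum_self]
    convert this using 1
    ring
  simp only [k']
  rw [add_comm, pow_add, map_mul, mul_assoc]
  refine (𝒜 v).mul_mem (h.unif_mem v _) ?_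
  split_ifs with h3
  · rw [pow_zero, map_one, one_mul, h3.1]
    intro i
    have := h2 i
    rwa [h3.2, one_mul] at this
  · exact hk v _ h2

end Global
end B1
end

section
namespace B1

lemma coeff_zlocs {p n f : ℕ} {a : ℕ} (h0 : 0 < a) (ha : a < f) :
    PowerSeries.coeff a (∏ i ∈ Finset.range n, PowerSeries.rescale ((p : ℚ) ^ i) (zloc f)) = 0 := by
  classical
  rw [PowerSeries.coeff_prod]
  refine Finset.sum_eq_zero fun l hl => ?_
  rw [Finset.mem_finsuppAntidiag] at hl
  have : ∃ i ∈ Finset.range n, l i ≠ 0 := by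
    by_contra hcon
    push Not at hcon
    exact h0.ne' (hl.1.symm.trans (Finset.sum_eq_zero hcon))
  obtain ⟨i, hi, hli⟩ := this
  refine Finset.prod_eq_zero hi ?_
  have h1 : l i ≤ a := by
    rw [← hl.1]
    exact Finset.single_le_sum (f := fun i => l i) (fun _ _ => Nat.zero_le _) hi
  have h2 : ¬ f ∣ l i := fun h => by
    have := Nat.le_of_dvd (Nat.pos_of_ne_zero hli) h
    omega
  rw [PowerSeries.coeff_rescale, zloc, PowerSeries.coeff_mk, if_neg h2, mul_zero]

section Global
variable {F : Type u} [Field F] {D : Type u} [DivisionRing D] [Algebra F D] {ι : Type u}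
    {O : ι → ValuationSubring F} {ϖ : ι → Fˣ} {p n : ℕ} {f : ι → ℕ} {m : ℕ}
    {e : Module.Basis (Fin m) F D} {𝒜 : ι → Subring D}

lemma effSet_pow {R : Type*} [Ring R] (A : Subring R) (p n d : ℕ) :
    EffSet A (p ^ n) d = EffSet A p (n * d) := by
  unfold EffSet
  rw [pow_mul]

lemma global_eff (hc : CurveData F p O f ϖ) (h : OrdFam O ϖ p n f e 𝒜) (hn : 0 < n) (d : ℕ)
    (S : Finset ι) (hS : ∀ v ∉ S, d < f v) :
    (EffSet (IntAdele 𝒜) (p ^ n) d).Finite ∧ (Nat.card (EffSet (IntAdele 𝒜) (p ^ n) d) : ℚ) =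
      PowerSeries.coeff d (∏ v ∈ S, ∏ i ∈ Finset.range n,
        PowerSeries.rescale ((p : ℚ) ^ i) (zloc (f v))) := by
  have hlc := fun v m => loc_count hc.prime (hc.fpos v) hn (h.loc v) m
  have hfin : ∀ v m, (EffSet (𝒜 v) (p ^ n) m).Finite := fun v m => by
    rw [effSet_pow]; exact (hlc v _).1
  have hcard : ∀ v m, (Nat.card (EffSet (𝒜 v) (p ^ n) m) : ℚ) = PowerSeries.coeff m
      (∏ i ∈ Finset.range n, PowerSeries.rescale ((p : ℚ) ^ i) (zloc (f v))) := fun v m => by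
    rw [effSet_pow]; exact (hlc v _).2.2 m rfl
  have h2 : 2 ≤ p ^ n := hc.prime.two_le.trans (Nat.le_self_pow hn.ne' p)
  have := card_eff 𝒜 (p ^ n) d h2 ?_ hfin S ?_
  · refine ⟨this.1, ?_⟩
    rw [this.2]
    congr 1
    refine Finset.prod_congr rfl fun v _ => ?_
    ext m
    rw [PowerSeries.coeff_mk, hcard]
  · intro v L h1 h2 h3
    rw [← pow_mul] at h3
    obtain ⟨a, -, ha⟩ := (Nat.dvd_prime_pow hc.prime).mp h3
    have hL : L ∈ EffSet (𝒜 v) p a := ⟨h1, h2, ha⟩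
    by_cases hna : n ∣ a
    · obtain ⟨b, rfl⟩ := hna
      exact ⟨b, by rw [ha, pow_mul]⟩
    · rw [(hlc v a).2.1 hna] at hL
      exact hL.elim
  · intro v hv m hm0 hm
    have h3 := hcard v m
    rw [coeff_zlocs hm0 (lt_of_le_of_lt hm (hS v hv))] at h3
    have h4 : Nat.card (EffSet (𝒜 v) (p ^ n) m) = 0 := by exact_mod_cast h3
    have h5 := hfin v m
    rw [Nat.card_coe_set_eq, Set.ncard_eq_zero h5] at h4
    exact h4

lemma global_rec (hc : CurveData F p O f ϖ) (h : OrdFam O ϖ p n f e 𝒜) (hn : 0 < n) :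
    ∃ T : ℕ, 0 < T ∧ ∃ χ : ℚ, 0 < χ ∧ ∃ d0 : ℕ, ∀ d ≥ d0,
      (Nat.card (EffSet (IntAdele 𝒜) (p ^ n) d) : ℚ) * (χ * (p : ℚ) ^ (n * (d + T)) - 1) =
        Nat.card (EffSet (IntAdele 𝒜) (p ^ n) (d + T)) * (χ * (p : ℚ) ^ (n * d) - 1) := by
  have h2 : 2 ≤ p ^ n := hc.prime.two_le.trans (Nat.le_self_pow hn.ne' p)
  obtain ⟨k, hk, ⟨v, hv⟩, htop⟩ := exists_H1 hc h
  have hfin : {v | ¬ k v = 0}.Finite := Filter.eventually_cofinite.mp hk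
  have hr := kap_relIndex k hk h hfin.toFinset (by simp)
  have hT : 0 < ∑ v ∈ hfin.toFinset, f v * k v * n := by
    refine Finset.sum_pos' (fun _ _ => Nat.zero_le _) ⟨v, by simpa using hv.ne', ?_⟩
    have := hc.fpos v
    positivity
  have hgood : Good (h.diag hc).toAddMonoidHom.range
      (tr (kap ϖ 𝒜 k hk)⁻¹ (IntAdele 𝒜).toAddSubgroup) := by
    refine ⟨card_H0 k hk hc h, ?_⟩
    rw [htop, AddSubgroup.index_top]
    exact one_ne_zero
  have hgood' := hgood.down (le_kap k hk h) (kap_relIndex_ne k hk hc.prime h)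
  obtain ⟨v0⟩ := hc.ne
  have : Nontrivial (Adele 𝒜) := ⟨⟨0, 1, fun h => by
    have := congrFun (congrArg Subtype.val h) v0
    exact zero_ne_one this⟩⟩
  obtain ⟨χ, hχ, d0, hd⟩ := class_count (h.diag hc) (IntAdele 𝒜) (p ^ n) h2 hgood' (kap ϖ 𝒜 k hk)
    (kap_central k hk) _ hT (kap_mem k hk h) hr htop (fun d => by
      refine (global_eff hc h hn d (hc.fin d).toFinset ?_).1
      intro v hv
      simpa using hv)
  refine ⟨_, hT, χ, hχ, d0, fun d hd' => ?_⟩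
  have := hd d hd'
  push_cast at this
  simpa only [pow_mul] using this

theorem global_contra (hc : CurveData F p O f ϖ) (h : OrdFam O ϖ p n f e 𝒜) (hn : 2 ≤ n)
    {m' : ℕ} {e' : Module.Basis (Fin m') F F} {𝒜' : ι → Subring F}
    (h' : OrdFam O ϖ p 1 f e' 𝒜') : False := by
  classical
  obtain ⟨T', hT', χ', hχ', d0', hb⟩ := global_rec hc h (by omega)
  obtain ⟨T, hT, χ, hχ, d0, ha⟩ := global_rec hc h' one_pos
  refine zeta_contra p n hc.prime.two_le hn (fun d => Nat.card (EffSet (IntAdele 𝒜') (p ^ 1) d))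
    (fun d => Nat.card (EffSet (IntAdele 𝒜) (p ^ n) d)) ?_ T d0 hT χ hχ ?_ ?_ T' d0' hT' χ' hχ' hb ?_
  · have : EffSet (IntAdele 𝒜') (p ^ 1) 0 = {(IntAdele 𝒜').toAddSubgroup} := by
      ext U
      rw [Set.mem_singleton_iff]
      constructor
      · rintro ⟨h1, -, h2⟩
        rw [pow_zero, AddSubgroup.relIndex_eq_one] at h2
        exact le_antisymm h2 h1
      · rintro rfl
        refine ⟨le_rfl, fun u hu a ha => (IntAdele 𝒜').mul_mem hu ha, ?_⟩
        rw [AddSubgroup.relIndex_self, pow_zero]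
    rw [this]
    simp
  · simpa only [one_mul] using ha
  · intro N
    obtain ⟨v0⟩ := hc.ne
    let k : ι → ℕ := fun v => if v = v0 then N else 0
    have hk : ∀ᶠ v in Filter.cofinite, k v = 0 := by
      rw [Filter.eventually_cofinite]
      refine (Set.finite_singleton v0).subset (fun w hw => ?_)
      by_contra hcon
      exact hw (if_neg hcon)
    have hr := kap_relIndex k hk h' {v0} (fun v hv => if_neg (by simpa using hv))
    refine ⟨f v0 * N, Nat.le_mul_of_pos_left _ (hc.fpos v0), ?_⟩
    rw [Finset.sum_singleton, mul_one] at hr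
    simp only [k, if_true] at hr
    have hmem : tr (kap ϖ 𝒜' k hk)⁻¹ (IntAdele 𝒜').toAddSubgroup ∈
        EffSet (IntAdele 𝒜') (p ^ 1) (f v0 * N) := by
      refine ⟨le_kap k hk h', ?_, hr⟩
      intro u hu a ha
      rw [mem_tr] at hu ⊢
      rw [← mul_assoc]
      exact (IntAdele 𝒜').mul_mem hu ha
    have hfin := (global_eff hc h' one_pos (f v0 * N) (hc.fin (f v0 * N)).toFinset
      (fun v hv => by simpa using hv)).1
    have : Finite (EffSet (IntAdele 𝒜') (p ^ 1) (f v0 * N)) := hfin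
    exact Nat.card_ne_zero.mpr ⟨⟨⟨_, hmem⟩⟩, this⟩
  · ext d
    set S := (hc.fin d).toFinset with hS
    have hS' : ∀ d' ≤ d, ∀ v ∉ S, d' < f v := by
      intro d' hd' v hv
      have : d < f v := by simpa [hS] using hv
      omega
    have ha' : ∀ d' ≤ d, (Nat.card (EffSet (IntAdele 𝒜') (p ^ 1) d') : ℚ) =
        PowerSeries.coeff d' (∏ v ∈ S, zloc (f v)) := by
      intro d' hd'
      rw [(global_eff hc h' one_pos d' S (hS' d' hd')).2]
      congr 1
      refine Finset.prod_congr rfl fun v _ => ?_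
      rw [Finset.prod_range_one, pow_zero, PowerSeries.rescale_one, RingHom.id_apply]
    rw [PowerSeries.coeff_mk, (global_eff hc h (by omega) d S (hS' d le_rfl)).2, Finset.prod_comm]
    simp_rw [← map_prod]
    rw [PowerSeries.coeff_prod, PowerSeries.coeff_prod]
    refine Finset.sum_congr rfl fun l hl => Finset.prod_congr rfl fun i hi => ?_
    rw [Finset.mem_finsuppAntidiag] at hl
    have h1 : l i ≤ d := by
      rw [← hl.1]
      exact Finset.single_le_sum (f := fun i => l i) (fun _ _ => Nat.zero_le _) hi
    rw [PowerSeries.coeff_rescale, PowerSeries.coeff_rescale, PowerSeries.coeff_mk, ha' _ h1]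

end Global
end B1
end

section
namespace B1

set_option linter.unusedSectionVars false

section Core
variable {S : Type u} [CommRing S] [IsLocalRing S] [Finite S] {π : S}
  {V : Type*} [AddCommGroup V] [Module S V] [Module.Free S V] [Module.Finite S V]
  {A B κ : Type*} [Ring A] [Ring B] [CommRing κ] {n : ℕ}

lemma card_free (W : Type*) [AddCommGroup W] [Module S W] [Module.Free S W] [Module.Finite S W] :
    Nat.card W = Nat.card S ^ Module.finrank S W := by
  rw [Nat.card_congr (Module.finBasis S W).equivFun.toEquiv, Nat.card_fun, Nat.card_fin]

/-- Morita-type counting: the core local computation at finite level. -/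
theorem core_finite (hπ : IsNilpotent π) (hn : 0 < n)
    (ρ : A →+* Module.End S V) (σ : B →+* Module.End S V)
    (hcomm : ∀ a b, ρ a * σ b = σ b * ρ a)
    (φ : A →+* Matrix (Fin n) (Fin n) κ) (hφ : Function.Surjective φ)
    (hker : ∀ a, φ a = 0 → ∃ b, ρ a = π • ρ b)
    (ε : A) (hε : φ ε = Matrix.single ⟨0, hn⟩ ⟨0, hn⟩ 1) (hid : ρ ε * ρ ε = ρ ε)
    (m : ℕ) (hcard : Nat.card σ.range = Nat.card S ^ m)
    (hrank : (Module.finrank S V) ^ 2 = n ^ 2 * m) :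
    ∃ w : ℕ, w ^ 2 = m ∧ ∃ ψ : B →+* Matrix (Fin w) (Fin w) S, Function.Surjective ψ ∧
      ∀ b, ψ b = 0 ↔ σ b = 0 := by
  classical
  have hS2 : 2 ≤ Nat.card S := Finite.one_lt_card
  have hfinV : Finite V := Module.finite_of_finite S
  obtain ⟨M, hM⟩ := hπ
  let o : Fin n := ⟨0, hn⟩
  choose u hu using fun i => hφ (Matrix.single i o 1)
  choose w' hw' using fun i => hφ (Matrix.single o i 1)
  -- the submodule W
  let P : V →ₗ[S] V := ρ ε
  let W : Submodule S V := LinearMap.range P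
  have hPW : ∀ x ∈ W, P x = x := by
    rintro _ ⟨y, rfl⟩
    exact LinearMap.congr_fun hid y
  have hproj : Module.Projective S W := by
    refine Module.Projective.of_split W.subtype (LinearMap.rangeRestrict P) ?_
    ext x
    exact hPW x x.2
  have hWfin : Module.Finite S W := inferInstance
  have hWfree : Module.Free S W := Module.free_of_flat_of_isLocalRing
  -- sum of u ε w is a unit
  obtain ⟨a0, ha0⟩ := hker (∑ i, u i * ε * w' i - 1) (by
    rw [map_sub, map_sum, map_one, sub_eq_zero]
    have h1 : ∀ i, φ (u i * ε * w' i) = Matrix.single i i 1 := by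
      intro i
      rw [map_mul, map_mul, hu, hw', hε]
      simp [o]
    simp_rw [h1]
    ext i j
    by_cases hij : i = j
    · subst hij
      simp [Matrix.sum_apply, Matrix.single]
    · rw [Matrix.one_apply_ne hij, Matrix.sum_apply]
      refine Finset.sum_eq_zero fun k _ => ?_
      simp only [Matrix.single, Matrix.of_apply]
      rw [if_neg]
      rintro ⟨rfl, rfl⟩
      exact hij rfl)
  have hnil : ∀ g : Module.End S V, IsNilpotent (π • g) := fun g => ⟨M, by
    rw [smul_pow, hM, zero_smul]⟩
  have hunit : IsUnit (∑ i, ρ (u i) * ρ ε * ρ (w' i)) := by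
    have : ∑ i, ρ (u i) * ρ ε * ρ (w' i) = 1 + π • ρ a0 := by
      rw [← ha0]; simp
    rw [this]
    exact (hnil _).isUnit_one_add
  have hdelta : ∀ i j, ∃ b, ρ ε * ρ (w' i) * ρ (u j) * ρ ε = (if i = j then ρ ε else 0) + π • ρ b := by
    intro i j
    obtain ⟨b, hb⟩ := hker (ε * w' i * u j * ε - if i = j then ε else 0) (by
      simp only [map_sub, map_mul, hu, hw', hε]
      by_cases h : i = j
      · subst h; simp [hε, o]
      · simp [h])
    refine ⟨b, ?_⟩
    rw [← hb]
    split_ifs <;> simp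
  choose c hc using hdelta
  -- card V = card W ^ n
  have hVW : Nat.card V = Nat.card W ^ n := by
    have hcf : Nat.card (Fin n → W) = Nat.card W ^ n := by rw [Nat.card_fun, Nat.card_fin]
    rw [← hcf]
    let α : V → (Fin n → W) := fun v i => ⟨P (ρ (w' i) v), ⟨_, rfl⟩⟩
    let β : (Fin n → W) →+ V :=
      { toFun := fun x => ∑ i, ρ (u i) (x i : V)
        map_zero' := by simp
        map_add' := fun x y => by simp [Finset.sum_add_distrib] }
    have hα : Function.Injective α := by
      intro v v' h
      have h1 : ∀ i, ρ ε (ρ (w' i) v) = ρ ε (ρ (w' i) v') := fun i =>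
        congrArg Subtype.val (congrFun h i)
      have h2 : (∑ i, ρ (u i) * ρ ε * ρ (w' i)) v = (∑ i, ρ (u i) * ρ ε * ρ (w' i)) v' := by
        simp only [LinearMap.sum_apply, Module.End.mul_apply, h1]
      exact ((Module.End.isUnit_iff _).mp hunit).1 h2
    have hβ : Function.Injective β := by
      rw [injective_iff_map_eq_zero]
      intro x hx
      have key : ∀ i, (x i : V) = - (π • ∑ j, ρ (c i j) (x j : V)) := by
        intro i
        have h1 : ρ ε (ρ (w' i) (∑ j, ρ (u j) (x j : V))) = 0 := by
          have : ∑ j, ρ (u j) (x j : V) = 0 := hx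
          rw [this, map_zero, map_zero]
        have h2 : ∀ j, ρ ε (ρ (w' i) (ρ (u j) (x j : V))) =
            (if i = j then (x j : V) else 0) + π • ρ (c i j) (x j : V) := by
          intro j
          have h3 := LinearMap.congr_fun (hc i j) (x j : V)
          have h4 : ρ ε (x j : V) = x j := hPW _ (x j).2
          simp only [Module.End.mul_apply, h4] at h3
          rw [h3]
          split_ifs <;> simp [h4]
        rw [map_sum, map_sum, Finset.sum_congr rfl (fun j _ => h2 j), Finset.sum_add_distrib,
          Finset.sum_ite_eq, if_pos (Finset.mem_univ i), ← Finset.smul_sum] at h1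
        exact eq_neg_of_add_eq_zero_left h1
      have hdiv : ∀ N : ℕ, ∀ i, ∃ y, (x i : V) = π ^ N • y := by
        intro N
        induction N with
        | zero => exact fun i => ⟨x i, by simp⟩
        | succ N ih =>
          intro i
          choose y hy using ih
          refine ⟨- ∑ j : Fin n, (ρ (c i j)) (y j), ?_⟩
          have h5 : ∑ j : Fin n, (ρ (c i j)) (x j : V) = π ^ N • ∑ j : Fin n, (ρ (c i j)) (y j) := by
            rw [Finset.smul_sum]
            refine Finset.sum_congr rfl fun j _ => ?_
            rw [← map_smul, ← hy]
          rw [key i, h5, smul_neg, pow_succ', mul_smul]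
      funext i
      obtain ⟨y, hy⟩ := hdiv M i
      apply Subtype.ext
      rw [hy, hM, zero_smul]; rfl
    exact le_antisymm (Nat.card_le_card_of_injective α hα) (Nat.card_le_card_of_injective β hβ)
  have hrk : Module.finrank S V = Module.finrank S W * n := by
    rw [card_free (S := S) V, card_free (S := S) W, ← pow_mul] at hVW
    exact Nat.pow_right_injective hS2 hVW
  have hw2 : (Module.finrank S W) ^ 2 = m := by
    rw [hrk] at hrank
    have : 0 < n ^ 2 := by positivity
    apply Nat.eq_of_mul_eq_mul_left this
    rw [← hrank]; ring
  refine ⟨Module.finrank S W, hw2, ?_⟩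
  -- the map B → End W
  have hres : ∀ b, ∀ x ∈ W, σ b x ∈ W := by
    rintro b _ ⟨y, rfl⟩
    refine ⟨σ b y, ?_⟩
    exact LinearMap.congr_fun (hcomm ε b) y
  let θ : B →+* Module.End S W :=
    { toFun := fun b => (σ b).restrict (hres b)
      map_one' := by ext; simp
      map_mul' := fun a b => by ext; simp
      map_zero' := by ext; simp
      map_add' := fun a b => by ext; simp }
  have hθ : ∀ b, θ b = 0 ↔ σ b = 0 := by
    intro b
    constructor
    · intro h
      have h1 : ∀ v, σ b (ρ ε v) = 0 := by
        intro v
        exact congrArg Subtype.val (LinearMap.congr_fun h ⟨ρ ε v, ⟨v, rfl⟩⟩)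
      have h2 : (∑ i, ρ (u i) * ρ ε * ρ (w' i)) * σ b = 0 := by
        ext v
        rw [Finset.sum_mul, LinearMap.sum_apply]
        refine Finset.sum_eq_zero fun i _ => ?_
        rw [mul_assoc, hcomm, mul_assoc, ← mul_assoc (ρ ε), hcomm]
        simp [h1]
      exact (hunit.mul_right_eq_zero).mp h2
    · intro h
      ext x
      change σ b x = 0
      rw [h]; rfl
  let μ := LinearMap.toMatrixAlgEquiv (Module.finBasis S W)
  refine ⟨(μ.toRingEquiv : Module.End S W →+* _).comp θ, ?_, ?_⟩
  · have hsurj : Function.Surjective θ := by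
      have hfinEnd : Finite (Module.End S W) := Module.finite_of_finite S
      have hcardEnd : Nat.card (Module.End S W) = Nat.card S ^ m := by
        rw [card_free (S := S) (Module.End S W), ← hw2, Module.finrank_linearMap, sq]
      have hk : RingHom.ker θ = RingHom.ker σ := by
        ext b
        rw [RingHom.mem_ker, RingHom.mem_ker, hθ]
      have hr : Nat.card θ.range = Nat.card S ^ m := by
        rw [← hcard, ← Nat.card_congr (RingHom.quotientKerEquivRange θ).toEquiv,
          ← Nat.card_congr (RingHom.quotientKerEquivRange σ).toEquiv, hk]
      have : (θ.range : Set (Module.End S W)) = Set.univ := by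
        refine Set.eq_of_subset_of_ncard_le (Set.subset_univ _) ?_
        rw [Set.ncard_univ, hcardEnd, ← hr]
        exact le_of_eq (Nat.card_coe_set_eq _)
      intro y
      have hy : y ∈ (θ.range : Set (Module.End S W)) := this ▸ Set.mem_univ y
      exact hy
    exact μ.surjective.comp hsurj
  · intro b
    rw [← hθ]
    exact map_eq_zero_iff μ.toRingEquiv μ.injective

end Core
end B1
end

section
namespace B1

lemma lift_idem {O A R : Type*} [CommRing O] [Ring A] [Algebra O A] [Ring R] (π : O) (φ : A →+* R)
    (e0 : R) (he0 : e0 * e0 = e0) (hφ : Function.Surjective φ)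
    (hker : ∀ a, φ a = 0 → ∃ b, a = π • b) (N : ℕ) :
    ∃ ε : A, φ ε = e0 ∧ ∃ a, ε * ε - ε = π ^ (N + 1) • a := by
  induction N with
  | zero =>
    obtain ⟨ε, hε⟩ := hφ e0
    refine ⟨ε, hε, ?_⟩
    rw [zero_add, pow_one]
    exact hker _ (by rw [map_sub, map_mul, hε, he0, sub_self])
  | succ N ih =>
    obtain ⟨ε, hε, a, ha⟩ := ih
    refine ⟨3 * (ε * ε) - 2 * (ε * ε * ε), ?_, ?_⟩
    · simp only [map_sub, map_mul, map_ofNat, hε, he0]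
      rw [← sub_mul]
      norm_num
    · refine ⟨π ^ N • (a * a * (4 * (ε * ε - ε) - 3)), ?_⟩
      have h1 : (3 * (ε * ε) - 2 * (ε * ε * ε)) * (3 * (ε * ε) - 2 * (ε * ε * ε)) -
          (3 * (ε * ε) - 2 * (ε * ε * ε)) =
          (ε * ε - ε) * (ε * ε - ε) * (4 * (ε * ε - ε) - 3) := by noncomm_ring
      rw [h1]
      have h2 : (ε * ε - ε) * (ε * ε - ε) = π ^ (N + 1) • π ^ (N + 1) • (a * a) := by
        rw [ha, smul_mul_assoc, mul_smul_comm]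
      rw [h2, smul_mul_assoc, smul_mul_assoc, smul_smul, smul_smul]
      congr 1
      ring

lemma exists_red {O V : Type*} [CommRing O] [Nontrivial O] [AddCommGroup V] [Module O V]
    [Module.Free O V] [Module.Finite O V] (z : O) :
    ∃ red : Module.End O V →+* Module.End (O ⧸ Ideal.span {z})
        (Fin (Module.finrank O V) → O ⧸ Ideal.span {z}),
      (∀ (c : O) g, red (c • g) = Ideal.Quotient.mk (Ideal.span {z}) c • red g) ∧
      ∀ g, red g = 0 ↔ ∃ g', g = z • g' := by
  classical
  have hmk : ∀ x : O, Ideal.Quotient.mk (Ideal.span {z}) x = 0 ↔ ∃ y, x = z * y := by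
    intro x
    rw [Ideal.Quotient.eq_zero_iff_mem, Ideal.mem_span_singleton]
    rfl
  generalize hr : Module.finrank O V = r
  let bV : Module.Basis (Fin r) O V := Module.finBasisOfFinrankEq O V hr
  let μ : Module.End O V ≃ₐ[O] Matrix (Fin r) (Fin r) O := LinearMap.toMatrixAlgEquiv bV
  generalize μ = μ
  have h1 : ∀ (c : O) (g : Matrix (Fin r) (Fin r) O),
      (Ideal.Quotient.mk (Ideal.span {z})).mapMatrix (c • g) =
      Ideal.Quotient.mk (Ideal.span {z}) c • (Ideal.Quotient.mk (Ideal.span {z})).mapMatrix g := by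
    intro c g
    ext i j
    simp
  have h2 : ∀ (g : Matrix (Fin r) (Fin r) O),
      (Ideal.Quotient.mk (Ideal.span {z})).mapMatrix g = 0 ↔ ∃ g', g = z • g' := by
    intro g
    constructor
    · intro h
      have h1 : ∀ i j, ∃ y, g i j = z * y := fun i j => (hmk _).mp (congrFun (congrFun h i) j)
      choose y hy using h1
      refine ⟨Matrix.of y, ?_⟩
      ext i j
      exact hy i j
    · rintro ⟨g', rfl⟩
      rw [h1, (hmk z).mpr ⟨1, by rw [mul_one]⟩, zero_smul]
  refine ⟨((Matrix.toLinAlgEquiv' (R := O ⧸ Ideal.span {z}) (n := Fin r)).toRingEquiv.toRingHom).comp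
      (((Ideal.Quotient.mk (Ideal.span {z})).mapMatrix).comp μ.toRingEquiv.toRingHom), ?_, ?_⟩
  · intro c g
    change Matrix.toLinAlgEquiv' (RingHom.mapMatrix _ (μ (c • g))) =
      _ • Matrix.toLinAlgEquiv' (RingHom.mapMatrix _ (μ g))
    rw [map_smul, h1, map_smul]
  · intro g
    change Matrix.toLinAlgEquiv' (RingHom.mapMatrix _ (μ g)) = 0 ↔ _
    rw [map_eq_zero_iff _ (AlgEquiv.injective _), h2]
    constructor
    · rintro ⟨g', hg⟩
      exact ⟨μ.symm g', by rw [← map_smul, ← hg, AlgEquiv.symm_apply_apply]⟩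
    · rintro ⟨g', rfl⟩
      exact ⟨μ g', map_smul _ _ _⟩

section Core
variable {O : Type u} [CommRing O] [IsDomain O] [IsLocalRing O] {π : O}
  {V : Type*} [AddCommGroup V] [Module O V] [Module.Free O V] [Module.Finite O V]
  {A B κ : Type*} [Ring A] [Algebra O A] [Ring B] [Algebra O B] [Module.Free O B]
  [Module.Finite O B] [CommRing κ] {n : ℕ}

theorem core_dvr (hπ0 : π ≠ 0) (hπ : π ∈ IsLocalRing.maximalIdeal O)
    (N : ℕ) (hN : 0 < N) [Finite (O ⧸ Ideal.span {π ^ N})] (hn : 0 < n)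
    (ρ : A →ₐ[O] Module.End O V) (σ : B →ₐ[O] Module.End O V)
    (hcomm : ∀ a b, ρ a * σ b = σ b * ρ a)
    (φ : A →+* Matrix (Fin n) (Fin n) κ) (hφ : Function.Surjective φ)
    (hker : ∀ a, φ a = 0 → ∃ b, a = π • b)
    (hsat : ∀ b g, σ b = π • g → ∃ b', b = π • b')
    (hrank : (Module.finrank O V) ^ 2 = n ^ 2 * Module.finrank O B) :
    ∃ w : ℕ, w ^ 2 = Module.finrank O B ∧
      ∃ ψ : B →+* Matrix (Fin w) (Fin w) (O ⧸ Ideal.span {π ^ N}), Function.Surjective ψ ∧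
      ∀ b, ψ b = 0 ↔ ∃ b', b = π ^ N • b' := by
  classical
  set I := Ideal.span {π ^ N} with hI
  have hIm : I ≤ IsLocalRing.maximalIdeal O := by
    rw [hI, Ideal.span_singleton_le_iff_mem]
    exact Ideal.pow_mem_of_mem _ hπ N hN
  have hnt : Nontrivial (O ⧸ I) := Ideal.Quotient.nontrivial_iff.mpr (by
    intro h
    rw [h, top_le_iff] at hIm
    exact (IsLocalRing.maximalIdeal.isMaximal O).ne_top hIm)
  have hloc : IsLocalRing (O ⧸ I) :=
    IsLocalRing.of_surjective' (Ideal.Quotient.mk I) Ideal.Quotient.mk_surjective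
  have hmk : ∀ x : O, Ideal.Quotient.mk I x = 0 ↔ ∃ y, x = π ^ N * y := by
    intro x
    rw [Ideal.Quotient.eq_zero_iff_mem, hI, Ideal.mem_span_singleton]
    rfl
  obtain ⟨red, hred_smul, hred0⟩ := exists_red (V := V) (π ^ N)
  have hsatN : ∀ M : ℕ, ∀ b g, σ b = π ^ M • g → ∃ b', b = π ^ M • b' := by
    intro M
    induction M with
    | zero => exact fun b g _ => ⟨b, by simp⟩
    | succ M ih =>
      intro b g hb
      obtain ⟨b1, rfl⟩ := hsat b (π ^ M • g) (by rw [hb, smul_smul, pow_succ'])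
      have h1 : σ b1 = π ^ M • g := by
        rw [map_smul, pow_succ', mul_smul] at hb
        exact smul_right_injective _ hπ0 hb
      obtain ⟨b2, rfl⟩ := ih b1 g h1
      exact ⟨b2, by rw [smul_smul, pow_succ']⟩
  have hσ0 : ∀ b, red (σ b) = 0 ↔ ∃ b', b = π ^ N • b' := by
    intro b
    rw [hred0]
    constructor
    · rintro ⟨g, hg⟩
      exact hsatN N b g hg
    · rintro ⟨b', rfl⟩
      exact ⟨σ b', map_smul _ _ _⟩
  obtain ⟨ε, hε, a, ha⟩ := lift_idem π φ (Matrix.single ⟨0, hn⟩ ⟨0, hn⟩ 1) (by simp) hφ hker (N - 1)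
  rw [Nat.sub_add_cancel hN] at ha
  have hcard : Nat.card (red.comp (σ : B →+* Module.End O V)).range =
      Nat.card (O ⧸ I) ^ Module.finrank O B := by
    let β := (Module.finBasis O B).equivFun
    let T1 : B →+ Module.End (O ⧸ I) (Fin (Module.finrank O V) → O ⧸ I) :=
      (red.comp (σ : B →+* Module.End O V)).toAddMonoidHom
    let T2 : B →+ (Fin (Module.finrank O B) → O ⧸ I) :=
      { toFun := fun b i => Ideal.Quotient.mk I (β b i)
        map_zero' := by ext; simp
        map_add' := fun _ _ => by ext; simp }
    have hk : T1.ker = T2.ker := by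
      ext b
      rw [AddMonoidHom.mem_ker, AddMonoidHom.mem_ker]
      refine (hσ0 b).trans ?_
      constructor
      · rintro ⟨b', rfl⟩
        funext i
        change Ideal.Quotient.mk I (β _ i) = 0
        rw [hmk, map_smul]
        exact ⟨_, rfl⟩
      · intro h
        have h1 : ∀ i, ∃ y, β b i = π ^ N * y := fun i => (hmk _).mp (congrFun h i)
        choose y hy using h1
        refine ⟨β.symm y, ?_⟩
        rw [← map_smul]
        apply β.injective
        rw [LinearEquiv.apply_symm_apply]
        funext i
        exact hy i
    have hs : Function.Surjective T2 := by
      intro y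
      choose x hx using fun i => Ideal.Quotient.mk_surjective (y i)
      refine ⟨β.symm x, ?_⟩
      funext i
      change Ideal.Quotient.mk I (β _ i) = _
      rw [LinearEquiv.apply_symm_apply, hx]
    have h1 : Nat.card T1.range = Nat.card T2.range := by
      rw [← Nat.card_congr (QuotientAddGroup.quotientKerEquivRange T1).toEquiv,
        ← Nat.card_congr (QuotientAddGroup.quotientKerEquivRange T2).toEquiv, hk]
    rw [AddMonoidHom.range_eq_top.mpr hs, AddSubgroup.card_top, Nat.card_fun, Nat.card_fin] at h1
    rw [← h1]
    rfl
  obtain ⟨w, hw, ψ, hψ, hψ0⟩ := core_finite (S := O ⧸ I) (π := Ideal.Quotient.mk I π)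
    (V := Fin (Module.finrank O V) → O ⧸ I) ⟨N, by rw [← map_pow, hmk]; exact ⟨1, by rw [mul_one]⟩⟩ hn
    (red.comp (ρ : A →+* Module.End O V)) (red.comp (σ : B →+* Module.End O V))
    (fun a b => by
      change red (ρ a) * red (σ b) = red (σ b) * red (ρ a)
      rw [← map_mul, hcomm, map_mul])
    φ hφ (fun a ha => by
      obtain ⟨b, rfl⟩ := hker a ha
      refine ⟨b, ?_⟩
      change red (ρ (π • b)) = _ • red (ρ b)
      rw [map_smul, hred_smul]) ε hε (by
      change red (ρ ε) * red (ρ ε) = red (ρ ε)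
      rw [← sub_eq_zero, ← map_mul, ← map_mul, ← map_sub, ← map_sub, ha, hred0]
      exact ⟨ρ a, map_smul _ _ _⟩) _ hcard (by
      rw [Module.finrank_fin_fun]; exact hrank)
  exact ⟨w, hw, ψ, hψ, fun b => (hψ0 b).trans (hσ0 b)⟩

end Core
end B1
end

section
namespace B1

section DVR
variable {O : Type u} [CommRing O] [IsDomain O] [IsDiscreteValuationRing O]

lemma card_quot_pow {π : O} (hπ : Irreducible π) {q : ℕ}
    (hq : Nat.card (IsLocalRing.ResidueField O) = q) (N : ℕ) :
    Nat.card (O ⧸ Ideal.span {π ^ N}) = q ^ N := by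
  have hne : IsLocalRing.maximalIdeal O ≠ ⊥ := IsDiscreteValuationRing.not_a_field O
  have h := cardQuot_pow_of_prime (P := IsLocalRing.maximalIdeal O) hne (i := N)
  rw [Submodule.cardQuot_apply, Submodule.cardQuot_apply, hπ.maximalIdeal_eq,
    Ideal.span_singleton_pow] at h
  rw [← hq]
  refine h.trans ?_
  rw [← hπ.maximalIdeal_eq]
  rfl

lemma chainRing_quot {π : O} (hπ : Irreducible π) {q : ℕ} (hq0 : 0 < q)
    (hq : Nat.card (IsLocalRing.ResidueField O) = q) (N : ℕ) :
    ChainRing (O ⧸ Ideal.span {π ^ N}) (Ideal.Quotient.mk _ π) N q := by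
  have hc := card_quot_pow hπ hq
  have hfin : Finite (O ⧸ Ideal.span {π ^ N}) :=
    Nat.finite_of_card_ne_zero (by rw [hc]; exact (pow_pos hq0 _).ne')
  refine ⟨hfin, ?_, ?_⟩
  · intro i hi
    have hle : Ideal.span {π ^ N} ≤ Ideal.span {π ^ i} := by
      rw [Ideal.span_singleton_le_span_singleton]
      exact pow_dvd_pow _ hi
    have hmap : Ideal.map (Ideal.Quotient.mk (Ideal.span {π ^ N})) (Ideal.span {π ^ i}) =
        Ideal.span {Ideal.Quotient.mk (Ideal.span {π ^ N}) π ^ i} := by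
      rw [Ideal.map_span, Set.image_singleton, map_pow]
    have h1 := Nat.card_congr (DoubleQuot.quotQuotEquivQuotOfLE hle).toEquiv
    rw [hmap, hc] at h1
    have h2 := AddSubgroup.card_eq_card_quotient_mul_card_addSubgroup
      (Submodule.toAddSubgroup (Ideal.span {Ideal.Quotient.mk (Ideal.span {π ^ N}) π ^ i}))
    rw [hc] at h2
    have h3 : q ^ N = q ^ i * Nat.card
      (Ideal.span {Ideal.Quotient.mk (Ideal.span {π ^ N}) π ^ i}) := by
      rw [← h1]; exact h2
    have h4 : q ^ N = q ^ i * q ^ (N - i) := by rw [← pow_add, Nat.add_sub_cancel' hi]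
    exact Nat.eq_of_mul_eq_mul_left (pow_pos hq0 i) (h3.symm.trans h4)
  · intro J
    have hJ : Ideal.map (Ideal.Quotient.mk _) (Ideal.comap (Ideal.Quotient.mk _) J) = J :=
      Ideal.map_comap_of_surjective _ Ideal.Quotient.mk_surjective J
    have hN : π ^ N ∈ Ideal.comap (Ideal.Quotient.mk (Ideal.span {π ^ N})) J := by
      rw [Ideal.mem_comap, Ideal.Quotient.eq_zero_iff_mem.mpr (Ideal.mem_span_singleton_self _)]
      exact J.zero_mem
    have hne : Ideal.comap (Ideal.Quotient.mk (Ideal.span {π ^ N})) J ≠ ⊥ := by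
      intro h
      rw [h, Ideal.mem_bot] at hN
      exact pow_ne_zero _ hπ.ne_zero hN
    obtain ⟨i, hi⟩ := IsDiscreteValuationRing.ideal_eq_span_pow_irreducible hne hπ
    refine ⟨i, ?_, ?_⟩
    · rw [hi, Ideal.mem_span_singleton] at hN
      exact (pow_dvd_pow_iff hπ.ne_zero hπ.not_isUnit).mp hN
    · rw [← hJ, hi, Ideal.map_span, Set.image_singleton, map_pow]

variable {F : Type u} [Field F] [Algebra O F] [IsFractionRing O F]

lemma finrank_lattice {W : Type*} [AddCommGroup W] [Module F W] [Module O W] [IsScalarTower O F W]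
    (M : Submodule O W) [Module.Finite O M] (hM : ∀ s : W, ∃ c : O, c ≠ 0 ∧ c • s ∈ M) :
    Module.Free O M ∧ Module.finrank O M = Module.finrank F W := by
  have htf : Module.IsTorsionFree O W := by
    refine Module.IsTorsionFree.trans_faithfulSMul O F W
  have hfree : Module.Free O M := inferInstance
  refine ⟨hfree, ?_⟩
  let b := Module.finBasis O M
  have hli : LinearIndependent O (fun i => (b i : W)) :=
    b.linearIndependent.map' M.subtype (Submodule.ker_subtype M)
  have hliF : LinearIndependent F (fun i => (b i : W)) :=
    (LinearIndependent.iff_fractionRing O F).mp hli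
  have hsp : ⊤ ≤ Submodule.span F (Set.range (fun i => (b i : W))) := by
    intro s _
    obtain ⟨c, hc0, hc⟩ := hM s
    have h1 : (c • s) ∈ Submodule.span O (Set.range (fun i => (b i : W))) := by
      have h2 : (⟨c • s, hc⟩ : M) ∈ Submodule.span O (Set.range b) := by
        rw [b.span_eq]; trivial
      have h3 := Submodule.mem_map_of_mem (f := M.subtype) h2
      rw [Submodule.map_span, ← Set.range_comp] at h3
      exact h3
    have h2 : (c • s) ∈ Submodule.span F (Set.range (fun i => (b i : W))) :=
      Submodule.span_le_restrictScalars O F _ h1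
    have h3 : algebraMap O F c ≠ 0 := by
      intro h
      exact hc0 ((FaithfulSMul.algebraMap_eq_zero_iff O F).mp h)
    have h4 := Submodule.smul_mem _ (algebraMap O F c)⁻¹ h2
    rwa [← algebraMap_smul F c s, smul_smul, inv_mul_cancel₀ h3, one_smul] at h4
  have := Module.finrank_eq_card_basis (Module.Basis.mk hliF hsp)
  rw [this, Fintype.card_fin]

variable {D : Type u} [DivisionRing D] [Algebra F D] [Algebra O D] [IsScalarTower O F D]
  {V : Type*} [AddCommGroup V] [Module O V] [Module.Free O V] [Module.Finite O V]
  {A κ : Type*} [Ring A] [Algebra O A]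
  [CommRing κ] {n : ℕ}

theorem locOrd_of_core {π : O} (hπ : Irreducible π) {q : ℕ} (hq0 : 0 < q)
    (hq : Nat.card (IsLocalRing.ResidueField O) = q) (B : Subalgebra O D) [Module.Finite O B]
    (hB : ∀ s : D, ∃ c : O, c ≠ 0 ∧ c • s ∈ B) (hn : 0 < n)
    (ρ : A →ₐ[O] Module.End O V) (σ : B →ₐ[O] Module.End O V)
    (hcomm : ∀ a b, ρ a * σ b = σ b * ρ a)
    (φ : A →+* Matrix (Fin n) (Fin n) κ) (hφ : Function.Surjective φ)
    (hker : ∀ a, φ a = 0 → ∃ b, a = π • b)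
    (hsat : ∀ b g, σ b = π • g → ∃ b', b = π • b')
    (hrank : (Module.finrank O V) ^ 2 = n ^ 2 * Module.finrank F D)
    (ϖ : Dˣ) (hϖ : (ϖ : D) = algebraMap O D π) :
    ∃ w : ℕ, w ^ 2 = Module.finrank F D ∧ LocOrd B.toSubring ϖ w q := by
  obtain ⟨hfree, hfr⟩ := finrank_lattice (F := F) (W := D) (Subalgebra.toSubmodule B)
    (fun s => hB s)
  have hfree' : Module.Free O B := hfree
  have hfr' : Module.finrank O B = Module.finrank F D := hfr
  rw [← hfr'] at hrank
  have hfin : ∀ N, Finite (O ⧸ Ideal.span {π ^ N}) := fun N =>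
    Nat.finite_of_card_ne_zero (by rw [card_quot_pow hπ hq]; exact (pow_pos hq0 _).ne')
  have hπm : π ∈ IsLocalRing.maximalIdeal O := by
    rw [hπ.maximalIdeal_eq]; exact Ideal.mem_span_singleton_self _
  have key := fun N hN => core_dvr hπ.ne_zero hπm N hN hn ρ σ hcomm φ hφ hker hsat hrank
  obtain ⟨w, hw, -⟩ := key 1 one_pos
  have hmem : ∀ (c : O), algebraMap O D c ∈ B := fun c => B.algebraMap_mem c
  refine ⟨w, hw.trans hfr', ?_, ?_, ?_, ?_⟩
  · intro x; rw [hϖ]; exact Algebra.commutes _ _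
  · rw [hϖ]; exact hmem _
  · intro s
    obtain ⟨c, hc0, hc⟩ := hB s
    obtain ⟨k, u, hu⟩ := IsDiscreteValuationRing.eq_unit_mul_pow_irreducible hc0 hπ
    refine ⟨k, ?_⟩
    have h1 : (ϖ : D) ^ k * s = algebraMap O D (↑u⁻¹ : O) * (c • s) := by
      rw [Algebra.smul_def, ← mul_assoc, ← map_mul, hu, hϖ, ← mul_assoc, Units.inv_mul, one_mul,
        map_pow]
    rw [h1]
    exact B.mul_mem (hmem _) hc
  · intro N
    have hsm : ∀ b : D, π ^ N • b = (ϖ : D) ^ N * b := by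
      intro b; rw [Algebra.smul_def, hϖ, map_pow]
    rcases Nat.eq_zero_or_pos N with rfl | hN
    · have hsub : Subsingleton (O ⧸ Ideal.span {π ^ 0}) := by
        rw [pow_zero, Ideal.span_singleton_one]
        exact Submodule.Quotient.subsingleton_iff.mpr rfl
      refine ⟨_, inferInstance, _,
        { toFun := fun _ => 0
          map_one' := Subsingleton.elim _ _
          map_mul' := fun _ _ => Subsingleton.elim _ _
          map_zero' := rfl
          map_add' := fun _ _ => Subsingleton.elim _ _ }, chainRing_quot hπ hq0 hq 0, ?_, ?_⟩
      · intro y; exact ⟨0, Subsingleton.elim _ _⟩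
      · intro a
        refine ⟨fun _ => ⟨a, a.2, by rw [pow_zero, one_mul]⟩, fun _ => rfl⟩
    · obtain ⟨w', hw', ψ, hψ, hψ0⟩ := key N hN
      obtain rfl : w' = w := Nat.pow_left_injective (n := 2) (by norm_num) (hw'.trans hw.symm)
      refine ⟨_, inferInstance, _, ψ, chainRing_quot hπ hq0 hq N, hψ, ?_⟩
      intro a
      refine (hψ0 a).trans ?_
      constructor
      · rintro ⟨b, hb⟩
        refine ⟨b, b.2, ?_⟩
        rw [← hsm, hb]; rfl
      · rintro ⟨b, hb, hab⟩
        refine ⟨⟨b, hb⟩, Subtype.ext ?_⟩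
        refine hab.trans ?_
        rw [← hsm]; rfl

end DVR
end B1
end

section
namespace B1

open Classical in
lemma artin_whaples {F D ι : Type*} [Field F] [DivisionRing D] [Algebra F D] [Algebra.IsCentral F D]
    [Fintype ι] {e : ι → D} (he : LinearIndependent F e) (m : ℕ) :
    ∀ b : ι → D, (Finset.univ.filter (fun i => b i ≠ 0)).card ≤ m →
      (∀ x, ∑ i, e i * x * b i = 0) → b = 0 := by
  induction m with
  | zero =>
    intro b hb _
    funext i
    by_contra hi
    have : i ∈ Finset.univ.filter (fun i => b i ≠ 0) := by simpa using hi
    rw [Nat.le_zero, Finset.card_eq_zero] at hb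
    rw [hb] at this
    simp at this
  | succ m ih =>
    intro b hb hx
    by_contra hb0
    obtain ⟨i0, hi0⟩ := Function.ne_iff.mp hb0
    simp only [Pi.zero_apply] at hi0
    let b1 : ι → D := fun i => b i * (b i0)⁻¹
    have hb1 : ∀ x, ∑ i, e i * x * b1 i = 0 := by
      intro x
      have := congrArg (· * (b i0)⁻¹) (hx x)
      simp only [zero_mul, Finset.sum_mul] at this
      simpa only [b1, mul_assoc] using this
    have hb1i : b1 i0 = 1 := mul_inv_cancel₀ hi0
    have hcomm : ∀ y i, b1 i * y = y * b1 i := by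
      intro y i
      have h := ih (fun i => b1 i * y - y * b1 i) ?_ ?_
      · exact sub_eq_zero.mp (congrFun h i)
      · have hss : Finset.univ.filter (fun i => b1 i * y - y * b1 i ≠ 0) ⊂
            Finset.univ.filter (fun i => b i ≠ 0) := by
          refine Finset.ssubset_iff_of_subset ?_ |>.mpr ⟨i0, by simpa using hi0, ?_⟩
          · intro i
            simp only [Finset.mem_filter, Finset.mem_univ, true_and]
            intro h h0
            apply h
            simp [b1, h0]
          · simp [hb1i]
        have := Finset.card_lt_card hss
        omega
      · intro x
        have h1 := congrArg (· * y) (hb1 x)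
        have h2 := hb1 (x * y)
        simp only [zero_mul, Finset.sum_mul] at h1
        have : ∀ i, e i * x * (b1 i * y - y * b1 i) = e i * x * b1 i * y - e i * (x * y) * b1 i := by
          intro i; noncomm_ring
        simp only [this, Finset.sum_sub_distrib, h1, h2, sub_zero]
    have hcen : ∀ i, ∃ c : F, algebraMap F D c = b1 i := by
      intro i
      have : b1 i ∈ Subalgebra.center F D := by
        rw [Subalgebra.mem_center_iff]
        intro y; exact (hcomm y i).symm
      exact (Algebra.IsCentral.mem_center_iff F).mp this |>.imp fun c hc => hc.symm
    choose c hc using hcen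
    have h1 := hb1 1
    simp only [mul_one] at h1
    have h2 : ∑ i, c i • e i = 0 := by
      rw [← h1]
      refine Finset.sum_congr rfl fun i _ => ?_
      rw [← hc, Algebra.smul_def, Algebra.commutes]
    have h3 := Fintype.linearIndependent_iff.mp he c h2 i0
    have h4 := hc i0
    rw [h3, hb1i, map_zero] at h4
    exact zero_ne_one h4

/-- Elementary operators are combinations of two sided multiplications. -/
lemma exists_coeff {F D : Type*} [Field F] [DivisionRing D] [Algebra F D] [Algebra.IsCentral F D]
    {m : ℕ} (e : Module.Basis (Fin m) F D) :
    ∃ c : Fin m → Fin m → Fin m → Fin m → F, ∀ k l x,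
      e.repr x k • e l = ∑ i, ∑ j, c k l i j • (e i * x * e j) := by
  classical
  have : FiniteDimensional F D := e.finiteDimensional_of_finite
  let T : Fin m × Fin m → Module.End F D := fun ij => LinearMap.mulLeft F (e ij.1) ∘ₗ LinearMap.mulRight F (e ij.2)
  have hT : ∀ ij x, T ij x = e ij.1 * x * e ij.2 := by
    intro ij x; simp [T, mul_assoc]
  have hli : LinearIndependent F T := by
    rw [Fintype.linearIndependent_iff]
    intro c hc
    have h1 := artin_whaples e.linearIndependent m (fun i => ∑ j, c (i, j) • e j)
      ((Finset.card_filter_le _ _).trans (by simp)) (by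
        intro x
        have := congrArg (fun g : Module.End F D => g x) hc
        simp only [LinearMap.sum_apply, LinearMap.smul_apply, hT, Fintype.sum_prod_type,
          LinearMap.zero_apply] at this
        rw [← this]
        refine Finset.sum_congr rfl fun i _ => ?_
        rw [Finset.mul_sum]
        refine Finset.sum_congr rfl fun j _ => ?_
        rw [mul_smul_comm])
    rintro ⟨i, j⟩
    exact Fintype.linearIndependent_iff.mp e.linearIndependent (fun j => c (i, j)) (congrFun h1 i) j
  have hsp := hli.span_eq_top_of_card_eq_finrank' (by
    rw [Module.finrank_linearMap, Module.finrank_eq_card_basis e, Fintype.card_prod])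
  have : ∀ k l, ∃ c : Fin m × Fin m → F, ∑ ij, c ij • T ij = (e.coord k).smulRight (e l) := by
    intro k l
    have h : (e.coord k).smulRight (e l) ∈ Submodule.span F (Set.range T) := by rw [hsp]; trivial
    exact (Submodule.mem_span_range_iff_exists_fun F).mp h
  choose c hc using this
  refine ⟨fun k l i j => c k l (i, j), fun k l x => ?_⟩
  have := congrArg (fun g : Module.End F D => g x) (hc k l)
  simp only [LinearMap.sum_apply, LinearMap.smul_apply, hT, Fintype.sum_prod_type] at this
  rw [this]
  rfl

/-- central simple algebras over finite fields are split -/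
lemma csa_finite {κ R : Type*} [Field κ] [Finite κ] [Ring R] [Algebra κ R] [FiniteDimensional κ R]
    [Algebra.IsCentral κ R] [IsSimpleRing R] :
    ∃ n : ℕ, 0 < n ∧ n ^ 2 = Module.finrank κ R ∧
      Nonempty (R ≃ₐ[κ] Matrix (Fin n) (Fin n) κ) := by
  have : IsArtinianRing R := IsArtinianRing.of_finite κ R
  obtain ⟨n, hn, E, _, _, hE, ⟨g⟩⟩ :=
    IsSimpleRing.exists_algEquiv_matrix_divisionRing_finite κ R
  have hfin : Finite E := Module.finite_of_finite κ
  have hcomm : ∀ x y : E, x * y = y * x := by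
    letI := littleWedderburn E
    intro x y
    exact mul_comm x y
  have hn0 : 0 < n := Nat.pos_of_ne_zero hn.out
  have hs : Function.Surjective (algebraMap κ E) := by
    intro d
    have h1 : g.symm (Matrix.scalar (Fin n) d) ∈ Subalgebra.center κ R := by
      rw [Subalgebra.mem_center_iff]
      intro b
      apply g.injective
      rw [map_mul, map_mul, AlgEquiv.apply_symm_apply]
      exact (Matrix.scalar_commute d (fun r => hcomm d r) (g b)).symm.eq
    obtain ⟨c, hc⟩ := (Algebra.IsCentral.mem_center_iff κ).mp h1
    refine ⟨c, ?_⟩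
    have h2 := congrArg g hc
    rw [AlgEquiv.apply_symm_apply, AlgEquiv.commutes] at h2
    have h3 := congrFun (congrFun h2 ⟨0, hn0⟩) ⟨0, hn0⟩
    simp only [Matrix.scalar_apply, Matrix.diagonal_apply_eq, Matrix.algebraMap_matrix_apply,
      if_true] at h3
    exact h3.symm
  let g2 : R ≃ₐ[κ] Matrix (Fin n) (Fin n) κ := g.trans (AlgEquiv.mapMatrix (AlgEquiv.ofBijective (Algebra.ofId κ E)
    ⟨(algebraMap κ E).injective, hs⟩).symm)
  refine ⟨n, hn0, ?_, ⟨g2⟩⟩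
  rw [g2.toLinearEquiv.finrank_eq, Module.finrank_matrix]
  simp [pow_two]

end B1
end

section
namespace B1
open TensorProduct

lemma csa_of_coeff {κ R : Type*} [Field κ] [Ring R] [Nontrivial R] [Algebra κ R] {m : ℕ}
    (e : Module.Basis (Fin m) κ R) (c : Fin m → Fin m → Fin m → Fin m → κ)
    (hc : ∀ k l x, e.repr x k • e l = ∑ i, ∑ j, c k l i j • (e i * x * e j)) :
    Algebra.IsCentral κ R ∧ IsSimpleRing R := by
  constructor
  · refine ⟨fun z hz => ?_⟩
    rw [Subalgebra.mem_center_iff] at hz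
    have h1 : ∀ k l, e.repr z k • e l = e.repr 1 k • (e l * z) := by
      intro k l
      rw [hc, ← smul_mul_assoc, hc, Finset.sum_mul]
      refine Finset.sum_congr rfl fun i _ => ?_
      rw [Finset.sum_mul]
      refine Finset.sum_congr rfl fun j _ => ?_
      rw [smul_mul_assoc, mul_one, mul_assoc, mul_assoc, hz]
    have h0 : ∃ k, e.repr 1 k ≠ 0 := by
      by_contra hcon
      push Not at hcon
      have : e.repr 1 = 0 := Finsupp.ext hcon
      exact one_ne_zero ((map_eq_zero_iff _ e.repr.injective).mp this)
    obtain ⟨k, hk⟩ := h0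
    rw [Algebra.mem_bot]
    refine ⟨(e.repr 1 k)⁻¹ * e.repr z k, ?_⟩
    have h2 : ∀ l, e l * z = ((e.repr 1 k)⁻¹ * e.repr z k) • e l := by
      intro l
      rw [mul_smul, h1, smul_smul, inv_mul_cancel₀ hk, one_smul]
    have h3 : LinearMap.mulRight κ z = ((e.repr 1 k)⁻¹ * e.repr z k) • LinearMap.id := by
      apply e.ext
      intro l
      simpa using h2 l
    have h4 := congrArg (fun g : R →ₗ[κ] R => g 1) h3
    simp only [LinearMap.mulRight_apply, one_mul, LinearMap.smul_apply, LinearMap.id_apply] at h4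
    rw [Algebra.algebraMap_eq_smul_one]
    exact h4.symm
  · refine ⟨⟨fun I => ?_⟩⟩
    by_cases hI : I = ⊥
    · exact Or.inl hI
    right
    have : ∃ x ∈ I, x ≠ 0 := by
      by_contra hcon
      push Not at hcon
      apply hI
      rw [eq_bot_iff]
      intro x hx
      rw [hcon x hx]
      exact TwoSidedIdeal.zero_mem _
    obtain ⟨x, hx, hx0⟩ := this
    have h0 : ∃ k, e.repr x k ≠ 0 := by
      by_contra hcon
      push Not at hcon
      exact hx0 ((map_eq_zero_iff _ e.repr.injective).mp (Finsupp.ext hcon))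
    obtain ⟨k, hk⟩ := h0
    have hsm : ∀ (a : κ) y, y ∈ I → a • y ∈ I := by
      intro a y hy
      rw [Algebra.smul_def]
      exact I.mul_mem_left _ _ hy
    have hsum : ∀ f : Fin m → R, (∀ i, f i ∈ I) → ∑ i, f i ∈ I := by
      intro f hf
      exact sum_mem fun i _ => hf i
    have hel : ∀ l, e l ∈ I := by
      intro l
      have h1 : e.repr x k • e l ∈ I := by
        rw [hc]
        refine hsum _ fun i => hsum _ fun j => hsm _ _ ?_
        exact I.mul_mem_right _ _ (I.mul_mem_left _ _ hx)
      have := hsm (e.repr x k)⁻¹ _ h1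
      rwa [smul_smul, inv_mul_cancel₀ hk, one_smul] at this
    rw [eq_top_iff]
    intro y _
    rw [← e.sum_repr y]
    exact hsum _ fun i => hsm _ _ (hel i)

section
variable {O : Type u} [CommRing O] [IsDomain O] [IsDiscreteValuationRing O]

lemma residue_surj {A₀ : Type*} [Ring A₀] [Algebra O A₀] :
    Function.Surjective (fun a : A₀ => (1 : IsLocalRing.ResidueField O) ⊗ₜ[O] a) := by
  intro x
  induction x using TensorProduct.induction_on with
  | zero => exact ⟨0, by simp⟩
  | tmul c a =>
    obtain ⟨r, rfl⟩ := IsLocalRing.residue_surjective c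
    refine ⟨r • a, ?_⟩
    simp only
    rw [← TensorProduct.smul_tmul]
    congr 1
    rw [Algebra.smul_def, mul_one]
    rfl
  | add x y hx hy =>
    obtain ⟨a, rfl⟩ := hx
    obtain ⟨b, rfl⟩ := hy
    exact ⟨a + b, TensorProduct.tmul_add _ _ _⟩

lemma residue_ker {A₀ : Type*} [Ring A₀] [Algebra O A₀] [Module.Free O A₀] [Module.Finite O A₀]
    {π : O} (hπ : Irreducible π) (a : A₀)
    (h : (1 : IsLocalRing.ResidueField O) ⊗ₜ[O] a = 0) : ∃ b, a = π • b := by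
  let b := Module.finBasis O A₀
  have h1 : ∀ i, ∃ y, b.repr a i = π * y := by
    intro i
    have h2 := congrArg (fun z => (Algebra.TensorProduct.basis (IsLocalRing.ResidueField O) b).repr z i) h
    simp only [Algebra.TensorProduct.basis_repr_tmul, map_zero] at h2
    have h3 : IsLocalRing.residue O (b.repr a i) = 0 := by
      simpa using h2
    rw [IsLocalRing.residue_eq_zero_iff, hπ.maximalIdeal_eq, Ideal.mem_span_singleton] at h3
    exact h3
  choose y hy using h1
  refine ⟨∑ i, y i • b i, ?_⟩
  rw [Finset.smul_sum]
  conv_lhs => rw [← b.sum_repr a]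
  refine Finset.sum_congr rfl fun i _ => ?_
  rw [hy, mul_smul]

/-- the residue map on an Azumaya algebra -/
lemma azumaya_residue {A₀ : Type*} [Ring A₀] [Algebra O A₀] [Module.Free O A₀] [Module.Finite O A₀]
    [Finite (IsLocalRing.ResidueField O)]
    {π : O} (hπ : Irreducible π)
    (h1 : Algebra.IsCentral (IsLocalRing.ResidueField O) ((IsLocalRing.ResidueField O) ⊗[O] A₀))
    (h2 : IsSimpleRing ((IsLocalRing.ResidueField O) ⊗[O] A₀)) :
    ∃ n : ℕ, 0 < n ∧ n ^ 2 = Module.finrank O A₀ ∧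
      ∃ φ : A₀ᵐᵒᵖ →+* Matrix (Fin n) (Fin n) (IsLocalRing.ResidueField O), Function.Surjective φ ∧
        ∀ a, φ a = 0 → ∃ b, a = π • b := by
  obtain ⟨n, hn, hn2, ⟨g⟩⟩ := csa_finite (κ := IsLocalRing.ResidueField O)
    (R := (IsLocalRing.ResidueField O) ⊗[O] A₀)
  refine ⟨n, hn, ?_, ?_⟩
  · rw [hn2, Module.finrank_baseChange]
  · let φ0 : A₀ →+* Matrix (Fin n) (Fin n) (IsLocalRing.ResidueField O) :=
      g.toRingEquiv.toRingHom.comp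
        (Algebra.TensorProduct.includeRight (R := O) (A := IsLocalRing.ResidueField O)
          (B := A₀)).toRingHom
    have hφ0 : ∀ a, φ0 a = g ((1 : IsLocalRing.ResidueField O) ⊗ₜ[O] a) := fun _ => rfl
    refine ⟨(Matrix.transposeRingEquiv (Fin n)
      (IsLocalRing.ResidueField O)).symm.toRingHom.comp (RingHom.op φ0), ?_, ?_⟩
    · intro M
      obtain ⟨a, ha⟩ := residue_surj (O := O) (g.symm M.transpose)
      refine ⟨MulOpposite.op a, ?_⟩
      change ((φ0 a)).transpose = M
      rw [hφ0]
      simp only at ha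
      rw [ha, AlgEquiv.apply_symm_apply, Matrix.transpose_transpose]
    · intro a ha
      change ((φ0 a.unop)).transpose = 0 at ha
      rw [Matrix.transpose_eq_zero, hφ0, map_eq_zero_iff _ g.injective] at ha
      obtain ⟨b, hb⟩ := residue_ker hπ _ ha
      exact ⟨MulOpposite.op b, MulOpposite.unop_injective hb⟩

variable {F : Type u} [Field F] [Algebra O F] [IsFractionRing O F]
variable {D : Type u} [DivisionRing D] [Algebra F D] [Algebra O D] [IsScalarTower O F D]

theorem good_place {π : O} (hπ : Irreducible π) {q : ℕ} (hq0 : 0 < q)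
    (hq : Nat.card (IsLocalRing.ResidueField O) = q) {m : ℕ} (e : Module.Basis (Fin m) F D)
    (c : Fin m → Fin m → Fin m → Fin m → F)
    (hc : ∀ k l x, e.repr x k • e l = ∑ i, ∑ j, c k l i j • (e i * x * e j))
    (h1 : ∀ k, e.repr 1 k ∈ Set.range (algebraMap O F))
    (h2 : ∀ i j k, e.repr (e i * e j) k ∈ Set.range (algebraMap O F))
    (h3 : ∀ k l i j, c k l i j ∈ Set.range (algebraMap O F))
    (ϖ : Dˣ) (hϖ : (ϖ : D) = algebraMap O D π) :
    ∃ B : Subalgebra O D, (∀ s, s ∈ B ↔ ∀ i, e.repr s i ∈ Set.range (algebraMap O F)) ∧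
      ∃ w : ℕ, w ^ 2 = Module.finrank F D ∧ LocOrd B.toSubring ϖ w q := by
  have hfinκ : Finite (IsLocalRing.ResidueField O) :=
    Nat.finite_of_card_ne_zero (by rw [hq]; exact hq0.ne')
  have hmem : ∀ s : D, s ∈ Submodule.span O (Set.range e) ↔
      ∀ i, e.repr s i ∈ Set.range (algebraMap O F) := fun s => e.mem_span_iff_repr_mem O s
  have hmm : Submodule.span O (Set.range e) * Submodule.span O (Set.range e) ≤
      Submodule.span O (Set.range e) := by
    rw [Submodule.span_mul_span, Submodule.span_le]
    rintro _ ⟨_, ⟨i, rfl⟩, _, ⟨j, rfl⟩, rfl⟩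
    exact (hmem _).mpr (h2 i j)
  have h1m : (1 : D) ∈ Submodule.span O (Set.range e) := (hmem _).mpr h1
  let B : Subalgebra O D := Submodule.toSubalgebra (Submodule.span O (Set.range e)) h1m
    (fun x y hx hy => hmm (Submodule.mul_mem_mul hx hy))
  let b : Module.Basis (Fin m) O B := e.restrictScalars O
  have hb : ∀ i, (b i : D) = e i := fun i => e.restrictScalars_apply O i
  have hbr : ∀ (s : B) i, algebraMap O F (b.repr s i) = e.repr s i := fun s i =>
    e.restrictScalars_repr_apply O s i
  have hfin : Module.Finite O B := Module.Finite.of_basis b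
  have hfree : Module.Free O B := Module.Free.of_basis b
  refine ⟨B, hmem, ?_⟩
  choose c' hc' using h3
  have hcB : ∀ k l (x : B), b.repr x k • b l = ∑ i, ∑ j, c' k l i j • (b i * x * b j) := by
    intro k l x
    apply Subtype.ext
    have h := hc k l x
    simp only [AddSubmonoidClass.coe_finsetSum]
    simp only [Subalgebra.coe_smul, Subalgebra.coe_mul, hb]
    rw [← algebraMap_smul F, hbr, h]
    refine Finset.sum_congr rfl fun i _ => Finset.sum_congr rfl fun j _ => ?_
    rw [← hc', algebraMap_smul]
  let κ := IsLocalRing.ResidueField O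
  let bκ := Algebra.TensorProduct.basis κ b
  have hnt : Nontrivial (κ ⊗[O] B) := by
    have hm : 0 < m := by
      rcases Nat.eq_zero_or_pos m with rfl | hm
      · exact absurd (e.repr.injective (Subsingleton.elim _ _)) (one_ne_zero (α := D))
      · exact hm
    exact ⟨⟨bκ ⟨0, hm⟩, 0, bκ.ne_zero _⟩⟩
  obtain ⟨hcen, hsim⟩ := csa_of_coeff bκ (fun k l i j => IsLocalRing.residue O (c' k l i j)) (by
    intro k l x
    obtain ⟨s, rfl⟩ := residue_surj x
    have h := congrArg (Algebra.TensorProduct.includeRight (R := O) (A := κ) (B := B)) (hcB k l s)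
    simp only [map_sum, map_smul, map_mul] at h
    have hs : ∀ (r : O) (z : κ ⊗[O] B), IsLocalRing.residue O r • z = r • z := fun r z =>
      algebraMap_smul κ r z
    simp only [hs]
    have hbb : ∀ i, bκ i = Algebra.TensorProduct.includeRight (R := O) (A := κ) (B := B) (b i) := by
      intro i
      simp [bκ]
    simp only [hbb]
    have hr : bκ.repr ((1 : κ) ⊗ₜ[O] s) k = IsLocalRing.residue O (b.repr s k) := by
      simp only [bκ, Algebra.TensorProduct.basis_repr_tmul]
      simp
      rfl
    rw [hr, hs]
    exact h)
  obtain ⟨n, hn, hn2, φ, hφ, hker⟩ := azumaya_residue (A₀ := B) hπ hcen hsim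
  have hfr : Module.finrank O B = m := by rw [Module.finrank_eq_card_basis b, Fintype.card_fin]
  have hfrD : Module.finrank F D = m := by rw [Module.finrank_eq_card_basis e, Fintype.card_fin]
  refine locOrd_of_core hπ hq0 hq B ?_ hn (Algebra.lsmul O O B : Bᵐᵒᵖ →ₐ[O] Module.End O B)
    (Algebra.lmul O B) ?_ φ hφ hker ?_ ?_ ϖ hϖ
  · intro s
    obtain ⟨d, hd⟩ := IsLocalization.exist_integer_multiples_of_finite (nonZeroDivisors O)
      (fun i => e.repr s i)
    refine ⟨d, nonZeroDivisors.coe_ne_zero d, (hmem _).mpr fun i => ?_⟩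
    rw [← algebraMap_smul F, map_smul]
    obtain ⟨y, hy⟩ := hd i
    exact ⟨y, by rw [hy, Algebra.smul_def]; rfl⟩
  · intro a b
    ext x
    simp [mul_assoc]
  · intro b g h
    refine ⟨g 1, ?_⟩
    have := congrArg (fun g : Module.End O B => g 1) h
    simpa using this
  · rw [hn2, hfr, hfrD, pow_two]

end
end B1
end

section
namespace B1
open TensorProduct

section
variable {O : Type u} [CommRing O] [IsDomain O] [IsDiscreteValuationRing O]
variable {F : Type u} [Field F] [Algebra O F] [IsFractionRing O F]
variable {E : Type u} [DivisionRing E] [Algebra F E] [Algebra O E] [IsScalarTower O F E]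
  [FiniteDimensional F E]

theorem bad_place {π : O} (hπ : Irreducible π) {q : ℕ} (hq0 : 0 < q)
    (hq : Nat.card (IsLocalRing.ResidueField O) = q) {s : ℕ} (i0 : Fin s)
    {A₀ : Type*} [Ring A₀] [Algebra O A₀] [Module.Free O A₀] [Module.Finite O A₀]
    (hcen : Algebra.IsCentral (IsLocalRing.ResidueField O) ((IsLocalRing.ResidueField O) ⊗[O] A₀))
    (hsim : IsSimpleRing ((IsLocalRing.ResidueField O) ⊗[O] A₀))
    (j : A₀ →ₐ[O] Matrix (Fin s) (Fin s) E)
    (hj : ∀ M, ∃ c : O, c ≠ 0 ∧ ∃ a, c • M = j a)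
    (hfr : Module.finrank O A₀ = s ^ 2 * Module.finrank F E)
    (ϖ : Eˣ) (hϖ : (ϖ : E) = algebraMap O E π) :
    ∃ B : Subalgebra O E, Module.Finite O B ∧
      ∃ w : ℕ, w ^ 2 = Module.finrank F E ∧ LocOrd B.toSubring ϖ w q := by
  have hfinκ : Finite (IsLocalRing.ResidueField O) :=
    Nat.finite_of_card_ne_zero (by rw [hq]; exact hq0.ne')
  obtain ⟨n, hn, hn2, φ, hφ, hker⟩ := azumaya_residue (A₀ := A₀) hπ hcen hsim
  let row : A₀ →ₗ[O] (Fin s → E) :=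
    { toFun := fun a => j a i0
      map_add' := fun a b => by rw [map_add]; rfl
      map_smul' := fun c a => by rw [map_smul]; rfl }
  have hrow : ∀ a, row a = j a i0 := fun _ => rfl
  let 𝒱 : Submodule O (Fin s → E) := LinearMap.range row
  have hfinV : Module.Finite O 𝒱 := inferInstance
  have hlat : ∀ v : Fin s → E, ∃ c : O, c ≠ 0 ∧ c • v ∈ 𝒱 := by
    intro v
    obtain ⟨c, hc, a, ha⟩ := hj (fun _ => v)
    refine ⟨c, hc, a, ?_⟩
    rw [hrow, ← ha]
    rfl
  obtain ⟨hfreeV, hrV⟩ := finrank_lattice (F := F) 𝒱 hlat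
  have hrV' : Module.finrank O 𝒱 = s * Module.finrank F E := by
    rw [hrV, Module.finrank_pi_fintype]
    simp
  have hact : ∀ (a : A₀) v, v ∈ 𝒱 → Matrix.vecMul v (j a) ∈ 𝒱 := by
    rintro a _ ⟨b, rfl⟩
    refine ⟨b * a, ?_⟩
    rw [hrow, hrow, map_mul]
    rfl
  let ρ : A₀ᵐᵒᵖ →ₐ[O] Module.End O 𝒱 :=
    { toFun := fun a =>
        { toFun := fun v => ⟨Matrix.vecMul v.1 (j a.unop), hact _ _ v.2⟩
          map_add' := fun v w => Subtype.ext (Matrix.add_vecMul (j a.unop) v.1 w.1)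
          map_smul' := fun c v => Subtype.ext (Matrix.smul_vecMul c v.1 (j a.unop)) }
      map_one' := by
        ext v : 2
        change Matrix.vecMul v.1 (j 1) = v.1
        rw [map_one, Matrix.vecMul_one]
      map_mul' := fun a b => by
        ext v : 2
        change Matrix.vecMul v.1 (j (b.unop * a.unop)) =
          Matrix.vecMul (Matrix.vecMul v.1 (j b.unop)) (j a.unop)
        rw [map_mul, Matrix.vecMul_vecMul]
      map_zero' := by
        ext v : 2
        change Matrix.vecMul v.1 (j 0) = 0
        rw [map_zero, Matrix.vecMul_zero]
      map_add' := fun a b => by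
        ext v : 2
        change Matrix.vecMul v.1 (j (a.unop + b.unop)) =
          Matrix.vecMul v.1 (j a.unop) + Matrix.vecMul v.1 (j b.unop)
        rw [map_add, Matrix.vecMul_add]
      commutes' := fun c => by
        ext v : 2
        change Matrix.vecMul v.1 (j (algebraMap O A₀ c)) = c • v.1
        rw [Algebra.algebraMap_eq_smul_one, map_smul, map_one]
        funext i
        simp [Matrix.vecMul, dotProduct, Matrix.one_apply] }
  let B : Subalgebra O E :=
    { carrier := {b | ∀ v ∈ 𝒱, b • v ∈ 𝒱}
      mul_mem' := fun {a b} ha hb v hv => by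
        rw [mul_smul]; exact ha _ (hb _ hv)
      add_mem' := fun {a b} ha hb v hv => by
        rw [add_smul]; exact 𝒱.add_mem (ha _ hv) (hb _ hv)
      algebraMap_mem' := fun c v hv => by
        rw [algebraMap_smul]; exact 𝒱.smul_mem _ hv }
  have hBmem : ∀ b, b ∈ B ↔ ∀ v ∈ 𝒱, b • v ∈ 𝒱 := fun b => Iff.rfl
  let σ : B →ₐ[O] Module.End O 𝒱 :=
    { toFun := fun b =>
        { toFun := fun v => ⟨(b : E) • v.1, b.2 _ v.2⟩
          map_add' := fun v w => Subtype.ext (smul_add _ _ _)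
          map_smul' := fun c v => Subtype.ext (smul_comm _ _ _) }
      map_one' := by
        ext v : 2
        exact one_smul E v.1
      map_mul' := fun a b => by
        ext v : 2
        exact mul_smul (a : E) (b : E) v.1
      map_zero' := by
        ext v : 2
        exact zero_smul E v.1
      map_add' := fun a b => by
        ext v : 2
        exact add_smul (a : E) (b : E) v.1
      commutes' := fun c => by
        ext v : 2
        exact algebraMap_smul E c v.1 }
  have hσ : ∀ b v, ((σ b v : 𝒱) : Fin s → E) = (b : E) • (v : Fin s → E) := fun _ _ => rfl
  have hinjO : Function.Injective (algebraMap O F) := IsFractionRing.injective O F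
  have hinjOE : ∀ c : O, c ≠ 0 → algebraMap O E c ≠ 0 := by
    intro c hc h
    rw [IsScalarTower.algebraMap_apply O F E] at h
    have h1 := (map_eq_zero_iff _ (algebraMap F E).injective).mp h
    exact hc ((map_eq_zero_iff _ hinjO).mp h1)
  have hfinB : Module.Finite O B := by
    obtain ⟨c, hc, hv⟩ := hlat (Pi.single i0 1)
    let f : B →ₗ[O] 𝒱 := (LinearMap.applyₗ (R := O) (⟨_, hv⟩ : 𝒱)).comp σ.toLinearMap
    refine Module.Finite.of_injective f ?_
    rw [injective_iff_map_eq_zero]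
    intro b hb
    have h1 : (b : E) • (c • (Pi.single i0 1 : Fin s → E)) = 0 := congrArg Subtype.val hb
    have h2 := congrFun h1 i0
    rw [smul_comm] at h2
    simp only [Pi.smul_apply, Pi.single_eq_same, smul_eq_mul, mul_one, Pi.zero_apply] at h2
    rw [Algebra.smul_def] at h2
    exact Subtype.ext ((mul_eq_zero.mp h2).resolve_left (hinjOE c hc))
  refine ⟨B, hfinB, ?_⟩
  refine locOrd_of_core hπ hq0 hq B ?_ hn ρ σ ?_ φ hφ hker ?_ ?_ ϖ hϖ
  · intro d
    obtain ⟨S, hS⟩ := (Module.Finite.iff_fg (N := 𝒱)).mp hfinV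
    have key : ∀ T : Finset (Fin s → E), ∃ c : O, c ≠ 0 ∧ ∀ v ∈ T, c • (d • v) ∈ 𝒱 := by
      classical
      intro T
      induction T using Finset.induction_on with
      | empty => exact ⟨1, one_ne_zero, by simp⟩
      | insert x T _ ih =>
        obtain ⟨c, hc, hcT⟩ := ih
        obtain ⟨c', hc', hx⟩ := hlat (d • x)
        refine ⟨c * c', mul_ne_zero hc hc', fun v hv => ?_⟩
        rcases Finset.mem_insert.mp hv with rfl | hv
        · rw [mul_smul]; exact 𝒱.smul_mem _ hx
        · rw [mul_comm, mul_smul]; exact 𝒱.smul_mem _ (hcT v hv)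
    obtain ⟨c, hc, hcS⟩ := key S
    refine ⟨c, hc, (hBmem _).mpr fun v hv => ?_⟩
    rw [smul_assoc]
    rw [← hS] at hv
    induction hv using Submodule.span_induction with
    | mem x hx => exact hcS x hx
    | zero => rw [smul_zero, smul_zero]; exact 𝒱.zero_mem
    | add x y _ _ hx hy => rw [smul_add, smul_add]; exact 𝒱.add_mem hx hy
    | smul r x _ hx =>
      rw [smul_comm d r, smul_comm c r]; exact 𝒱.smul_mem _ hx
  · intro a b
    ext v : 2
    change Matrix.vecMul ((b : E) • v.1) (j a.unop) = (b : E) • Matrix.vecMul v.1 (j a.unop)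
    rw [Matrix.smul_vecMul]
  · intro b g h
    have hπE := hinjOE π hπ.ne_zero
    have hb' : (algebraMap O E π)⁻¹ * (b : E) ∈ B := by
      rw [hBmem]
      intro v hv
      have h1 := congrArg (fun g : Module.End O 𝒱 => ((g ⟨v, hv⟩ : 𝒱) : Fin s → E)) h
      simp only [hσ] at h1
      rw [mul_smul, h1]
      have h2 : (((π • g) ⟨v, hv⟩ : 𝒱) : Fin s → E) = algebraMap O E π • ((g ⟨v, hv⟩ : 𝒱) : Fin s → E) := by
        rw [algebraMap_smul]; rfl
      rw [h2, smul_smul, inv_mul_cancel₀ hπE, one_smul]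
      exact (g ⟨v, hv⟩).2
    refine ⟨⟨_, hb'⟩, Subtype.ext ?_⟩
    change (b : E) = π • ((algebraMap O E π)⁻¹ * (b : E))
    rw [Algebra.smul_def, ← mul_assoc, mul_inv_cancel₀ hπE, one_mul]
  · rw [hrV', hn2, hfr]; ring

end
end B1
end

section
namespace B1
open IsDedekindDomain HeightOneSpectrum

section ded
variable {R F : Type u} [CommRing R] [IsDedekindDomain R] [Field F] [Algebra R F]
  [IsFractionRing R F]

lemma mem_vs (v : HeightOneSpectrum R) (x : F) :
    x ∈ valuationSubringAtPrime F v ↔ v.valuation F x ≤ 1 := by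
  rw [valuationSubringAtPrime_eq_valuationSubring]; rfl

lemma dvr_vs (v : HeightOneSpectrum R) :
    IsDiscreteValuationRing (valuationSubringAtPrime F v) :=
  IsLocalization.AtPrime.isDiscreteValuationRing_of_dedekind_domain R v.ne_bot _

lemma unif_vs (v : HeightOneSpectrum R) : ∃ ϖ : Fˣ, ∃ h : (ϖ : F) ∈ valuationSubringAtPrime F v,
    Irreducible (⟨ϖ, h⟩ : valuationSubringAtPrime F v) := by
  have := dvr_vs (F := F) v
  obtain ⟨a, ha⟩ := IsDiscreteValuationRing.exists_irreducible (valuationSubringAtPrime F v)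
  exact ⟨Units.mk0 (a : F) (fun h => ha.ne_zero (Subtype.ext h)), a.2, ha⟩

lemma card_vs (v : HeightOneSpectrum R) :
    Nat.card (IsLocalRing.ResidueField (valuationSubringAtPrime F v)) =
      Nat.card (R ⧸ v.asIdeal) := by
  have := v.isMaximal
  exact (Nat.card_congr (IsLocalization.AtPrime.equivQuotMaximalIdeal v.asIdeal
    (valuationSubringAtPrime F v)).toEquiv).symm

lemma fin_mem [Ring.HasFiniteQuotients R] (d : R) (hd : d ≠ 0) :
    {v : HeightOneSpectrum R | d ∈ v.asIdeal}.Finite := by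
  refine Set.Finite.of_finite_image (f := fun v => v.asIdeal)
    ((Ring.HasFiniteQuotients.finite_setOfPred_mem d hd).subset ?_) ?_
  · rintro _ ⟨v, hv, rfl⟩
    exact hv
  · intro v _ w _ h
    exact HeightOneSpectrum.ext h

lemma mem_of_mul {v : HeightOneSpectrum R} {d : R} (hd : d ∉ v.asIdeal) {x : F}
    (hx : ∃ a : R, algebraMap R F d * x = algebraMap R F a) :
    x ∈ valuationSubringAtPrime F v := by
  obtain ⟨a, ha⟩ := hx
  rw [mem_vs]
  have h1 : v.valuation F (algebraMap R F d) = 1 := v.valuation_eq_one_iff_notMem.2 hd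
  have h2 : v.valuation F (algebraMap R F a) ≤ 1 := v.valuation_le_one (K := F) a
  rw [← ha, map_mul, h1, one_mul] at h2
  exact h2

lemma ae_vs [Ring.HasFiniteQuotients R] (x : F) :
    {v : HeightOneSpectrum R | x ∉ valuationSubringAtPrime F v}.Finite := by
  obtain ⟨⟨a, d⟩, h⟩ := IsLocalization.surj (nonZeroDivisors R) x
  refine (fin_mem (d : R) (nonZeroDivisors.coe_ne_zero d)).subset fun v hv => ?_
  by_contra hd
  exact hv (mem_of_mul hd ⟨a, by rw [mul_comm]; exact h⟩)

lemma approx [Ring.HasFiniteQuotients R] (g : HeightOneSpectrum R → F)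
    (hg : {v | g v ∉ valuationSubringAtPrime F v}.Finite) :
    ∃ x : F, ∀ v, x - g v ∈ valuationSubringAtPrime F v := by
  classical
  obtain ⟨d, hd⟩ := IsLocalization.exist_integer_multiples_of_finset (nonZeroDivisors R)
    (hg.toFinset.image g)
  have hd0 := nonZeroDivisors.coe_ne_zero d
  have hT := (hg.union (fin_mem (d : R) hd0))
  set T := hT.toFinset
  have h1 : ∀ v, ∃ a : R, algebraMap R F d * (if g v ∈ valuationSubringAtPrime F v then 0 else g v)
      = algebraMap R F a := by
    intro v
    split_ifs with h
    · exact ⟨0, by simp⟩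
    · obtain ⟨a, ha⟩ := hd (g v) (by
        simp only [Finset.mem_image, Set.Finite.mem_toFinset]
        exact ⟨v, h, rfl⟩)
      exact ⟨a, by rw [ha, Algebra.smul_def]⟩
  choose a ha using h1
  have hdF : algebraMap R F d ≠ 0 := by
    simp
  have h2 : ∀ v : HeightOneSpectrum R, ∃ n : ℕ, WithZero.exp (-(n : ℤ)) ≤
      v.intValuation (d : R) := by
    intro v
    exact ⟨_, (intValuation_if_neg v hd0).ge⟩
  choose n hn using h2
  obtain ⟨y, hy⟩ := IsDedekindDomain.exists_forall_sub_mem_ideal (s := T)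
    (fun v : HeightOneSpectrum R => v.asIdeal) n (fun v _ => v.prime)
    (fun v _ w _ h h' => h (HeightOneSpectrum.ext h')) (fun v => a v)
  refine ⟨algebraMap R F y / algebraMap R F d, fun v => ?_⟩
  have key : algebraMap R F y / algebraMap R F d -
      (if g v ∈ valuationSubringAtPrime F v then 0 else g v) ∈ valuationSubringAtPrime F v := by
    by_cases hv : v ∈ T
    · have h3 := hy v hv
      have h4 : algebraMap R F y / algebraMap R F d -
        (if g v ∈ valuationSubringAtPrime F v then 0 else g v) =
          algebraMap R F (y - a v) / algebraMap R F d := by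
        rw [map_sub, ← ha]; field_simp
      rw [h4, mem_vs, map_div₀, valuation_of_algebraMap, valuation_of_algebraMap]
      refine div_le_one_of_le₀ (le_trans ?_ (hn v)) zero_le
      exact (v.intValuation_le_pow_iff_mem _ _).2 h3
    · have hv' : ¬ (g v ∉ valuationSubringAtPrime F v ∨ (d : R) ∈ v.asIdeal) := by
        intro h; exact hv ((Set.Finite.mem_toFinset hT).2 h)
      push Not at hv'
      rw [if_pos hv'.1, sub_zero]
      exact mem_of_mul hv'.2 ⟨y, by field_simp⟩
  by_cases h : g v ∈ valuationSubringAtPrime F v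
  · rw [if_pos h, sub_zero] at key
    exact sub_mem key h
  · rwa [if_neg h] at key

lemma center (W : ValuationSubring F) (hR : ∀ r : R, algebraMap R F r ∈ W) :
    W = ⊤ ∨ ∃ v : HeightOneSpectrum R, valuationSubringAtPrime F v ≤ W ∧
      ∀ r : R, r ∈ v.asIdeal ↔ W.valuation (algebraMap R F r) < 1 := by
  let φ : R →+* W := (algebraMap R F).codRestrict W.toSubring hR
  let P : Ideal R := (IsLocalRing.maximalIdeal W).comap φ
  have hP : ∀ r : R, r ∈ P ↔ W.valuation (algebraMap R F r) < 1 := by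
    intro r
    exact (W.valuation_lt_one_iff (φ r))
  have hunit : ∀ s : R, s ∉ P → (algebraMap R F s)⁻¹ ∈ W := by
    intro s hs
    rw [hP, not_lt] at hs
    rw [← W.valuation_le_one_iff, map_inv₀]
    exact inv_le_one_of_one_le₀ hs
  by_cases hb : P = ⊥
  · left
    rw [eq_top_iff]
    intro x _
    obtain ⟨a, d, hd, rfl⟩ := IsFractionRing.div_surjective (A := R) x
    rw [div_eq_mul_inv]
    refine mul_mem (hR a) (hunit d ?_)
    rw [hb]
    exact fun h => nonZeroDivisors.ne_zero hd h
  · right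
    refine ⟨⟨P, inferInstance, hb⟩, fun x hx => ?_, hP⟩
    rw [mem_vs] at hx
    obtain ⟨n, d, h⟩ := exists_primeCompl_mul_eq_of_integer _ x hx
    have hd : algebraMap R F d ≠ 0 := by
      intro h0
      have : (d : R) = 0 := by simpa using h0
      exact d.2 (by rw [this]; exact zero_mem _)
    rw [← eq_div_iff hd, div_eq_mul_inv] at h
    rw [h]
    exact mul_mem (hR n) (hunit _ d.2)
end ded
end B1
end

section
namespace B1
open IsDedekindDomain HeightOneSpectrum Polynomial
open scoped IntermediateField.algebraAdjoinAdjoin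

section poly
variable {k F : Type u} [Field k] [Field F] [Algebra k F]

/-- The affine coordinate ring attached to `x`. -/
abbrev CR (k : Type u) {F : Type u} [Field k] [Field F] [Algebra k F] (x : F) :=
  integralClosure (Algebra.adjoin k ({x} : Set F)) F

lemma hfq_poly [Finite k] : Ring.HasFiniteQuotients k[X] where
  finiteQuotient {I} hI := by
    obtain ⟨g, rfl⟩ := (IsPrincipalIdealRing.principal I).principal
    have hg : g ≠ 0 := fun h => hI (by rw [h]; simp)
    have : Module.Finite k (AdjoinRoot g) := (AdjoinRoot.powerBasis hg).finite
    exact Module.finite_of_finite k (M := AdjoinRoot g)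

lemma hfq_congr {A B : Type u} [CommRing A] [CommRing B] [IsDomain B] (e : A ≃+* B)
    (h : Ring.HasFiniteQuotients A) : Ring.HasFiniteQuotients B := by
  let _ := e.toRingHom.toAlgebra
  have : Module.Finite A B := Module.Finite.of_surjective (Algebra.linearMap A B) e.surjective
  exact Ring.HasFiniteQuotients.of_module_finite A B

variable (x : F)

lemma adj_pid (hx : Transcendental k x) :
    IsPrincipalIdealRing (Algebra.adjoin k ({x} : Set F)) :=
  IsPrincipalIdealRing.of_surjective (Polynomial.algEquivOfTranscendental k x hx).toRingEquiv.toRingHom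
    (Polynomial.algEquivOfTranscendental k x hx).surjective

lemma CR_le (W : ValuationSubring F) (hk : ∀ c : k, algebraMap k F c ∈ W) {x : F} (hxW : x ∈ W)
    (r : CR k x) : algebraMap (CR k x) F r ∈ W := by
  have hA : ∀ a : Algebra.adjoin k ({x} : Set F), (a : F) ∈ W := by
    rintro ⟨a, ha⟩
    induction ha using Algebra.adjoin_induction with
    | mem y hy =>
      change y ∈ W
      rw [Set.mem_singleton_iff.1 hy]; exact hxW
    | algebraMap c => exact hk c
    | add a b _ _ h1 h2 => exact add_mem h1 h2
    | mul a b _ _ h1 h2 => exact mul_mem h1 h2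
  let φ : Algebra.adjoin k ({x} : Set F) →+* W :=
    (algebraMap (Algebra.adjoin k ({x} : Set F)) F).codRestrict W.toSubring hA
  obtain ⟨q, hq, hq0⟩ := r.2
  have : IsIntegral W (r : F) := by
    refine ⟨q.map φ, hq.map φ, ?_⟩
    rw [Polynomial.eval₂_map]
    exact hq0
  obtain ⟨z, hz⟩ := IsIntegrallyClosed.isIntegral_iff.1 this
  change (r : F) ∈ W
  rw [← hz]
  exact z.2

lemma CR_x : ∃ r : CR k x, algebraMap (CR k x) F r = x :=
  ⟨algebraMap (Algebra.adjoin k ({x} : Set F)) (CR k x) ⟨x, Algebra.self_mem_adjoin_singleton k x⟩,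
    rfl⟩

lemma CR_k (c : k) : ∃ r : CR k x, algebraMap (CR k x) F r = algebraMap k F c :=
  ⟨algebraMap (Algebra.adjoin k ({x} : Set F)) (CR k x) (algebraMap k _ c), rfl⟩

lemma CR_exists (hx : Transcendental k x) : Nonempty (HeightOneSpectrum (CR k x)) := by
  have h1 : ¬ IsField (CR k x) := by
    intro h
    have h2 : IsField (Algebra.adjoin k ({x} : Set F)) :=
      isField_of_isIntegral_of_isField (R := Algebra.adjoin k ({x} : Set F)) (S := CR k x)
        (fun a b hab => Subtype.ext (congrArg (Subtype.val : CR k x → F) hab)) h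
    exact Polynomial.not_isField k
      (MulEquiv.isField h2 (Polynomial.algEquivOfTranscendental k x hx).toRingEquiv.toMulEquiv)
  obtain ⟨M, hM⟩ := Ideal.exists_maximal (CR k x)
  exact ⟨⟨M, hM.isPrime, Ring.ne_bot_of_isMaximal_of_not_isField hM h1⟩⟩

lemma frac_bdd (W : ValuationSubring F) (hk : ∀ c : k, algebraMap k F c ∈ W) (hxW : x ∉ W)
    (N M : k[X]) (hM : M ≠ 0) (hNM : N.degree < M.degree) : aeval x N / aeval x M ∈ W := by
  have htriv : W.valuation.IsTrivialOn k := ⟨fun c hc => by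
    have h1 := (W.valuation_le_one_iff _).2 (hk c)
    have h2 := (W.valuation_le_one_iff _).2 (hk c⁻¹)
    rw [map_inv₀, map_inv₀] at h2
    have h3 : W.valuation (algebraMap k F c) ≠ 0 := by simpa using hc
    exact le_antisymm h1 ((inv_le_one₀ (zero_lt_iff.2 h3)).1 h2)⟩
  have hpos : 1 < W.valuation x := by
    rw [← not_le, W.valuation_le_one_iff]; exact hxW
  by_cases hN : N = 0
  · simp [hN, zero_mem]
  rw [← W.valuation_le_one_iff, map_div₀,
    valuation_aeval_eq_valuation_X_pow_natDegree_of_one_lt_valuation_X _ hpos hN,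
    valuation_aeval_eq_valuation_X_pow_natDegree_of_one_lt_valuation_X _ hpos hM]
  exact div_le_one_of_le₀ (pow_le_pow_right₀ hpos.le (natDegree_le_natDegree hNM.le)) zero_le

variable [FiniteDimensional (IntermediateField.adjoin k ({x} : Set F)) F]
  [Algebra.IsSeparable (IntermediateField.adjoin k ({x} : Set F)) F]

lemma CR_ded (hx : Transcendental k x) : IsDedekindDomain (CR k x) := by
  have := adj_pid x hx
  exact integralClosure.isDedekindDomain (Algebra.adjoin k ({x} : Set F))
    (IntermediateField.adjoin k ({x} : Set F)) F

lemma CR_frac (hx : Transcendental k x) : IsFractionRing (CR k x) F := by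
  have := adj_pid x hx
  exact integralClosure.isFractionRing_of_finite_extension
    (IntermediateField.adjoin k ({x} : Set F)) F

lemma CR_hfq [Finite k] (hx : Transcendental k x) : Ring.HasFiniteQuotients (CR k x) := by
  have := adj_pid x hx
  have := hfq_congr (Polynomial.algEquivOfTranscendental k x hx).toRingEquiv hfq_poly
  have : Module.Finite (Algebra.adjoin k ({x} : Set F)) (CR k x) :=
    IsIntegralClosure.finite (Algebra.adjoin k ({x} : Set F))
      (IntermediateField.adjoin k ({x} : Set F)) F _
  exact Ring.HasFiniteQuotients.of_module_finite (Algebra.adjoin k ({x} : Set F)) (CR k x)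

lemma CR_decomp (hx : Transcendental k x) : ∃ (s : Finset F), ∀ w : F, ∃ (r : CR k x) (e : F → F),
    w = algebraMap (CR k x) F r + ∑ b ∈ s, e b * b ∧
    ∀ W : ValuationSubring F, (∀ c : k, algebraMap k F c ∈ W) → x ∉ W → ∀ b ∈ s, e b ∈ W := by
  obtain ⟨s, b, hb⟩ := FiniteDimensional.exists_is_basis_integral
    (Algebra.adjoin k ({x} : Set F)) (IntermediateField.adjoin k ({x} : Set F)) F
  classical
  have hK : ∀ c : IntermediateField.adjoin k ({x} : Set F), ∃ (r : CR k x) (e : F),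
      (c : F) = algebraMap (CR k x) F r + e ∧ ∀ W : ValuationSubring F,
      (∀ c : k, algebraMap k F c ∈ W) → x ∉ W → e ∈ W := by
    intro c
    obtain ⟨N, M, h⟩ := IntermediateField.mem_adjoin_simple_iff k (c : F) |>.1 c.2
    by_cases hM : M = 0
    · refine ⟨0, 0, ?_, fun W _ _ => zero_mem W⟩
      rw [h, hM]; simp
    have hMx : aeval x M ≠ 0 := fun h0 => hM (by
      by_contra h1; exact hx ⟨M, h1, h0⟩)
    refine ⟨algebraMap (Algebra.adjoin k ({x} : Set F)) (CR k x)
      ⟨aeval x (N / M), aeval_mem_adjoin_singleton k x⟩, aeval x (N % M) / aeval x M, ?_, ?_⟩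
    · change (c : F) = aeval x (N / M) + _
      rw [h, eq_comm]
      field_simp
      rw [← map_mul, ← map_add, mul_comm, EuclideanDomain.div_add_mod]
    · intro W hk hxW
      exact frac_bdd x W hk hxW _ _ hM (EuclideanDomain.mod_lt _ hM)
  choose r e h1 h2 using hK
  refine ⟨Finset.univ.image b, fun w => ?_⟩
  refine ⟨∑ i, r (b.repr w i) * ⟨b i, hb i⟩, fun y => if h : ∃ i, b i = y then
    e (b.repr w h.choose) else 0, ?_, ?_⟩
  · rw [Finset.sum_image (fun i _ j _ h => b.injective h)]
    have : ∀ i, (if h : ∃ j, b j = b i then e (b.repr w h.choose) else 0) = e (b.repr w i) := by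
      intro i
      have h : ∃ j, b j = b i := ⟨i, rfl⟩
      rw [dif_pos h, b.injective h.choose_spec]
    simp only [this]
    rw [map_sum, ← Finset.sum_add_distrib]
    conv_lhs => rw [← b.sum_repr w]
    refine Finset.sum_congr rfl fun i _ => ?_
    rw [map_mul, Algebra.smul_def]
    change ((b.repr w i : IntermediateField.adjoin k ({x} : Set F)) : F) * b i = _ * b i + _
    rw [h1 (b.repr w i)]
    ring
  · intro W hk hxW y hy
    dsimp only
    split_ifs
    · exact h2 _ W hk hxW
    · exact zero_mem W
end poly
end B1
end

section
namespace B1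
open IsDedekindDomain HeightOneSpectrum Polynomial

lemma integral_mem {k F : Type u} [Field k] [Field F] [Algebra k F] (W : ValuationSubring F)
    (hk : ∀ c : k, algebraMap k F c ∈ W) {z : F} (hz : IsIntegral k z) : z ∈ W := by
  let φ : k →+* W := (algebraMap k F).codRestrict W.toSubring hk
  obtain ⟨q, hq, hq0⟩ := hz
  have : IsIntegral W z := by
    refine ⟨q.map φ, hq.map φ, ?_⟩
    rw [Polynomial.eval₂_map]
    exact hq0
  obtain ⟨w, hw⟩ := IsIntegrallyClosed.isIntegral_iff.1 this
  rw [← hw]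
  exact w.2

lemma integral_of_mem {k F : Type u} [Field k] [Field F] [Algebra k F] {z : F}
    (h : ∀ W : ValuationSubring F, (∀ c : k, algebraMap k F c ∈ W) → z ∈ W) : IsIntegral k z := by
  have h1 : z ∈ (integralClosure (Subring.closure ((algebraMap k F).range : Set F)) F).toSubring := by
    rw [← iInf_valuationSubring_superset, Subring.mem_iInf]
    rintro ⟨W, hW⟩
    exact h W fun c => hW ⟨c, rfl⟩
  have h2 : IsIntegral (Subring.closure ((algebraMap k F).range : Set F)) z := h1
  rw [Subring.closure_eq] at h2
  obtain ⟨q, hq, hq0⟩ := h2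
  obtain ⟨q', h3, -, h5⟩ := Polynomial.lifts_and_natDegree_eq_and_monic
    (f := (algebraMap k F).rangeRestrict)
    ((Polynomial.mem_lifts _).2 (Polynomial.map_surjective _ (RingHom.rangeRestrict_surjective _) q)) hq
  refine ⟨q', h5, ?_⟩
  rw [← h3, Polynomial.eval₂_map] at hq0
  exact hq0

lemma card_pow {p : ℕ} (hp : p.Prime) {R : Type u} [CommRing R] [IsDedekindDomain R]
    [Ring.HasFiniteQuotients R] (hpR : (p : R) = 0) (v : HeightOneSpectrum R) :
    ∃ n : ℕ, 0 < n ∧ Nat.card (R ⧸ v.asIdeal) = p ^ n := by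
  have := v.isMaximal
  let _ := Ideal.Quotient.field v.asIdeal
  have : Finite (R ⧸ v.asIdeal) := Ring.HasFiniteQuotients.finiteQuotient v.ne_bot
  have := Fintype.ofFinite (R ⧸ v.asIdeal)
  have : Fact p.Prime := ⟨hp⟩
  have : CharP (R ⧸ v.asIdeal) p := by
    refine (CharP.charP_iff_prime_eq_zero hp).2 ?_
    rw [← map_natCast (Ideal.Quotient.mk v.asIdeal), hpR, map_zero]
  obtain ⟨n, -, hn⟩ := FiniteField.card (R ⧸ v.asIdeal) p
  exact ⟨n, n.pos, by rw [Nat.card_eq_fintype_card, hn]⟩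

lemma fin_sum {α β : Type u} [Finite β] {S : Set (α ⊕ β)} (h : (Sum.inl ⁻¹' S).Finite) :
    S.Finite :=
  Set.finite_preimage_inl_and_inr.1 ⟨h, Set.toFinite _⟩

theorem curve_of_pieces (k F R R' : Type u) [Field k] [Finite k] [Field F] [Algebra k F]
    [CommRing R] [IsDedekindDomain R] [Ring.HasFiniteQuotients R] [Algebra R F] [IsFractionRing R F]
    [CommRing R'] [IsDedekindDomain R'] [Ring.HasFiniteQuotients R'] [Algebra R' F]
    [IsFractionRing R' F] (x : F) (hx0 : x ≠ 0)
    (hk1 : ∀ c : k, ∃ r : R, algebraMap R F r = algebraMap k F c)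
    (hk2 : ∀ c : k, ∃ r : R', algebraMap R' F r = algebraMap k F c)
    (hR : ∀ W : ValuationSubring F, (∀ c : k, algebraMap k F c ∈ W) → x ∈ W →
      ∀ r : R, algebraMap R F r ∈ W)
    (hR' : ∀ W : ValuationSubring F, (∀ c : k, algebraMap k F c ∈ W) → x⁻¹ ∈ W →
      ∀ r : R', algebraMap R' F r ∈ W)
    (y : R') (hy : algebraMap R' F y = x⁻¹) (hne : Nonempty (HeightOneSpectrum R))
    (hdec : ∃ (s : Finset F), ∀ w : F, ∃ (r : R) (e : F → F),
      w = algebraMap R F r + ∑ b ∈ s, e b * b ∧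
      ∀ W : ValuationSubring F, (∀ c : k, algebraMap k F c ∈ W) → x ∉ W → ∀ b ∈ s, e b ∈ W) :
    ∃ (p : ℕ) (ι : Type u) (O : ι → ValuationSubring F) (f : ι → ℕ) (ϖ : ι → Fˣ),
      CurveData F p O f ϖ ∧ ∀ v (c : k), algebraMap k F c ∈ O v := by
  classical
  let p := ringChar k
  have hp : p.Prime := (CharP.char_is_prime_or_zero k p).resolve_right
    (CharP.char_ne_zero_of_finite k p)
  have hpF : (p : F) = 0 := by
    rw [← map_natCast (algebraMap k F), CharP.cast_eq_zero, map_zero]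
  have hpR : (p : R) = 0 := IsFractionRing.injective R F (by rw [map_natCast, hpF, map_zero])
  have hpR' : (p : R') = 0 := IsFractionRing.injective R' F (by rw [map_natCast, hpF, map_zero])
  have hy0 : y ≠ 0 := by
    rintro rfl
    rw [map_zero] at hy
    exact inv_ne_zero hx0 hy.symm
  have hfy := fin_mem y hy0
  have hfin : Finite {q : HeightOneSpectrum R' // y ∈ q.asIdeal} := hfy
  let O : HeightOneSpectrum R ⊕ {q : HeightOneSpectrum R' // y ∈ q.asIdeal} → ValuationSubring F :=
    Sum.elim (fun v => valuationSubringAtPrime F v) (fun q => valuationSubringAtPrime F q.1)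
  have hmemR : ∀ (v : HeightOneSpectrum R) (r : R), algebraMap R F r ∈ valuationSubringAtPrime F v :=
    fun v r => (mem_vs v _).2 (v.valuation_le_one r)
  have hmemR' : ∀ (v : HeightOneSpectrum R') (r : R'),
    algebraMap R' F r ∈ valuationSubringAtPrime F v :=
    fun v r => (mem_vs v _).2 (v.valuation_le_one r)
  have hkO : ∀ i (c : k), algebraMap k F c ∈ O i := by
    rintro (v | q) c
    · obtain ⟨r, hr⟩ := hk1 c
      rw [← hr]; exact hmemR v r
    · obtain ⟨r, hr⟩ := hk2 c
      rw [← hr]; exact hmemR' q.1 r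
  have hcard : ∀ i, ∃ n : ℕ, 0 < n ∧ Nat.card (IsLocalRing.ResidueField (O i)) = p ^ n := by
    rintro (v | q)
    · obtain ⟨n, h0, h⟩ := card_pow hp hpR v
      exact ⟨n, h0, (card_vs v).trans h⟩
    · obtain ⟨n, h0, h⟩ := card_pow hp hpR' q.1
      exact ⟨n, h0, (card_vs q.1).trans h⟩
  have hun : ∀ i, ∃ ϖ : Fˣ, ∃ h : (ϖ : F) ∈ O i, Irreducible (⟨ϖ, h⟩ : O i) := by
    rintro (v | q)
    · exact unif_vs v
    · exact unif_vs q.1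
  choose f hfpos hf using hcard
  choose ϖ hϖ using hun
  have hxq : ∀ q : {q : HeightOneSpectrum R' // y ∈ q.asIdeal}, x ∉ O (Sum.inr q) := by
    intro q hq
    have h1 : q.1.valuation F x ≤ 1 := (mem_vs q.1 x).1 hq
    have h2 : q.1.valuation F (algebraMap R' F y) < 1 := (q.1.valuation_lt_one_iff_mem y).2 q.2
    rw [hy, map_inv₀] at h2
    exact absurd h1 (not_le.2 ((inv_lt_one₀ (zero_lt_iff.2 (by simpa using hx0))).1 h2))
  have hall : ∀ z : F, (∀ i, z ∈ O i) → IsIntegral k z := by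
    intro z hz
    refine integral_of_mem fun W hW => ?_
    by_cases hxW : x ∈ W
    · rcases center W (hR W hW hxW) with h | ⟨v, hv, -⟩
      · rw [h]; trivial
      · exact hv (hz (Sum.inl v))
    · have hyW : x⁻¹ ∈ W := (W.mem_or_inv_mem x).resolve_left hxW
      rcases center W (hR' W hW hyW) with h | ⟨v, hv, hv2⟩
      · rw [h]; trivial
      · refine hv (hz (Sum.inr ⟨v, ?_⟩))
        rw [hv2, hy, map_inv₀]
        refine (inv_lt_one₀ (zero_lt_iff.2 (by simpa using hx0))).2 ?_
        rw [← not_le, W.valuation_le_one_iff]; exact hxW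
  refine ⟨p, _, O, f, ϖ, ⟨hp, ?_, hϖ, hfpos, hf, ?_, ?_, ?_, ?_, ?_⟩, hkO⟩
  · rintro (v | q)
    · exact dvr_vs v
    · exact dvr_vs q.1
  · exact hne.map Sum.inl
  · intro d
    refine fin_sum ((Ring.HasFiniteQuotients.finite_cardQuot_heightOneSpectrum_le
      (R := R) (p ^ d)).subset fun v hv => ?_)
    change v.asIdeal.cardQuot ≤ p ^ d
    rw [Submodule.cardQuot_apply]
    have h1 : Nat.card (R ⧸ v.asIdeal) = p ^ f (Sum.inl v) :=
      (card_vs (F := F) v).symm.trans (hf (Sum.inl v))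
    exact h1.le.trans (Nat.pow_le_pow_right hp.pos hv)
  · intro z
    exact fin_sum (ae_vs (R := R) z)
  · obtain ⟨v0⟩ := hne
    have : Finite (IsLocalRing.ResidueField (O (Sum.inl v0))) := by
      refine Nat.finite_of_card_ne_zero ?_
      rw [hf]
      exact pow_ne_zero _ hp.ne_zero
    have hinj : Function.Injective (fun z : {z : F // ∀ i, z ∈ O i} =>
        IsLocalRing.residue (O (Sum.inl v0)) ⟨z.1, z.2 _⟩) := by
      rintro ⟨a, ha⟩ ⟨b, hb⟩ hab
      by_contra hne
      have hu0 : a - b ≠ 0 := fun h => hne (Subtype.ext (sub_eq_zero.1 h))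
      have hu : ∀ i, a - b ∈ O i := fun i => sub_mem (ha i) (hb i)
      have hui : (a - b)⁻¹ ∈ O (Sum.inl v0) := integral_mem _ (hkO _) (hall _ hu).inv
      have h1 := sub_eq_zero.2 hab
      dsimp only at h1
      rw [← map_sub, IsLocalRing.residue_eq_zero_iff, IsLocalRing.mem_maximalIdeal] at h1
      refine h1 (IsUnit.of_mul_eq_one ⟨(a - b)⁻¹, hui⟩ (Subtype.ext ?_))
      exact mul_inv_cancel₀ hu0
    have hfs : Finite {z : F // ∀ i, z ∈ O i} := Finite.of_injective _ hinj
    exact hfs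
  · obtain ⟨s, hs⟩ := hdec
    obtain ⟨d, hd⟩ := IsLocalization.exist_integer_multiples_of_finset (nonZeroDivisors R') s
    have hd0 : algebraMap R' F d ≠ 0 := by simp
    refine ⟨Sum.elim (fun _ => 1) (fun _ => algebraMap R' F d), ?_, ?_, ?_⟩
    · refine fin_sum (Set.Finite.subset Set.finite_empty ?_)
      intro v hv
      exact hv rfl
    · rintro (v | q)
      · exact one_ne_zero
      · exact hd0
    · intro g hg
      have hg' : {v : HeightOneSpectrum R | g (Sum.inl v) ∉ valuationSubringAtPrime F v}.Finite :=
        (Set.finite_preimage_inl_and_inr.2 hg).1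
      obtain ⟨z1, hz1⟩ := approx (fun v : HeightOneSpectrum R => g (Sum.inl v)) hg'
      obtain ⟨z2, hz2⟩ := approx (fun v : HeightOneSpectrum R' =>
        if h : y ∈ v.asIdeal then g (Sum.inr ⟨v, h⟩) else 0) (by
          refine hfy.subset fun v hv => ?_
          by_contra h
          have h' : y ∉ v.asIdeal := h
          refine hv ?_
          rw [dif_neg h']
          exact zero_mem _)
      obtain ⟨r, e, hw, he⟩ := hs (z2 - z1)
      refine ⟨z1 + algebraMap R F r, ?_⟩
      rintro (v | q)
      · change 1 * (z1 + algebraMap R F r - g (Sum.inl v)) ∈ valuationSubringAtPrime F v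
        rw [one_mul, add_sub_right_comm]
        exact add_mem (hz1 v) (hmemR v r)
      · change algebraMap R' F d * (z1 + algebraMap R F r - g (Sum.inr q)) ∈
          valuationSubringAtPrime F q.1
        have h1 := hz2 q.1
        rw [dif_pos q.2] at h1
        have h2 : algebraMap R' F d * (z1 + algebraMap R F r - g (Sum.inr q)) =
            algebraMap R' F d * (z2 - g (Sum.inr q)) - ∑ b ∈ s, e b * (algebraMap R' F d * b) := by
          have h3 : ∑ b ∈ s, e b * (algebraMap R' F d * b) =
              algebraMap R' F d * ∑ b ∈ s, e b * b := by
            rw [Finset.mul_sum]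
            exact Finset.sum_congr rfl fun b _ => by ring
          rw [h3]
          have h4 : algebraMap R F r = z2 - z1 - ∑ b ∈ s, e b * b := by rw [hw]; ring
          rw [h4]; ring
        rw [h2]
        refine sub_mem (mul_mem (hmemR' _ _) h1) (sum_mem fun b hb => mul_mem ?_ ?_)
        · exact he _ (hkO (Sum.inr q)) (hxq q) b hb
        · obtain ⟨a, ha⟩ := hd b hb
          have : algebraMap R' F d * b = algebraMap R' F a := by
            rw [ha, Algebra.smul_def]
          rw [this]
          exact hmemR' _ _
end B1
end

section
namespace B1
open IsDedekindDomain HeightOneSpectrum Polynomial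
open scoped IntermediateField.algebraAdjoinAdjoin

lemma sep_gen (k F : Type u) [Field k] [Finite k] [Field F] [Algebra k F]
    (h : IsCurveFunctionField k F) : ∃ x : F, Transcendental k x ∧
      FiniteDimensional (IntermediateField.adjoin k ({x} : Set F)) F ∧
      Algebra.IsSeparable (IntermediateField.adjoin k ({x} : Set F)) F := by
  obtain ⟨⟨s0, hs0⟩, x0, hx0, hal⟩ := h
  have hess : Algebra.EssFiniteType k F :=
    IntermediateField.fg_top_iff.1 ⟨s0, hs0⟩
  have hb0 : IsTranscendenceBasis k (fun _ : Unit => x0) := by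
    refine isTranscendenceBasis_iff_algebraicIndependent_isAlgebraic.2 ⟨?_, ?_⟩
    · exact algebraicIndependent_unique_type_iff.2 hx0
    · rw [Set.range_const]
      exact Algebra.IsAlgebraic.trans _ (IntermediateField.adjoin k ({x0} : Set F)) _
  obtain ⟨s, hs, hsep⟩ := exists_isTranscendenceBasis_and_isSeparable_of_perfectField k F
  have hc := hs.lift_cardinalMk_eq hb0
  have hc1 : s.card = 1 := by
    simpa using hc
  obtain ⟨x, rfl⟩ := Finset.card_eq_one.1 hc1
  rw [Finset.coe_singleton] at hsep
  have htr : Transcendental k x := hs.1.transcendental ⟨x, by simp⟩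
  refine ⟨x, htr, ?_, hsep⟩
  have : Algebra.EssFiniteType (IntermediateField.adjoin k ({x} : Set F)) F :=
    Algebra.EssFiniteType.of_comp k _ F
  exact Algebra.finite_of_essFiniteType_of_isAlgebraic

theorem curve_data (k F : Type u) [Field k] [Finite k] [Field F] [Algebra k F]
    (h : IsCurveFunctionField k F) :
    ∃ (p : ℕ) (ι : Type u) (O : ι → ValuationSubring F) (f : ι → ℕ) (ϖ : ι → Fˣ),
      CurveData F p O f ϖ ∧ ∀ v (c : k), algebraMap k F c ∈ O v := by
  obtain ⟨x, hx, h1, h2⟩ := sep_gen k F h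
  have hx0 : x ≠ 0 := by
    rintro rfl
    exact hx isAlgebraic_zero
  have hy : Transcendental k x⁻¹ := fun h => hx (by simpa using h.inv)
  have hadj : IntermediateField.adjoin k ({x} : Set F) =
      IntermediateField.adjoin k ({x⁻¹} : Set F) := by
    apply le_antisymm
    · rw [IntermediateField.adjoin_simple_le_iff]
      have := inv_mem (IntermediateField.mem_adjoin_simple_self k x⁻¹)
      rwa [inv_inv] at this
    · rw [IntermediateField.adjoin_simple_le_iff]
      exact inv_mem (IntermediateField.mem_adjoin_simple_self k x)
  have h3 : FiniteDimensional (IntermediateField.adjoin k ({x⁻¹} : Set F)) F := by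
    rw [← hadj]; exact h1
  have h4 : Algebra.IsSeparable (IntermediateField.adjoin k ({x⁻¹} : Set F)) F := by
    rw [← hadj]; exact h2
  have := CR_ded x hx
  have := CR_ded x⁻¹ hy
  have := CR_frac x hx
  have := CR_frac x⁻¹ hy
  have := CR_hfq x hx
  have := CR_hfq x⁻¹ hy
  obtain ⟨y, hy'⟩ := CR_x (k := k) x⁻¹
  exact curve_of_pieces k F (CR k x) (CR k x⁻¹) x hx0 (CR_k x) (CR_k x⁻¹)
    (fun W hk hxW => CR_le W hk hxW) (fun W hk hxW => CR_le W hk hxW) y hy' (CR_exists x hx)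
    (CR_decomp x hx)
end B1
end

section
namespace B1
open TensorProduct

section
variable {F : Type u} [Field F] {E : Type u} [DivisionRing E] [Algebra F E]

lemma range_iff (O : ValuationSubring F) (x : F) : x ∈ Set.range (algebraMap O F) ↔ x ∈ O :=
  ⟨fun ⟨y, hy⟩ => hy ▸ y.2, fun h => ⟨⟨x, h⟩, rfl⟩⟩

lemma fg_coord (O : ValuationSubring F) [IsDiscreteValuationRing O] {π : O} (hπ : Irreducible π)
    {m : ℕ} (e : Module.Basis (Fin m) F E) (B : Subalgebra O E) (hB : Module.Finite O B) :
    ∃ k : ℕ, ∀ s ∈ B, ∀ i, (π : F) ^ k * e.repr s i ∈ O := by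
  classical
  obtain ⟨S, hS⟩ := (Module.Finite.iff_fg (N := Subalgebra.toSubmodule B)).mp hB
  obtain ⟨c, hc⟩ := IsLocalization.exist_integer_multiples_of_finset (nonZeroDivisors O)
    ((S ×ˢ (Finset.univ : Finset (Fin m))).image (fun x => e.repr x.1 x.2))
  have hc0 : (c : O) ≠ 0 := nonZeroDivisors.coe_ne_zero c
  obtain ⟨k, u, hu⟩ := IsDiscreteValuationRing.eq_unit_mul_pow_irreducible hc0 hπ
  refine ⟨k, fun s hs => ?_⟩
  have hs' : s ∈ Submodule.span O (S : Set E) := by rw [hS]; exact hs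
  have h1 : (π : F) ^ k = ((↑u⁻¹ : O) : F) * ((c : O) : F) := by
    have : π ^ k = (↑u⁻¹ : O) * (c : O) := by rw [hu, ← mul_assoc, Units.inv_mul, one_mul]
    have h := congrArg (fun x : O => (x : F)) this
    simpa using h
  induction hs' using Submodule.span_induction with
  | mem x hx =>
    intro i
    have h2 := hc (e.repr x i) (Finset.mem_image.mpr ⟨(x, i), by simpa using hx, rfl⟩)
    obtain ⟨y, hy⟩ := h2
    rw [h1, mul_assoc]
    refine O.mul_mem _ _ (↑u⁻¹ : O).2 ?_
    have : ((c : O) : F) * e.repr x i = y := hy.symm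
    rw [this]
    exact y.2
  | zero => intro i; simp
  | add x y hx' hy' hx hy =>
    intro i
    rw [map_add, Finsupp.add_apply, mul_add]
    exact O.add_mem _ _ (hx (hS ▸ hx' : x ∈ Subalgebra.toSubmodule B) i) (hy (hS ▸ hy' : y ∈ Subalgebra.toSubmodule B) i)
  | smul r x hx' hx =>
    intro i
    have : e.repr (r • x) i = (r : F) * e.repr x i := by
      have : r • x = (r : F) • x := rfl
      rw [this, map_smul]; rfl
    rw [this, mul_left_comm]
    exact O.mul_mem _ _ r.2 (hx (hS ▸ hx' : x ∈ Subalgebra.toSubmodule B) i)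

/-- local data needed at one place -/
def LocData (O : ValuationSubring F) (ϖ : Fˣ) (q d : ℕ) {m : ℕ} (e : Module.Basis (Fin m) F E)
    (good : Prop) (𝒜 : Subring E) : Prop :=
  (∃ w : ℕ, w ^ 2 = d ∧ LocOrd 𝒜 (Units.map (algebraMap F E).toMonoidHom ϖ) w q) ∧
  (∀ c ∈ O, algebraMap F E c ∈ 𝒜) ∧
  (good → ∀ s, s ∈ 𝒜 ↔ ∀ i, e.repr s i ∈ O) ∧
  (∃ k : ℕ, ∀ s ∈ 𝒜, ∀ i, (ϖ : F) ^ k * e.repr s i ∈ O)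

lemma ordFam_of_local {ι : Type u} [Nonempty ι] {O : ι → ValuationSubring F} {ϖ : ι → Fˣ} {p d : ℕ} {f : ι → ℕ}
    {m : ℕ} {e : Module.Basis (Fin m) F E} {G : ι → Prop} (hG : ∀ᶠ v in Filter.cofinite, G v)
    (h : ∀ v, ∃ 𝒜 : Subring E, LocData (O v) (ϖ v) (p ^ f v) d e (G v) 𝒜) :
    ∃ n : ℕ, n ^ 2 = d ∧ ∃ 𝒜 : ι → Subring E, OrdFam O ϖ p n f e 𝒜 := by
  choose 𝒜 h1 h2 h3 h4 using h
  obtain ⟨v0⟩ := ‹Nonempty ι›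
  obtain ⟨n, hn, -⟩ := h1 v0
  refine ⟨n, hn, 𝒜, ⟨?_, h2, ?_, h4⟩⟩
  · intro v
    obtain ⟨w, hw, hl⟩ := h1 v
    obtain rfl : w = n := Nat.pow_left_injective (n := 2) (by norm_num) (hw.trans hn.symm)
    exact hl
  · filter_upwards [hG] with v hv
    exact h3 v hv

lemma locData_good {O : ValuationSubring F} [IsDiscreteValuationRing O] {ϖ : Fˣ}
    (hϖ : ∃ h : (ϖ : F) ∈ O, Irreducible (⟨ϖ, h⟩ : O)) {q : ℕ} (hq0 : 0 < q)
    (hq : Nat.card (IsLocalRing.ResidueField O) = q) {m : ℕ} (e : Module.Basis (Fin m) F E)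
    (c : Fin m → Fin m → Fin m → Fin m → F)
    (hc : ∀ k l x, e.repr x k • e l = ∑ i, ∑ j, c k l i j • (e i * x * e j))
    (h1 : ∀ k, e.repr 1 k ∈ O)
    (h2 : ∀ i j k, e.repr (e i * e j) k ∈ O)
    (h3 : ∀ k l i j, c k l i j ∈ O) (G : Prop) :
    ∃ 𝒜 : Subring E, LocData O ϖ q (Module.finrank F E) e G 𝒜 := by
  obtain ⟨hm, hirr⟩ := hϖ
  obtain ⟨B, hB, w, hw, hl⟩ := good_place (F := F) (D := E) hirr hq0 hq e c hc
    (fun k => (range_iff O _).mpr (h1 k)) (fun i j k => (range_iff O _).mpr (h2 i j k))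
    (fun k l i j => (range_iff O _).mpr (h3 k l i j))
    (Units.map (algebraMap F E).toMonoidHom ϖ) rfl
  have hB' : ∀ s, s ∈ B.toSubring ↔ ∀ i, e.repr s i ∈ O := by
    intro s
    refine (hB s).trans (forall_congr' fun i => range_iff O _)
  refine ⟨B.toSubring, ⟨w, hw, hl⟩, ?_, fun _ => hB', 0, ?_⟩
  · intro c hc
    exact B.algebraMap_mem ⟨c, hc⟩
  · intro s hs i
    rw [pow_zero, one_mul]
    exact (hB' s).mp hs i

lemma locData_bad {O : ValuationSubring F} [IsDiscreteValuationRing O] [FiniteDimensional F E] {ϖ : Fˣ}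
    (hϖ : ∃ h : (ϖ : F) ∈ O, Irreducible (⟨ϖ, h⟩ : O)) {q : ℕ} (hq0 : 0 < q)
    (hq : Nat.card (IsLocalRing.ResidueField O) = q) {m : ℕ} (e : Module.Basis (Fin m) F E)
    {D : Type u} [Ring D] [Algebra F D] {s : ℕ} (hs : 0 < s)
    (g : D ≃ₐ[F] Matrix (Fin s) (Fin s) E) (hur : UnramifiedAt F O D) (G : Prop) (hG : ¬ G) :
    ∃ 𝒜 : Subring E, LocData O ϖ q (Module.finrank F E) e G 𝒜 := by
  obtain ⟨hm, hirr⟩ := hϖ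
  obtain ⟨A₀, _, _, ⟨hfree, hfin, -, hcen, hsim⟩, ⟨θ⟩⟩ := hur
  let Θ : F ⊗[O] A₀ ≃ₐ[F] Matrix (Fin s) (Fin s) E := θ.trans g
  let j : A₀ →ₐ[O] Matrix (Fin s) (Fin s) E :=
    (Θ.toAlgHom.restrictScalars O).comp
      (Algebra.TensorProduct.includeRight (R := O) (A := F) (B := A₀))
  have hj : ∀ a, j a = Θ ((1 : F) ⊗ₜ[O] a) := fun _ => rfl
  obtain ⟨B, hB, w, hw, hl⟩ := bad_place (F := F) (E := E) hirr hq0 hq ⟨0, hs⟩ (A₀ := A₀) hcen hsim j (by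
      intro M
      have key : ∀ x : F ⊗[O] A₀, ∃ c : O, c ≠ 0 ∧ ∃ a, c • x = (1 : F) ⊗ₜ[O] a := by
        intro x
        induction x using TensorProduct.induction_on with
        | zero => exact ⟨1, one_ne_zero, 0, by simp⟩
        | tmul t a =>
          obtain ⟨⟨y, c⟩, hc⟩ := IsLocalization.surj (nonZeroDivisors O) t
          refine ⟨c, nonZeroDivisors.coe_ne_zero c, y • a, ?_⟩
          rw [← TensorProduct.smul_tmul, TensorProduct.smul_tmul']
          congr 1
          rw [Algebra.smul_def, Algebra.smul_def, mul_one, mul_comm]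
          exact hc
        | add x y hx hy =>
          obtain ⟨c, hc, a, ha⟩ := hx
          obtain ⟨d, hd, b, hb⟩ := hy
          refine ⟨c * d, mul_ne_zero hc hd, d • a + c • b, ?_⟩
          rw [smul_add, TensorProduct.tmul_add, TensorProduct.tmul_smul, TensorProduct.tmul_smul,
            ← ha, ← hb, smul_smul, smul_smul, mul_comm d c]
      obtain ⟨c, hc, a, ha⟩ := key (Θ.symm M)
      refine ⟨c, hc, a, ?_⟩
      rw [hj, ← ha]
      have h1 : c • Θ.symm M = (c : F) • Θ.symm M := (algebraMap_smul F c _).symm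
      rw [h1, map_smul, AlgEquiv.apply_symm_apply]
      rfl) (by
      have h1 := Θ.toLinearEquiv.finrank_eq
      rw [Module.finrank_baseChange, Module.finrank_matrix] at h1
      rw [h1]
      simp [pow_two])
    (Units.map (algebraMap F E).toMonoidHom ϖ) rfl
  refine ⟨B.toSubring, ⟨w, hw, hl⟩, ?_, fun h => absurd h hG, ?_⟩
  · intro c hc
    exact B.algebraMap_mem ⟨c, hc⟩
  · exact fg_coord O hirr e B hB

theorem assembly {ι : Type u} {O : ι → ValuationSubring F} {ϖ : ι → Fˣ} {p : ℕ} {f : ι → ℕ}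
    (hc : CurveData F p O f ϖ) {D : Type u} [Ring D] [Algebra F D] (hD : IsCSA F D)
    (hur : ∀ v, UnramifiedAt F (O v) D) : IsMatrixAlgebra F D := by
  obtain ⟨hfd, hcen, hsim⟩ := hD
  have : IsArtinianRing D := IsArtinianRing.of_finite F D
  obtain ⟨s, hs, E, _, _, hE, ⟨g⟩⟩ :=
    IsSimpleRing.exists_algEquiv_matrix_divisionRing_finite F D
  have hs0 : 0 < s := Nat.pos_of_ne_zero hs.out
  have hcenE : Algebra.IsCentral F E := by
    refine ⟨fun d hd => ?_⟩
    rw [Subalgebra.mem_center_iff] at hd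
    have h1 : g.symm (Matrix.scalar (Fin s) d) ∈ Subalgebra.center F D := by
      rw [Subalgebra.mem_center_iff]
      intro b
      apply g.injective
      rw [map_mul, map_mul, AlgEquiv.apply_symm_apply]
      exact (Matrix.scalar_commute d (fun r => (hd r).symm) (g b)).symm.eq
    obtain ⟨c, hc⟩ := (Algebra.IsCentral.mem_center_iff F).mp h1
    rw [Algebra.mem_bot]
    refine ⟨c, ?_⟩
    have h2 := congrArg g hc
    rw [AlgEquiv.apply_symm_apply, AlgEquiv.commutes] at h2
    have h3 := congrFun (congrFun h2 ⟨0, hs0⟩) ⟨0, hs0⟩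
    simp only [Matrix.scalar_apply, Matrix.diagonal_apply_eq, Matrix.algebraMap_matrix_apply,
      if_true] at h3
    exact h3.symm
  have hdvr := hc.dvr
  have hne := hc.ne
  have hq0 : ∀ v, 0 < p ^ f v := fun v => pow_pos hc.prime.pos _
  by_cases h1 : Module.finrank F E = 1
  · have hbij : Function.Bijective (algebraMap F E) := by
      refine ⟨(algebraMap F E).injective, fun x => ?_⟩
      obtain ⟨c, hc⟩ := (finrank_eq_one_iff_of_nonzero' (1 : E) one_ne_zero).mp h1 x
      exact ⟨c, by rw [Algebra.algebraMap_eq_smul_one, hc]⟩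
    exact ⟨s, hs0, ⟨g.trans (AlgEquiv.mapMatrix
      (AlgEquiv.ofBijective (Algebra.ofId F E) hbij).symm)⟩⟩
  exfalso
  let e := Module.finBasis F E
  obtain ⟨c, hcc⟩ := exists_coeff e
  have hpos : 0 < Module.finrank F E := Module.finrank_pos
  obtain ⟨n, hn, 𝒜, hA⟩ := ordFam_of_local (O := O) (ϖ := ϖ) (p := p) (f := f)
    (d := Module.finrank F E) (e := e)
    (G := fun v => (∀ k, e.repr 1 k ∈ O v) ∧ (∀ i j k, e.repr (e i * e j) k ∈ O v) ∧
      (∀ k l i j, c k l i j ∈ O v)) (by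
      simp only [Filter.eventually_and, Filter.eventually_all]
      exact ⟨fun _ => hc.ae _, fun _ _ _ => hc.ae _, fun _ _ _ _ => hc.ae _⟩) (by
      intro v
      have := hdvr v
      by_cases hG : (∀ k, e.repr 1 k ∈ O v) ∧ (∀ i j k, e.repr (e i * e j) k ∈ O v) ∧
        (∀ k l i j, c k l i j ∈ O v)
      · exact locData_good (hc.unif v) (hq0 v) (hc.card v) e c hcc hG.1 hG.2.1 hG.2.2 _
      · exact locData_bad (hc.unif v) (hq0 v) (hc.card v) e hs0 g (hur v) _ hG)
  obtain ⟨n', hn', 𝒜', hA'⟩ := ordFam_of_local (O := O) (ϖ := ϖ) (p := p) (f := f)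
    (d := Module.finrank F F) (e := Module.Basis.singleton (Fin 1) F)
    (G := fun v => True) (by simp) (by
      intro v
      have := hdvr v
      refine locData_good (hc.unif v) (hq0 v) (hc.card v) _ (fun _ _ _ _ => 1) ?_ ?_ ?_ ?_ _
      · intro k l x; simp
      · intro k; simp
      · intro i j k; simp
      · intro k l i j; exact (O v).one_mem)
  rw [Module.finrank_self] at hn'
  obtain rfl : n' = 1 := Nat.pow_left_injective (n := 2) (by norm_num) (by simpa using hn')
  refine global_contra hc hA ?_ hA'
  by_contra hlt
  have : n = 0 ∨ n = 1 := by omega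
  rcases this with rfl | rfl
  · rw [← hn] at hpos; simp at hpos
  · exact h1 (by rw [← hn]; rfl)

end
end B1
end

/-!
STATEMENT 3: Every finite field has property B₁: for every proper regular integral
curve `C` over a finite field `k`, the Brauer group `Br(C)` vanishes.
-/

theorem finite_field_isB1 (k : Type u) [Field k] [Finite k] : IsB1 k := by
  intro F _ _ hF D _ _ hD hur
  obtain ⟨p, ι, O, f, ϖ, hc, hk⟩ := B1.curve_data k F hF
  exact B1.assembly hc hD (fun v => hur _ (hk v))
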